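/- Let (a_n)_{n≥1} be a sequence of integers and suppose that the formal power series f(t) = ∑_{n≥1} a_n t^{n-1} ∈ ℤ[[t]] is algebraic over ℚ(t) (i.e., there is a nonzero polynomial P ∈ ℚ[x,y] with P(t, f(t)) = 0). Then every power series y ∈ ℚ[[t]] satisfying the differential equation y'(t) = f(t)·y(t) is algebraic over ℚ(t) if and only if, for all but finitely many prime numbers p, the congruences a_{np} ≡ a_n (mod p) hold for all integers n ≥ 1. -/

import Mathlib

open PowerSeries

/-- A formal power series `g ∈ ℚ[[t]]` is algebraic over `ℚ(t)` if there exists a nonzero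
polynomial `P ∈ ℚ[x][y]` with `P(t, g(t)) = 0` (we evaluate the coefficients, polynomials in
`x = t`, as power series, and substitute `g` for `y`). -/
def IsAlgebraicPS (g : PowerSeries ℚ) : Prop :=
  ∃ P : Polynomial (Polynomial ℚ), P ≠ 0 ∧
    Polynomial.eval₂ Polynomial.coeToPowerSeries.ringHom g P = 0

namespace RankOne
open Polynomial in
/-- Evaluation of a polynomial with coefficients in `ℚ[t]` at a power series. -/
noncomputable abbrev ev (w : PowerSeries ℚ) : (ℚ[X])[X] →+* PowerSeries ℚ :=
  Polynomial.eval₂RingHom Polynomial.coeToPowerSeries.ringHom w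

theorem exists_separable_poly {f : PowerSeries ℚ} (hf : IsAlgebraicPS f) :
    ∃ P : Polynomial (Polynomial ℚ), ev f P = 0 ∧ ev f P.derivative ≠ 0 := by
  classical
  have hex : ∃ n, ∃ P : Polynomial (Polynomial ℚ), P ≠ 0 ∧ ev f P = 0 ∧ P.natDegree = n := by
    obtain ⟨P, h0, hP⟩ := hf
    exact ⟨_, P, h0, hP, rfl⟩
  obtain ⟨P, h0, hP, hn⟩ := Nat.find_spec hex
  refine ⟨P, hP, fun hd => ?_⟩
  by_cases hdeg : P.natDegree = 0
  · rw [Polynomial.natDegree_eq_zero] at hdeg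
    obtain ⟨c, rfl⟩ := hdeg
    simp only [Polynomial.coe_eval₂RingHom, Polynomial.eval₂_C,
      Polynomial.coeToPowerSeries.ringHom_apply, Polynomial.coe_eq_zero_iff] at hP
    exact h0 (by rw [hP, Polynomial.C_0])
  · have hlt := Polynomial.natDegree_derivative_lt hdeg
    refine Nat.find_min hex (m := P.derivative.natDegree) (by omega) ⟨_, ?_, hd, rfl⟩
    intro h
    exact hdeg (Polynomial.derivative_eq_zero.mp h)

theorem X_pow_dvd_of_coe {p : Polynomial ℚ} {n : ℕ}
    (h : (PowerSeries.X : PowerSeries ℚ) ^ n ∣ (p : PowerSeries ℚ)) :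
    (Polynomial.X : Polynomial ℚ) ^ n ∣ p := by
  rw [Polynomial.X_pow_dvd_iff]
  intro d hd
  simpa using (PowerSeries.X_pow_dvd_iff.mp h) d hd

theorem ev_sub_dvd (P : Polynomial (Polynomial ℚ)) (u v : PowerSeries ℚ) :
    u - v ∣ ev u P - ev v P := by
  simpa [Polynomial.eval₂_eq_eval_map] using
    Polynomial.sub_dvd_eval_sub u v (P.map Polynomial.coeToPowerSeries.ringHom)

theorem ev_C_coe (p : Polynomial ℚ) (w : PowerSeries ℚ) :
    ev w (Polynomial.C p) = (p : PowerSeries ℚ) := by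
  simp

theorem coe_eval (P : Polynomial (Polynomial ℚ)) (q : Polynomial ℚ) :
    ((P.eval q : Polynomial ℚ) : PowerSeries ℚ) = ev (q : PowerSeries ℚ) P := by
  have := Polynomial.hom_eval₂ P (RingHom.id _) Polynomial.coeToPowerSeries.ringHom q
  simpa [Polynomial.eval₂_id] using this

/-- Every algebraic power series is, up to an affine change with polynomial coefficients, a
solution of a fixed point equation `w = t * U(t, w)`. -/
theorem exists_fixed_point_form {f : PowerSeries ℚ} (hf : IsAlgebraicPS f) :
    ∃ (q : Polynomial ℚ) (k : ℕ) (U : Polynomial (Polynomial ℚ)) (w : PowerSeries ℚ),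
      f = (q : PowerSeries ℚ) + X ^ k * w ∧ w = X * ev w U := by
  obtain ⟨P, hP, hd⟩ := exists_separable_poly hf
  set K := (ev f P.derivative).order.toNat with hK
  obtain ⟨e, he, he0⟩ : ∃ e, ev f P.derivative = X ^ K * e ∧ constantCoeff e ≠ 0 := by
    refine ⟨_, (PowerSeries.X_pow_order_mul_divXPowOrder).symm, ?_⟩
    simpa [PowerSeries.constantCoeff_divXPowOrder_eq_zero_iff] using hd
  set q : Polynomial ℚ := trunc (K + 1) f
  obtain ⟨w', hw'⟩ : X ^ (K + 1) ∣ f - (q : PowerSeries ℚ) := by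
    rw [PowerSeries.X_pow_dvd_iff]
    intro m hm
    simp [q, coeff_trunc, hm]
  have hfq : f = (q : PowerSeries ℚ) + X ^ (K + 1) * w' := by rw [← hw']; ring
  obtain ⟨z, hz⟩ := ev_sub_dvd P.derivative f q
  obtain ⟨d, hdd⟩ : (Polynomial.X : Polynomial ℚ) ^ K ∣ P.derivative.eval q := by
    apply X_pow_dvd_of_coe
    rw [coe_eval]
    refine ⟨e - PowerSeries.X * w' * z, ?_⟩
    rw [hw'] at hz
    linear_combination he - hz
  have hdq : (d : PowerSeries ℚ) = e - X * w' * z := by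
    have h1 : X ^ K * (d : PowerSeries ℚ) = X ^ K * (e - X * w' * z) := by
      have := congrArg (fun p : Polynomial ℚ => (p : PowerSeries ℚ)) hdd
      simp only [coe_eval, Polynomial.coe_mul, Polynomial.coe_pow, Polynomial.coe_X] at this
      rw [← this]
      rw [hw'] at hz
      linear_combination he - hz
    exact mul_left_cancel₀ (pow_ne_zero _ X_ne_zero) h1
  have hd0 : d.coeff 0 ≠ 0 := by
    have := congrArg (constantCoeff (R := ℚ)) hdq
    simp only [map_sub, map_mul, constantCoeff_X, zero_mul, sub_zero] at this
    rw [← this] at he0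
    simpa [← coeff_zero_eq_constantCoeff_apply] using he0
  -- Taylor expansion
  set h : Polynomial (Polynomial ℚ) := Polynomial.C (Polynomial.X ^ (K + 1)) * Polynomial.X
  obtain ⟨R, hR⟩ := (P.map Polynomial.C).binomExpansion (Polynomial.C q) h
  have hevh : ev w' h = X ^ (K + 1) * w' := by
    simp only [h, map_mul, ev_C_coe, Polynomial.coe_pow, Polynomial.coe_X]
    simp
  have e1 : ev w' ((P.map Polynomial.C).eval (Polynomial.C q + h)) = ev f P := by
    have := Polynomial.hom_eval₂ P Polynomial.C (ev w') (Polynomial.C q + h)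
    rw [Polynomial.eval_map, this, map_add, hevh, ev_C_coe, ← hfq]
    congr 1
    exact RingHom.ext fun p => ev_C_coe p w'
  have e2 := congrArg (ev w') hR
  rw [e1, hP, Polynomial.derivative_map, Polynomial.eval_map, Polynomial.eval_map,
    Polynomial.eval₂_at_apply, Polynomial.eval₂_at_apply, hdd] at e2
  simp only [map_add, map_mul, map_pow, ev_C_coe, hevh, Polynomial.coe_X] at e2
  obtain ⟨A, hA⟩ : (Polynomial.X : Polynomial ℚ) ^ (2 * K + 1) ∣ P.eval q := by
    apply X_pow_dvd_of_coe
    refine ⟨-((d : PowerSeries ℚ) * w' + X * ev w' R * w' ^ 2), ?_⟩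
    linear_combination -e2
  rw [hA] at e2
  simp only [Polynomial.coe_mul, Polynomial.coe_pow, Polynomial.coe_X] at e2
  have e3 : (A : PowerSeries ℚ) + (d : PowerSeries ℚ) * w' + X * ev w' R * w' ^ 2 = 0 := by
    refine (mul_eq_zero.mp ?_).resolve_left
      (pow_ne_zero (2 * K + 1) (X_ne_zero (R := ℚ)))
    linear_combination -e2
  obtain ⟨A1, hA1⟩ : ∃ A1 : Polynomial ℚ, A = Polynomial.X * A1 + Polynomial.C (A.coeff 0) :=
    ⟨_, (Polynomial.X_mul_divX_add A).symm⟩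
  obtain ⟨d1, hd1⟩ : ∃ d1 : Polynomial ℚ, d = Polynomial.X * d1 + Polynomial.C (d.coeff 0) :=
    ⟨_, (Polynomial.X_mul_divX_add d).symm⟩
  set a0 := A.coeff 0
  set d0 := d.coeff 0
  set U' : Polynomial (Polynomial ℚ) := Polynomial.C (Polynomial.C (-d0⁻¹)) *
    (Polynomial.C A1 + Polynomial.C d1 * Polynomial.X + R * Polynomial.X ^ 2) with hU'
  set w0 : Polynomial ℚ := Polynomial.C (-d0⁻¹ * a0) with hw0
  have hevU : ev w' U' = PowerSeries.C (-d0⁻¹) * ((A1 : PowerSeries ℚ) + (d1 : PowerSeries ℚ) * w' + ev w' R * w' ^ 2) := by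
    simp only [hU', map_add, map_mul, map_pow, ev_C_coe, Polynomial.coe_C]
    simp
  have e4 : w' = (w0 : PowerSeries ℚ) + X * ev w' U' := by
    rw [hevU, hw0]
    rw [hA1, hd1] at e3
    simp only [Polynomial.coe_add, Polynomial.coe_mul, Polynomial.coe_X, Polynomial.coe_C,
      map_mul] at e3 ⊢
    have hc : PowerSeries.C (-d0⁻¹) * PowerSeries.C d0 = (-1 : PowerSeries ℚ) := by
      rw [← map_mul]; simp [hd0]
    linear_combination (-(PowerSeries.C (-d0⁻¹) : PowerSeries ℚ)) * e3 + w' * hc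
  refine ⟨q + Polynomial.X ^ (K + 1) * w0, K + 1, U'.comp (Polynomial.X + Polynomial.C w0),
    w' - w0, ?_, ?_⟩
  · simp only [Polynomial.coe_add, Polynomial.coe_mul, Polynomial.coe_pow, Polynomial.coe_X]
    rw [hfq]; ring
  · have : ev (w' - w0) (U'.comp (Polynomial.X + Polynomial.C w0)) = ev w' U' := by
      rw [Polynomial.coe_eval₂RingHom, Polynomial.eval₂_comp]
      simp
    rw [this]
    linear_combination e4

open scoped ENNReal

/-- A submultiplicative, subadditive function on a ring with values in `[0, ∞]`. -/
structure IsExtNorm {A : Type*} [CommRing A] (ν : A → ℝ≥0∞) : Prop where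
  zero : ν 0 = 0
  one : ν 1 ≤ 1
  neg : ∀ x, ν (-x) ≤ ν x
  add : ∀ x y, ν (x + y) ≤ ν x + ν y
  mul : ∀ x y, ν (x * y) ≤ ν x * ν y

namespace IsExtNorm
variable {A : Type*} [CommRing A] {ν : A → ℝ≥0∞} (h : IsExtNorm ν)
include h

theorem sum_le {ι : Type*} (s : Finset ι) (g : ι → A) :
    ν (∑ i ∈ s, g i) ≤ ∑ i ∈ s, ν (g i) := by
  classical
  induction s using Finset.induction_on with
  | empty => simp [h.zero]
  | insert i s hi ih =>
    rw [Finset.sum_insert hi, Finset.sum_insert hi]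
    exact (h.add _ _).trans (by gcongr)

theorem pow_le (x : A) (n : ℕ) : ν (x ^ n) ≤ ν x ^ n := by
  induction n with
  | zero => simpa using h.one
  | succ n ih =>
    rw [pow_succ, pow_succ]
    exact (h.mul _ _).trans (by gcongr)

/-- The subring of elements of finite norm. -/
def finite : Subring A where
  carrier := {x | ν x < ∞}
  zero_mem' := by simp [h.zero]
  one_mem' := h.one.trans_lt ENNReal.one_lt_top
  neg_mem' hx := (h.neg _).trans_lt hx
  add_mem' hx hy := (h.add _ _).trans_lt (ENNReal.add_lt_top.2 ⟨hx, hy⟩)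
  mul_mem' hx hy := (h.mul _ _).trans_lt (ENNReal.mul_lt_top hx hy)

end IsExtNorm

theorem isExtNorm_enorm : IsExtNorm (fun q : ℚ => ‖q‖ₑ) where
  zero := by simp
  one := by simp
  neg x := by simp
  add x y := enorm_add_le x y
  mul x y := by simp [enorm_mul]

theorem tsum_antidiagonal_mul {M : Type*} [AddMonoid M] [Finset.HasAntidiagonal M]
    (a b : M → ℝ≥0∞) :
    ∑' m, ∑ p ∈ Finset.HasAntidiagonal.antidiagonal m, a p.1 * b p.2 = (∑' m, a m) * ∑' m, b m := by
  have h1 : ∀ m, ∑ p ∈ Finset.HasAntidiagonal.antidiagonal m, a p.1 * b p.2 =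
      ∑' p : Finset.HasAntidiagonal.antidiagonal m, a p.1.1 * b p.1.2 := by
    intro m
    rw [tsum_fintype, ← Finset.sum_coe_sort]
  simp_rw [h1]
  rw [← ENNReal.tsum_sigma' (fun x : (Σ m : M, Finset.HasAntidiagonal.antidiagonal m) =>
      a x.2.1.1 * b x.2.1.2),
    ← (Finset.HasAntidiagonal.sigmaAntidiagonalEquivProd (A := M)).symm.tsum_eq]
  simp only [Finset.HasAntidiagonal.sigmaAntidiagonalEquivProd_symm_apply_snd_coe]
  rw [ENNReal.tsum_prod (f := fun x y => a x * b y)]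
  simp_rw [ENNReal.tsum_mul_left, ENNReal.tsum_mul_right]

/-- The weighted `ℓ¹` norm of a multivariate power series. -/
noncomputable def mvNorm {σ A : Type*} [CommRing A] (ν : A → ℝ≥0∞) (r : ℝ≥0∞)
    (g : MvPowerSeries σ A) : ℝ≥0∞ :=
  ∑' α : σ →₀ ℕ, ν (MvPowerSeries.coeff α g) * r ^ α.degree

theorem mvNorm_C {σ A : Type*} [CommRing A] {ν : A → ℝ≥0∞} (h : IsExtNorm ν) (r : ℝ≥0∞)
    (x : A) : mvNorm (σ := σ) ν r (MvPowerSeries.C x) = ν x := by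
  classical
  unfold mvNorm
  rw [tsum_eq_single 0]
  · simp
  · intro α hα
    rw [MvPowerSeries.coeff_C, if_neg hα, h.zero, zero_mul]

theorem isExtNorm_mvNorm {σ A : Type*} [CommRing A] {ν : A → ℝ≥0∞} (h : IsExtNorm ν)
    (r : ℝ≥0∞) : IsExtNorm (mvNorm (σ := σ) ν r) where
  zero := by simp [mvNorm, h.zero]
  one := by
    rw [← map_one (MvPowerSeries.C (σ := σ) (R := A)), mvNorm_C h]
    exact h.one
  neg x := by
    unfold mvNorm
    refine ENNReal.tsum_le_tsum fun α => ?_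
    rw [map_neg]
    gcongr
    exact h.neg _
  add x y := by
    unfold mvNorm
    rw [← ENNReal.tsum_add]
    refine ENNReal.tsum_le_tsum fun α => ?_
    rw [map_add, ← add_mul]
    gcongr
    exact h.add _ _
  mul x y := by
    classical
    unfold mvNorm
    rw [← tsum_antidiagonal_mul]
    refine ENNReal.tsum_le_tsum fun α => ?_
    rw [MvPowerSeries.coeff_mul]
    refine (mul_le_mul_left (h.sum_le _ _) _).trans ?_
    rw [Finset.sum_mul]
    refine Finset.sum_le_sum fun p hp => ?_
    rw [← Finset.HasAntidiagonal.mem_antidiagonal.mp hp, map_add, pow_add]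
    refine (mul_le_mul_left (h.mul _ _) _).trans (le_of_eq ?_)
    ring

/-- The weighted `ℓ¹` norm of a power series with rational coefficients. -/
noncomputable def psNorm (ρ : ℝ≥0∞) (g : PowerSeries ℚ) : ℝ≥0∞ :=
  mvNorm (fun q : ℚ => ‖q‖ₑ) ρ g

theorem isExtNorm_psNorm (ρ : ℝ≥0∞) : IsExtNorm (psNorm ρ) :=
  isExtNorm_mvNorm isExtNorm_enorm ρ

theorem psNorm_eq (ρ : ℝ≥0∞) (g : PowerSeries ℚ) :
    psNorm ρ g = ∑' k, ‖coeff k g‖ₑ * ρ ^ k := by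
  unfold psNorm mvNorm
  rw [← (Finsupp.uniqueEquiv (M := ℕ) ()).symm.tsum_eq]
  refine tsum_congr fun k => ?_
  have : (Finsupp.uniqueEquiv (M := ℕ) ()).symm k = Finsupp.single () k := by
    ext; simp
  rw [this]
  simp [PowerSeries.coeff]

theorem psNorm_X_mul (ρ : ℝ≥0∞) (g : PowerSeries ℚ) : psNorm ρ (X * g) ≤ ρ * psNorm ρ g := by
  refine ((isExtNorm_psNorm ρ).mul _ _).trans ?_
  gcongr
  rw [psNorm_eq, tsum_eq_single 1]
  · simp
  · intro k hk
    simp [coeff_X, hk]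

theorem psNorm_trunc (ρ : ℝ≥0∞) (g : PowerSeries ℚ) (m : ℕ) :
    psNorm ρ (trunc m g : Polynomial ℚ) = ∑ k ∈ Finset.range m, ‖coeff k g‖ₑ * ρ ^ k := by
  rw [psNorm_eq, tsum_eq_sum (s := Finset.range m)]
  · refine Finset.sum_congr rfl fun k hk => ?_
    rw [Polynomial.coeff_coe, coeff_trunc, if_pos (Finset.mem_range.mp hk)]
  · intro k hk
    rw [Polynomial.coeff_coe, coeff_trunc, if_neg (by simpa using hk)]
    simp

theorem psNorm_poly_lt_top {ρ : ℝ≥0∞} (hρ : ρ ≤ 1) (q : Polynomial ℚ) :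
    psNorm ρ (q : PowerSeries ℚ) < ∞ := by
  rw [psNorm_eq, tsum_eq_sum (s := q.support)]
  · refine ENNReal.sum_lt_top.2 fun k _ => ENNReal.mul_lt_top enorm_lt_top ?_
    exact (pow_le_one₀ zero_le hρ).trans_lt ENNReal.one_lt_top
  · intro k hk
    rw [Polynomial.coeff_coe, Polynomial.notMem_support_iff.mp hk]
    simp

theorem psNorm_mono {ρ ρ' : ℝ≥0∞} (h : ρ ≤ ρ') (g : PowerSeries ℚ) :
    psNorm ρ g ≤ psNorm ρ' g := by
  rw [psNorm_eq, psNorm_eq]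
  gcongr

theorem ev_eq_sum (w : PowerSeries ℚ) (U : Polynomial (Polynomial ℚ)) :
    ev w U = ∑ j ∈ Finset.range (U.natDegree + 1), (U.coeff j : PowerSeries ℚ) * w ^ j := by
  simp [Polynomial.eval₂_eq_sum_range]

theorem X_pow_dvd_sub_trunc (w : PowerSeries ℚ) (m : ℕ) :
    X ^ m ∣ w - ((trunc m w : Polynomial ℚ) : PowerSeries ℚ) := by
  rw [X_pow_dvd_iff]
  intro k hk
  simp [coeff_trunc, hk]

theorem exists_psNorm_lt_top_of_fixed_point {U : Polynomial (Polynomial ℚ)} {w : PowerSeries ℚ}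
    (hw : w = X * ev w U) : ∃ ρ : ℝ≥0∞, 0 < ρ ∧ ρ ≤ 1 ∧ psNorm ρ w < ∞ := by
  set M : ℝ≥0∞ := ∑ j ∈ Finset.range (U.natDegree + 1), psNorm 1 (U.coeff j : PowerSeries ℚ)
    with hM
  have hMt : M < ∞ := ENNReal.sum_lt_top.2 fun j _ => psNorm_poly_lt_top le_rfl _
  set ρ : ℝ≥0∞ := (M + 1)⁻¹ with hρ
  have hρ1 : ρ ≤ 1 := by
    rw [hρ, ENNReal.inv_le_one]
    exact le_add_self
  have hρM : ρ * M ≤ 1 := by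
    rw [hρ, mul_comm, ← div_eq_mul_inv]
    exact ENNReal.div_le_of_le_mul (by rw [one_mul]; exact le_self_add)
  have hev : ∀ z, psNorm ρ z ≤ 1 → psNorm ρ (ev z U) ≤ M := by
    intro z hz
    rw [ev_eq_sum]
    refine ((isExtNorm_psNorm ρ).sum_le _ _).trans (Finset.sum_le_sum fun j _ => ?_)
    refine ((isExtNorm_psNorm ρ).mul _ _).trans ?_
    refine (mul_le_mul' (psNorm_mono hρ1 _) (((isExtNorm_psNorm ρ).pow_le _ _).trans
      (pow_le_one₀ zero_le hz))).trans ?_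
    rw [mul_one]
  have key : ∀ m, psNorm ρ (trunc m w : Polynomial ℚ) ≤ 1 := by
    intro m
    induction m with
    | zero => rw [psNorm_trunc]; simp
    | succ m ih =>
      have h1 : trunc (m + 1) w = trunc (m + 1) (X * ev (trunc m w : Polynomial ℚ) U) := by
        ext k
        rw [coeff_trunc, coeff_trunc]
        split_ifs with hk
        · have h2 : X ^ (m + 1) ∣ w - X * ev (trunc m w : Polynomial ℚ) U := by
            nth_rw 1 [hw]
            rw [← mul_sub, pow_succ']
            exact mul_dvd_mul_left _ ((X_pow_dvd_sub_trunc w m).trans (ev_sub_dvd U _ _))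
          have := X_pow_dvd_iff.mp h2 k hk
          rwa [map_sub, sub_eq_zero] at this
        · rfl
      rw [h1, psNorm_trunc]
      refine (ENNReal.sum_le_tsum _).trans ?_
      rw [← psNorm_eq]
      refine (psNorm_X_mul _ _).trans (le_trans ?_ hρM)
      gcongr
      exact hev _ ih
  refine ⟨ρ, ?_, hρ1, lt_of_le_of_lt ?_ ENNReal.one_lt_top⟩
  · rw [hρ]
    exact ENNReal.inv_pos.2 (ENNReal.add_lt_top.2 ⟨hMt, ENNReal.one_lt_top⟩).ne
  · rw [psNorm_eq]
    refine ENNReal.tsum_le_of_sum_range_le fun m => ?_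
    rw [← psNorm_trunc]
    exact key m

/-- An algebraic power series has a positive radius of convergence. -/
theorem exists_psNorm_lt_top {f : PowerSeries ℚ} (hf : IsAlgebraicPS f) :
    ∃ ρ : ℝ≥0∞, 0 < ρ ∧ ρ ≤ 1 ∧ psNorm ρ f < ∞ := by
  obtain ⟨q, k, U, w, rfl, hw⟩ := exists_fixed_point_form hf
  obtain ⟨ρ, h0, h1, h2⟩ := exists_psNorm_lt_top_of_fixed_point hw
  refine ⟨ρ, h0, h1, ?_⟩
  have hX : psNorm ρ (X ^ k : PowerSeries ℚ) < ∞ := by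
    have := psNorm_poly_lt_top h1 (Polynomial.X ^ k)
    rwa [Polynomial.coe_pow, Polynomial.coe_X] at this
  exact (isExtNorm_psNorm ρ).finite.add_mem (psNorm_poly_lt_top h1 q)
    ((isExtNorm_psNorm ρ).finite.mul_mem hX h2)

/-- The subring of rational numbers which are integers. -/
def intQ : Subring ℚ := (Int.castRingHom ℚ).range

theorem natCast_mem_intQ (n : ℕ) : (n : ℚ) ∈ intQ := ⟨n, by simp⟩

/-- The subring of power series with integral coefficients. -/
def intPS : Subring (PowerSeries ℚ) where
  carrier := {g | ∀ k, coeff k g ∈ intQ}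
  zero_mem' k := by simp
  one_mem' k := by
    rw [coeff_one]
    split_ifs
    · exact one_mem _
    · exact zero_mem _
  neg_mem' h k := by
    rw [map_neg]
    exact neg_mem (h k)
  add_mem' h h' k := by
    rw [map_add]
    exact add_mem (h k) (h' k)
  mul_mem' h h' k := by
    rw [coeff_mul]
    exact sum_mem fun p _ => mul_mem (h _) (h' _)

theorem C_mem_intPS {x : ℚ} (hx : x ∈ intQ) : PowerSeries.C x ∈ intPS := by
  intro k
  rw [coeff_C]
  split_ifs
  · exact hx
  · exact zero_mem _

theorem mul_natCast_mem_intQ_of_den_dvd {x : ℚ} {c : ℕ} (h : x.den ∣ c) : (c : ℚ) * x ∈ intQ := by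
  obtain ⟨d, rfl⟩ := h
  refine ⟨d * x.num, ?_⟩
  simp only [eq_intCast, Int.cast_mul, Int.cast_natCast, Nat.cast_mul]
  nth_rw 3 [← Rat.num_div_den x]
  have : (x.den : ℚ) ≠ 0 := by exact_mod_cast x.den_ne_zero
  field_simp

theorem exists_common_den (q : Polynomial ℚ) :
    ∃ c : ℕ, 0 < c ∧ ∀ i, (c : ℚ) * q.coeff i ∈ intQ := by
  refine ⟨∏ i ∈ q.support, (q.coeff i).den,
    Finset.prod_pos fun i _ => (q.coeff i).den_pos, fun i => ?_⟩
  by_cases hi : i ∈ q.support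
  · exact mul_natCast_mem_intQ_of_den_dvd (Finset.dvd_prod_of_mem (fun i => (q.coeff i).den) hi)
  · rw [Polynomial.notMem_support_iff.mp hi, mul_zero]
    exact zero_mem _

theorem exists_common_den₂ (U : Polynomial (Polynomial ℚ)) :
    ∃ c : ℕ, 0 < c ∧ ∀ j i, (c : ℚ) * (U.coeff j).coeff i ∈ intQ := by
  choose c hc h using fun j => exists_common_den (U.coeff j)
  refine ⟨∏ j ∈ U.support, c j, Finset.prod_pos fun j _ => hc j, fun j i => ?_⟩
  by_cases hj : j ∈ U.support
  · obtain ⟨d, hd⟩ := Finset.dvd_prod_of_mem c hj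
    rw [hd, Nat.cast_mul, mul_comm (c j : ℚ), mul_assoc]
    exact mul_mem (natCast_mem_intQ _) (h j i)
  · rw [Polynomial.notMem_support_iff.mp hj]
    simp

theorem mem_intPS_of_forall_dvd {w : PowerSeries ℚ} (h : ∀ m, ∃ z ∈ intPS, X ^ m ∣ w - z) :
    w ∈ intPS := by
  intro k
  obtain ⟨z, hz, hd⟩ := h (k + 1)
  have := X_pow_dvd_iff.mp hd k (Nat.lt_succ_self k)
  rw [map_sub, sub_eq_zero] at this
  rw [this]
  exact hz k

theorem exists_pow_mul_fixed_point_mem_intQ {U : Polynomial (Polynomial ℚ)} {w : PowerSeries ℚ}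
    (hw : w = X * ev w U) : ∃ c : ℕ, 0 < c ∧ ∀ k, (c : ℚ) ^ k * coeff k w ∈ intQ := by
  obtain ⟨c, hc, hU⟩ := exists_common_den₂ U
  have hc0 : (c : ℚ) ≠ 0 := by exact_mod_cast hc.ne'
  set S : PowerSeries ℚ → PowerSeries ℚ := fun z => ∑ j ∈ Finset.range (U.natDegree + 1),
    (PowerSeries.C (c : ℚ) * rescale ((c : ℚ) ^ 2) (U.coeff j : PowerSeries ℚ)) *
      (PowerSeries.C (c : ℚ) * z) ^ j with hS
  set v := PowerSeries.C (c : ℚ)⁻¹ * rescale ((c : ℚ) ^ 2) w with hv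
  have hCv : PowerSeries.C (c : ℚ) * v = rescale ((c : ℚ) ^ 2) w := by
    rw [hv, ← mul_assoc, ← map_mul, mul_inv_cancel₀ hc0, map_one, one_mul]
  have hvS : v = X * S v := by
    simp only [hS, hCv]
    have h1 := congrArg (rescale ((c : ℚ) ^ 2)) hw
    rw [map_mul, ev_eq_sum, map_sum, rescale_X] at h1
    simp_rw [map_mul, map_pow] at h1
    rw [hv]
    conv_lhs => rw [h1]
    simp_rw [mul_assoc, ← Finset.mul_sum]
    have h2 : PowerSeries.C (c : ℚ)⁻¹ * PowerSeries.C (c : ℚ) = 1 := by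
      rw [← map_mul, inv_mul_cancel₀ hc0, map_one]
    linear_combination (PowerSeries.C (c : ℚ) * X * ∑ i ∈ Finset.range (U.natDegree + 1),
      rescale ((c : ℚ) ^ 2) (U.coeff i : PowerSeries ℚ) * rescale ((c : ℚ) ^ 2) w ^ i) * h2
  have hSint : ∀ z ∈ intPS, S z ∈ intPS := by
    intro z hz
    refine sum_mem fun j _ => mul_mem ?_ (pow_mem (mul_mem (C_mem_intPS (natCast_mem_intQ c)) hz) j)
    intro k
    rw [coeff_C_mul, coeff_rescale, Polynomial.coeff_coe, ← mul_assoc, mul_comm (c : ℚ), mul_assoc]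
    exact mul_mem (pow_mem (pow_mem (natCast_mem_intQ c) _) _) (hU j k)
  have hSd : ∀ y z, y - z ∣ S y - S z := by
    intro y z
    rw [hS, ← Finset.sum_sub_distrib]
    refine Finset.dvd_sum fun j _ => ?_
    rw [← mul_sub]
    refine Dvd.dvd.mul_left (Dvd.dvd.trans ?_ (sub_dvd_pow_sub_pow _ _ _)) _
    rw [← mul_sub]
    exact dvd_mul_left _ _
  have hvint : v ∈ intPS := by
    apply mem_intPS_of_forall_dvd
    intro m
    induction m with
    | zero => exact ⟨0, zero_mem _, by simp⟩
    | succ m ih =>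
      obtain ⟨z, hz, hd⟩ := ih
      refine ⟨X * S z, ?_, ?_⟩
      · refine mul_mem (fun k => ?_) (hSint z hz)
        rw [coeff_X]
        split_ifs
        · exact one_mem _
        · exact zero_mem _
      · nth_rw 1 [hvS]
        rw [← mul_sub, pow_succ']
        exact mul_dvd_mul_left _ (hd.trans (hSd _ _))
  refine ⟨c ^ 2, pow_pos hc 2, fun k => ?_⟩
  have h1 := congrArg (coeff k) hCv
  rw [coeff_rescale, coeff_C_mul] at h1
  push_cast
  rw [← h1]
  exact mul_mem (natCast_mem_intQ c) (hvint k)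

/-- Eisenstein's theorem on the denominators of algebraic power series. -/
theorem exists_pow_mul_coeff_mem_intQ {f : PowerSeries ℚ} (hf : IsAlgebraicPS f) :
    ∃ N : ℕ, 0 < N ∧ ∀ k, 1 ≤ k → (N : ℚ) ^ k * coeff k f ∈ intQ := by
  obtain ⟨q, k, U, w, rfl, hw⟩ := exists_fixed_point_form hf
  obtain ⟨c, hc, hcw⟩ := exists_pow_mul_fixed_point_mem_intQ hw
  obtain ⟨d, hd, hdq⟩ := exists_common_den q
  refine ⟨c * d, Nat.mul_pos hc hd, fun m hm => ?_⟩
  rw [map_add, mul_add, Polynomial.coeff_coe, coeff_X_pow_mul']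
  push_cast
  rw [mul_pow]
  refine add_mem ?_ ?_
  · obtain ⟨m, rfl⟩ := Nat.exists_eq_add_of_le' hm
    rw [pow_succ (d : ℚ), mul_assoc, mul_assoc]
    exact mul_mem (pow_mem (natCast_mem_intQ c) _)
      (mul_mem (pow_mem (natCast_mem_intQ d) _) (hdq m.succ))
  · split_ifs with hkm
    · obtain ⟨l, rfl⟩ := Nat.exists_eq_add_of_le' hkm
      rw [Nat.add_sub_cancel, pow_add (c : ℚ)]
      have := mul_mem (mul_mem (pow_mem (natCast_mem_intQ c) k)
        (pow_mem (natCast_mem_intQ d) (l + k))) (hcw l)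
      convert this using 1
      ring
    · rw [mul_zero]
      exact zero_mem _

theorem coeff_X_mul_derivative {R : Type*} [CommRing R] (g : PowerSeries R) (n : ℕ) :
    coeff n (X * d⁄dX R g) = n * coeff n g := by
  cases n with
  | zero => simp
  | succ n =>
    rw [coeff_succ_X_mul, coeff_derivative]
    push_cast
    ring

/-- The logarithmic derivative of an integral power series with constant term `1` satisfies the
Dwork type congruences. -/
theorem dvd_coeff_mul_sub_of_log_derivative {z b : PowerSeries ℤ} (hz : constantCoeff z = 1)
    (hb : X * d⁄dX ℤ z = b * z) {p : ℕ} (hp : p.Prime) (n : ℕ) :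
    (p : ℤ) ∣ coeff (n * p) b - coeff n b := by
  have := Fact.mk hp
  have hp0 : p ≠ 0 := hp.ne_zero
  have hpd : ∀ k, (p : ℤ) ∣ coeff k (z ^ p - expand p hp0 z) := by
    intro k
    have h1 : PowerSeries.map (Int.castRingHom (ZMod p)) (z ^ p - expand p hp0 z) = 0 := by
      rw [map_sub, map_pow, map_expand, sub_eq_zero]
      have := MvPowerSeries.map_frobenius_expand (R := ZMod p) p hp0
        (f := PowerSeries.map (Int.castRingHom (ZMod p)) z)
      rw [ZMod.frobenius_zmod, MvPowerSeries.map_id] at this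
      exact this.symm
    have h2 := congrArg (coeff k) h1
    rw [coeff_map, map_zero, eq_intCast] at h2
    exact (ZMod.intCast_zmod_eq_zero_iff_dvd _ p).mp h2
  choose u0 hu0 using hpd
  set u : PowerSeries ℤ := PowerSeries.mk u0
  have hu : z ^ p = expand p hp0 z + C (p : ℤ) * u := by
    rw [← sub_eq_iff_eq_add']
    ext k
    rw [hu0, coeff_C_mul, coeff_mk]
  have hexp : X * d⁄dX ℤ (expand p hp0 z) = C (p : ℤ) * expand p hp0 (X * d⁄dX ℤ z) := by
    ext k
    rw [coeff_X_mul_derivative, coeff_C_mul]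
    by_cases hk : p ∣ k
    · obtain ⟨m, rfl⟩ := hk
      rw [coeff_expand_mul, coeff_expand_mul, coeff_X_mul_derivative]
      push_cast
      ring
    · rw [coeff_expand_of_not_dvd _ _ _ hk, coeff_expand_of_not_dvd _ _ _ hk]
      simp
  have hpC : C (p : ℤ) ≠ (0 : PowerSeries ℤ) := by
    rw [Ne, map_eq_zero_iff _ PowerSeries.C_injective]
    exact_mod_cast hp0
  have h1 : z ^ (p - 1) * (X * d⁄dX ℤ z) =
      expand p hp0 (X * d⁄dX ℤ z) + X * d⁄dX ℤ u := by
    have h2 := congrArg (fun g => X * d⁄dX ℤ g) hu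
    simp only [map_add, Derivation.leibniz_pow, Derivation.leibniz, derivative_C, smul_eq_mul, mul_add, nsmul_eq_mul] at h2
    rw [hexp] at h2
    have hcast : ((p : ℕ) : PowerSeries ℤ) = C (p : ℤ) := by simp
    rw [hcast] at h2
    apply mul_left_cancel₀ hpC
    linear_combination h2
  rw [hb, map_mul] at h1
  obtain ⟨v, hv⟩ : ∃ v, z * v = 1 := ⟨invOfUnit z 1, mul_invOfUnit z 1 (by simpa using hz)⟩
  have hev : expand p hp0 z * expand p hp0 v = 1 := by rw [← map_mul, hv, map_one]
  have hzp : z ^ (p - 1) * z = z ^ p := by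
    rw [← pow_succ, Nat.sub_add_cancel hp.one_le]
  have h2 : b - expand p hp0 b =
      expand p hp0 v * (X * d⁄dX ℤ u) - C (p : ℤ) * (expand p hp0 v * u * b) := by
    rw [hu] at hzp
    linear_combination (expand p hp0 v) * h1 - b * (expand p hp0 v) * hzp
      - (b - expand p hp0 b) * hev
  have h3 := congrArg (coeff (n * p)) h2
  rw [map_sub, map_sub, mul_comm n p, coeff_expand_mul, coeff_C_mul] at h3
  rw [mul_comm n p, h3]
  refine dvd_sub ?_ (dvd_mul_right _ _)
  rw [coeff_mul]
  refine Finset.dvd_sum fun x hx => ?_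
  rw [Finset.HasAntidiagonal.mem_antidiagonal] at hx
  by_cases hk : p ∣ x.1
  · refine Dvd.dvd.mul_left ?_ _
    rw [coeff_X_mul_derivative]
    refine Dvd.dvd.mul_right ?_ _
    exact_mod_cast (Nat.dvd_add_right hk).mp (hx ▸ dvd_mul_right p n)
  · rw [coeff_expand_of_not_dvd _ _ _ hk, zero_mul]
    exact dvd_zero _

/-- The series `∑ b_k X^k / k`. -/
noncomputable def logSeries (b : ℕ → ℚ) : PowerSeries ℚ := PowerSeries.mk fun k => b k / k

/-- The series `exp (∑ b_k X^k / k)`. -/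
noncomputable def expo (b : ℕ → ℚ) : PowerSeries ℚ := (exp ℚ).subst (logSeries b)

theorem constantCoeff_logSeries (b : ℕ → ℚ) : constantCoeff (logSeries b) = 0 := by
  rw [← coeff_zero_eq_constantCoeff_apply]
  simp [logSeries]

theorem hasSubst_logSeries (b : ℕ → ℚ) : HasSubst (logSeries b) :=
  HasSubst.of_constantCoeff_zero' (constantCoeff_logSeries b)

theorem derivative_expo (b : ℕ → ℚ) :
    d⁄dX ℚ (expo b) = (PowerSeries.mk fun k => b (k + 1)) * expo b := by
  have h : d⁄dX ℚ (logSeries b) = PowerSeries.mk fun k => b (k + 1) := by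
    ext k
    rw [coeff_derivative, logSeries, coeff_mk, coeff_mk]
    push_cast
    have : (k : ℚ) + 1 ≠ 0 := by positivity
    field_simp
  rw [expo, derivative_subst (hasSubst_logSeries b), h, derivative_exp, mul_comm]

theorem constantCoeff_expo (b : ℕ → ℚ) : constantCoeff (expo b) = 1 := by
  have h := constantCoeff_subst (R := ℚ) (hasSubst_logSeries b) (exp ℚ)
  rw [finsum_eq_single _ 0] at h
  · refine h.trans ?_
    simp
  · intro n hn
    have : PowerSeries.constantCoeff (logSeries b ^ n) = 0 := by
      rw [map_pow, constantCoeff_logSeries, zero_pow hn]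
    refine (congrArg _ this).trans ?_
    simp

theorem eq_zero_of_derivative_eq_mul {f y : PowerSeries ℚ} (h : d⁄dX ℚ y = f * y)
    (h0 : constantCoeff y = 0) : y = 0 := by
  have key : ∀ n, ∀ m ≤ n, coeff m y = 0 := by
    intro n
    induction n with
    | zero =>
      intro m hm
      rw [Nat.le_zero.mp hm]
      simpa using h0
    | succ n ih =>
      intro m hm
      rcases Nat.lt_or_eq_of_le hm with hlt | rfl
      · exact ih m (Nat.lt_succ_iff.mp hlt)
      · have h1 := congrArg (coeff n) h
        rw [coeff_derivative, coeff_mul, Finset.sum_eq_zero] at h1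
        · exact (mul_eq_zero.mp h1).resolve_right (by positivity)
        · intro x hx
          rw [ih x.2 (by have := Finset.HasAntidiagonal.mem_antidiagonal.mp hx; omega), mul_zero]
  ext n
  exact key n n le_rfl

theorem eq_C_mul_of_derivative_eq_mul {f y Y : PowerSeries ℚ} (h : d⁄dX ℚ y = f * y)
    (hY : d⁄dX ℚ Y = f * Y) (h0 : constantCoeff Y = 1) : y = C (constantCoeff y) * Y := by
  rw [← sub_eq_zero]
  apply eq_zero_of_derivative_eq_mul (f := f)
  · rw [map_sub, Derivation.leibniz, derivative_C, smul_zero, add_zero, smul_eq_mul, h, hY]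
    ring
  · simp [h0]

theorem exists_map_eq_of_mem_intPS {g : PowerSeries ℚ} (hg : g ∈ intPS) :
    ∃ z : PowerSeries ℤ, PowerSeries.map (Int.castRingHom ℚ) z = g := by
  choose z hz using hg
  exact ⟨PowerSeries.mk z, by ext k; rw [coeff_map, coeff_mk, hz]⟩

theorem congruences_of_isAlgebraicPS (a : ℕ → ℤ)
    (h : IsAlgebraicPS (expo fun k => (a k : ℚ))) :
    ∃ B : ℕ, ∀ p : ℕ, p.Prime → B ≤ p → ∀ n : ℕ, 1 ≤ n → (p : ℤ) ∣ a (n * p) - a n := by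
  obtain ⟨N, hN, h_integral⟩ := exists_pow_mul_coeff_mem_intQ h
  set Y := expo fun k => (a k : ℚ) with hY
  have hmem : rescale (N : ℚ) Y ∈ intPS := by
    intro k
    rw [coeff_rescale]
    rcases Nat.eq_zero_or_pos k with rfl | hk
    · rw [coeff_zero_eq_constantCoeff_apply, hY, constantCoeff_expo]
      simp
    · exact h_integral k hk
  obtain ⟨z, hz⟩ := exists_map_eq_of_mem_intPS hmem
  have hinj : Function.Injective (PowerSeries.map (Int.castRingHom ℚ)) :=
    PowerSeries.map_injective _ (RingHom.injective_int _)
  set b : PowerSeries ℤ := PowerSeries.mk fun k => if k = 0 then 0 else (N : ℤ) ^ k * a k with hb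
  have hz0 : constantCoeff z = 1 := by
    have h1 := congrArg (coeff 0) hz
    rw [coeff_rescale, pow_zero, one_mul, coeff_zero_eq_constantCoeff_apply,
      coeff_zero_eq_constantCoeff_apply, hY, constantCoeff_expo,
      ← coeff_zero_eq_constantCoeff_apply, coeff_map] at h1
    simpa using h1
  have hzb : X * d⁄dX ℤ z = b * z := by
    apply hinj
    have h1 := derivative_expo fun k => (a k : ℚ)
    have h2 : PowerSeries.map (Int.castRingHom ℚ) (X * d⁄dX ℤ z) =
        rescale (N : ℚ) (X * d⁄dX ℚ Y) := by
      ext k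
      rw [coeff_map, coeff_X_mul_derivative, coeff_rescale, coeff_X_mul_derivative,
        map_mul, ← coeff_map, hz, coeff_rescale, map_natCast]
      ring
    have h3 : PowerSeries.map (Int.castRingHom ℚ) b =
        rescale (N : ℚ) (X * PowerSeries.mk fun k => (a (k + 1) : ℚ)) := by
      ext k
      rw [coeff_map, coeff_rescale, hb, coeff_mk]
      cases k with
      | zero => simp
      | succ k => rw [coeff_succ_X_mul, coeff_mk]; simp
    rw [h2, h1, map_mul _ b, hz, h3, ← map_mul, ← hY]
    congr 1
    ring
  refine ⟨N + 1, fun p hp hBp n hn => ?_⟩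
  have h1 := dvd_coeff_mul_sub_of_log_derivative hz0 hzb hp n
  have hn0 : n ≠ 0 := by omega
  have hnp0 : n * p ≠ 0 := mul_ne_zero hn0 hp.ne_zero
  rw [hb, coeff_mk, coeff_mk, if_neg hn0, if_neg hnp0] at h1
  have := Fact.mk hp
  have h2 : (p : ℤ) ∣ (N : ℤ) ^ n * (a (n * p) - a n) := by
    rw [← ZMod.intCast_zmod_eq_zero_iff_dvd] at h1 ⊢
    push_cast at h1 ⊢
    rw [pow_mul, ZMod.pow_card] at h1
    linear_combination h1
  refine (Int.Prime.dvd_mul' hp h2).resolve_left fun h3 => ?_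
  have h4 : p ∣ N := by exact_mod_cast Int.Prime.dvd_pow' hp h3
  exact absurd (Nat.le_of_dvd hN h4) (by omega)

/-- The sequence `b` satisfies the Dwork type congruences at the prime `p`. -/
def DworkAt (p : ℕ) (b : ℕ → ℤ) : Prop := ∀ n : ℕ, 1 ≤ n → (p : ℤ) ∣ b (n * p) - b n

section ModP

variable {p : ℕ} {b : ℕ → ℤ}

theorem exists_approx_solution (hp : p.Prime) (hb : DworkAt p b) (M : ℕ) (hM : 1 ≤ M) :
    ∃ z : PowerSeries ℤ, constantCoeff z = 1 ∧
      X ^ M ∣ PowerSeries.map (Int.castRingHom (ZMod p))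
        (X * d⁄dX ℤ z - X * PowerSeries.mk (fun k => b (k + 1)) * z) := by
  have := Fact.mk hp
  set fb := PowerSeries.mk (fun k => b (k + 1))
  set κ := PowerSeries.map (Int.castRingHom (ZMod p))
  induction M, hM using Nat.le_induction with
  | base =>
    refine ⟨1, by simp, ?_⟩
    rw [pow_one, ← map_X (Int.castRingHom (ZMod p))]
    exact map_dvd κ ⟨d⁄dX ℤ 1 - fb * 1, by ring⟩
  | succ M hM ih =>
    obtain ⟨z, hz, hd⟩ := ih
    set e := coeff M (κ (X * d⁄dX ℤ z - X * fb * z)) with he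
    obtain ⟨w, hw⟩ : ∃ w : ℤ, e + (w : ZMod p) * M = 0 := by
      by_cases hpM : p ∣ M
      · refine ⟨0, ?_⟩
        obtain ⟨n, rfl⟩ := hpM
        obtain ⟨v, hv⟩ : ∃ v, z * v = 1 := ⟨invOfUnit z 1, mul_invOfUnit z 1 (by simpa using hz)⟩
        set b' : PowerSeries ℤ := X * d⁄dX ℤ z * v
        have hb' : X * d⁄dX ℤ z = b' * z := by linear_combination (-(X * d⁄dX ℤ z)) * hv
        have hn : 1 ≤ n := Nat.pos_of_ne_zero (by rintro rfl; simp at hM)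
        have h1 : κ (b' - X * fb) = κ (X * d⁄dX ℤ z - X * fb * z) * κ v := by
          rw [← map_mul]
          congr 1
          linear_combination X * fb * hv
        have h2 : X ^ (p * n) ∣ κ (b' - X * fb) := h1 ▸ hd.mul_right _
        have hv0 : constantCoeff v = 1 := by
          have := congrArg (constantCoeff (R := ℤ)) hv
          rwa [map_mul, hz, one_mul, map_one] at this
        have hX : ∀ k, 1 ≤ k → coeff k (X * fb) = b k := by
          intro k hk
          obtain ⟨k, rfl⟩ := Nat.exists_eq_add_of_le' hk
          rw [coeff_succ_X_mul, coeff_mk]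
        have h3 : coeff (p * n) (κ (b' - X * fb)) = e := by
          obtain ⟨g, hg⟩ := hd
          rw [h1, he, hg, mul_assoc, coeff_X_pow_mul', coeff_X_pow_mul']
          simp only [le_refl, if_true, Nat.sub_self, coeff_zero_eq_constantCoeff_apply, map_mul]
          have : constantCoeff (κ v) = 1 := by
            rw [← coeff_zero_eq_constantCoeff_apply, coeff_map,
              coeff_zero_eq_constantCoeff_apply, hv0, map_one]
          rw [this, mul_one]
        have h4 := dvd_coeff_mul_sub_of_log_derivative hz hb' hp n
        have h5 := hb n hn
        have h6 := X_pow_dvd_iff.mp h2 n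
          ((Nat.lt_mul_iff_one_lt_left hn).2 hp.one_lt)
        rw [coeff_map, map_sub, hX n hn, eq_intCast] at h6
        rw [coeff_map, map_sub, hX _ (Nat.mul_pos hp.pos hn), eq_intCast] at h3
        rw [← ZMod.intCast_zmod_eq_zero_iff_dvd] at h4 h5
        rw [← h3]
        rw [mul_comm n p] at h4 h5
        push_cast at h4 h5 h6 ⊢
        linear_combination h4 + h6 - h5
      · obtain ⟨w, hw⟩ := ZMod.intCast_surjective (n := p) (-e / (M : ZMod p))
        refine ⟨w, ?_⟩
        have : (M : ZMod p) ≠ 0 := by rwa [Ne, ZMod.natCast_eq_zero_iff]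
        rw [hw]
        field_simp
        ring
    refine ⟨z * (1 + C w * X ^ M), ?_, ?_⟩
    · have : M ≠ 0 := by omega
      simp [hz, this]
    · obtain ⟨M, rfl⟩ := Nat.exists_eq_add_of_le' hM
      obtain ⟨g, hg⟩ := hd
      have h1 : X * d⁄dX ℤ (z * (1 + C w * X ^ (M + 1))) - X * fb * (z * (1 + C w * X ^ (M + 1))) =
          (X * d⁄dX ℤ z - X * fb * z) * (1 + C w * X ^ (M + 1))
            + X ^ (M + 1) * (z * C (w * (M + 1 : ℕ))) := by
        simp only [Derivation.leibniz, map_add, Derivation.leibniz_pow, derivative_C,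
          Derivation.map_one_eq_zero, derivative_X, smul_eq_mul, nsmul_eq_mul, map_mul]
        simp
        ring
      rw [h1, map_add, map_mul, hg, map_mul, map_pow, map_X, mul_assoc, ← mul_add, pow_succ]
      refine mul_dvd_mul_left _ ?_
      have h0 : ∀ y, constantCoeff (κ y) = ((constantCoeff y : ℤ) : ZMod p) := by
        intro y
        rw [← coeff_zero_eq_constantCoeff_apply, coeff_map, eq_intCast,
          coeff_zero_eq_constantCoeff_apply]
      rw [X_dvd_iff, map_add, map_mul, h0, h0]
      have h2 : constantCoeff g = e := by
        rw [he, hg, coeff_X_pow_mul', if_pos le_rfl, Nat.sub_self,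
          coeff_zero_eq_constantCoeff_apply]
      rw [h2]
      simp only [map_add, map_mul, hz, map_one, constantCoeff_C, map_pow, constantCoeff_X]
      push_cast at hw ⊢
      simpa using hw

theorem derivative_iterate_eq_zero (hp : p.Prime) (g : PowerSeries (ZMod p)) :
    (d⁄dX (ZMod p))^[p] g = 0 := by
  have := Fact.mk hp
  have h : ∀ m k, coeff k ((d⁄dX (ZMod p))^[m] g) =
      coeff (k + m) g * ∏ i ∈ Finset.range m, ((k + i + 1 : ℕ) : ZMod p) := by
    intro m
    induction m with
    | zero => simp
    | succ m ih =>
      intro k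
      rw [Function.iterate_succ_apply', coeff_derivative, ih, Finset.prod_range_succ',
        show k + 1 + m = k + (m + 1) by ring]
      push_cast
      rw [mul_assoc]
      congr 1
      congr 1
      · refine Finset.prod_congr rfl fun i _ => ?_
        ring
      · ring
  ext k
  rw [h, map_zero]
  refine mul_eq_zero_of_right _ (Finset.prod_eq_zero (i := p - 1 - k % p) ?_ ?_)
  · have := Nat.mod_lt k hp.pos
    simp only [Finset.mem_range]
    omega
  · rw [ZMod.natCast_eq_zero_iff]
    have h1 := Nat.mod_lt k hp.pos
    refine ⟨k / p + 1, ?_⟩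
    have h2 := Nat.div_add_mod k p
    have h3 : p * (k / p + 1) = p * (k / p) + p := by ring
    omega

/-- The operator `g ↦ g' + f g`. -/
noncomputable def nabla {R : Type*} [CommRing R] (f g : PowerSeries R) : PowerSeries R :=
  d⁄dX R g + f * g

theorem X_pow_dvd_derivative {R : Type*} [CommRing R] {g : PowerSeries R} {M : ℕ}
    (h : X ^ (M + 1) ∣ g) : X ^ M ∣ d⁄dX R g := by
  rw [X_pow_dvd_iff] at h ⊢
  intro m hm
  rw [coeff_derivative, h _ (by omega), zero_mul]

theorem dvd_coeff_nabla_iterate (hp : p.Prime) (hb : DworkAt p b) (g : PowerSeries ℤ) (k : ℕ) :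
    (p : ℤ) ∣ coeff k ((nabla (PowerSeries.mk fun k => b (k + 1)))^[p] g) := by
  have := Fact.mk hp
  set κ := PowerSeries.map (Int.castRingHom (ZMod p)) with hκ
  set fb := PowerSeries.mk fun k => b (k + 1)
  have hκd : ∀ y, κ (d⁄dX ℤ y) = d⁄dX (ZMod p) (κ y) := by
    intro y
    ext i
    rw [coeff_derivative, coeff_map, coeff_map, coeff_derivative]
    simp
  obtain ⟨z, hz, hd⟩ := exists_approx_solution hp hb (p + k + 2) (by omega)
  have hd' : X ^ (p + k + 1) ∣ d⁄dX (ZMod p) (κ z) - κ fb * κ z := by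
    obtain ⟨y, hy⟩ := hd
    refine ⟨y, ?_⟩
    rw [map_sub, map_mul, map_mul, map_mul, map_X, hκd, pow_succ', mul_assoc, mul_assoc,
      ← mul_sub] at hy
    exact mul_left_cancel₀ X_ne_zero hy
  have key : ∀ m ≤ p, X ^ (p + k + 1 - m) ∣
      (d⁄dX (ZMod p))^[m] (κ z * κ g) - κ z * κ ((nabla fb)^[m] g) := by
    intro m
    induction m with
    | zero => simp
    | succ m ih =>
      intro hm
      rw [Function.iterate_succ_apply', Function.iterate_succ_apply']
      set G := (nabla fb)^[m] g
      have h1 := ih (by omega)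
      rw [show p + k + 1 - m = p + k + 1 - (m + 1) + 1 by omega] at h1
      have h2 := X_pow_dvd_derivative h1
      have h3 : X ^ (p + k + 1 - (m + 1)) ∣ (d⁄dX (ZMod p) (κ z) - κ fb * κ z) * κ G :=
        ((pow_dvd_pow _ (by omega)).trans hd').mul_right _
      have h4 := dvd_add h2 h3
      convert h4 using 1
      rw [nabla, map_add, map_mul, hκd, map_sub, Derivation.leibniz, smul_eq_mul, smul_eq_mul]
      ring
  have h1 := key p le_rfl
  rw [derivative_iterate_eq_zero hp, zero_sub, dvd_neg, show p + k + 1 - p = k + 1 by omega] at h1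
  obtain ⟨v, hv⟩ : ∃ v, z * v = 1 := ⟨invOfUnit z 1, mul_invOfUnit z 1 (by simpa using hz)⟩
  have h2 : X ^ (k + 1) ∣ κ ((nabla fb)^[p] g) := by
    have h3 := h1.mul_left (κ v)
    rwa [← mul_assoc, ← map_mul, mul_comm v, hv, map_one, one_mul] at h3
  have h3 := X_pow_dvd_iff.mp h2 k (Nat.lt_succ_self k)
  rw [coeff_map, eq_intCast] at h3
  exact (ZMod.intCast_zmod_eq_zero_iff_dvd _ p).mp h3

theorem nabla_iterate_C_mul (f : PowerSeries ℤ) (c : ℤ) (m : ℕ) (g : PowerSeries ℤ) :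
    (nabla f)^[m] (C c * g) = C c * (nabla f)^[m] g := by
  induction m generalizing g with
  | zero => rfl
  | succ m ih =>
    have : nabla f (C c * g) = C c * nabla f g := by
      rw [nabla, nabla, Derivation.leibniz, derivative_C, smul_eq_mul]
      simp
      ring
    rw [Function.iterate_succ_apply, this, ih, Function.iterate_succ_apply]

theorem pow_dvd_coeff_nabla_iterate (hp : p.Prime) (hb : DworkAt p b) (n : ℕ) :
    ∃ h : PowerSeries ℤ,
      (nabla (PowerSeries.mk fun k => b (k + 1)))^[n * p] 1 = C ((p : ℤ) ^ n) * h := by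
  induction n with
  | zero => exact ⟨1, by simp⟩
  | succ n ih =>
    obtain ⟨h, hh⟩ := ih
    choose u hu using dvd_coeff_nabla_iterate hp hb h
    refine ⟨PowerSeries.mk u, ?_⟩
    rw [add_mul, one_mul, add_comm, Function.iterate_add_apply, hh, nabla_iterate_C_mul, pow_succ,
      map_mul C, mul_assoc]
    congr 1
    ext k
    rw [hu, coeff_C_mul, coeff_mk]

/-- `m!` times the `m`-th coefficient of `exp (∑ b_k X^k / k)`. -/
noncomputable def expoNum (b : ℕ → ℤ) (m : ℕ) : ℤ :=
  constantCoeff ((nabla (PowerSeries.mk fun k => b (k + 1)))^[m] 1)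

theorem factorial_mul_coeff_expo (b : ℕ → ℤ) (m : ℕ) :
    (m.factorial : ℚ) * coeff m (expo fun k => (b k : ℚ)) = expoNum b m := by
  set Y := expo fun k => (b k : ℚ) with hY
  set ι := PowerSeries.map (Int.castRingHom ℚ)
  set fb := PowerSeries.mk fun k => b (k + 1)
  have hd : d⁄dX ℚ Y = ι fb * Y := by
    rw [hY, derivative_expo]
    congr 1
  have h1 : (d⁄dX ℚ)^[m] Y = ι ((nabla fb)^[m] 1) * Y := by
    induction m with
    | zero => simp
    | succ m ih =>
      rw [Function.iterate_succ_apply', Function.iterate_succ_apply', ih, nabla,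
        Derivation.leibniz, hd]
      have : d⁄dX ℚ (ι ((nabla fb)^[m] 1)) = ι (d⁄dX ℤ ((nabla fb)^[m] 1)) := by
        ext i
        rw [coeff_derivative, coeff_map, coeff_map, coeff_derivative]
        simp
      rw [this, map_add, map_mul, smul_eq_mul, smul_eq_mul]
      ring
  have h2 : ∀ m k, ((k + m).factorial : ℚ) * coeff (k + m) Y =
      k.factorial * coeff k ((d⁄dX ℚ)^[m] Y) := by
    intro m
    induction m with
    | zero => simp
    | succ m ih =>
      intro k
      rw [Function.iterate_succ_apply', coeff_derivative, show k + (m + 1) = k + 1 + m by ring, ih,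
        Nat.factorial_succ]
      push_cast
      ring
  have h3 := h2 m 0
  rw [zero_add, h1] at h3
  rw [h3]
  simp only [Nat.factorial_zero, Nat.cast_one, one_mul, coeff_zero_eq_constantCoeff_apply, map_mul,
    hY, constantCoeff_expo, mul_one]
  rw [← coeff_zero_eq_constantCoeff_apply, coeff_map]
  simp [expoNum, fb]

theorem pow_dvd_expoNum (hp : p.Prime) (hb : DworkAt p b) (m : ℕ) :
    (p : ℤ) ^ (m / p) ∣ expoNum b m := by
  obtain ⟨h, hh⟩ := pow_dvd_coeff_nabla_iterate hp hb (m / p)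
  refine ⟨constantCoeff ((nabla (PowerSeries.mk fun k => b (k + 1)))^[m % p] h), ?_⟩
  have h1 : m = m % p + m / p * p := by rw [mul_comm]; exact (Nat.mod_add_div m p).symm
  conv_lhs => rw [h1]
  rw [expoNum, Function.iterate_add_apply, hh, nabla_iterate_C_mul, map_mul, constantCoeff_C]

end ModP

/-- The exponent of the prime `p` in `denomBound B m`. -/
def denomExp (B p m : ℕ) : ℕ := if p < B then m else 2 * m / p ^ 2

/-- A common denominator for the coefficients of degree at most `m` of the series
`exp (∑ b_k X^k / k)`, where `b` satisfies the Dwork congruences at all primes `p ≥ B`. -/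
def denomBound (B m : ℕ) : ℕ := ∏ p ∈ Nat.primesBelow (m + 1), p ^ denomExp B p m

theorem denomBound_zero (B : ℕ) : denomBound B 0 = 1 := by
  simp [denomBound, Nat.primesBelow_succ, Nat.not_prime_zero]

theorem denomBound_pos (B m : ℕ) : 0 < denomBound B m :=
  Finset.prod_pos fun _ hp => pow_pos (Nat.prime_of_mem_primesBelow hp).pos _

theorem denomBound_mul_dvd (B i j : ℕ) :
    denomBound B i * denomBound B j ∣ denomBound B (i + j) := by
  have hsub : ∀ i k, i ≤ k → denomBound B i ∣
      ∏ p ∈ Nat.primesBelow (k + 1), p ^ denomExp B p i := by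
    intro i k hik
    refine Finset.prod_dvd_prod_of_subset _ _ _ fun p hp => ?_
    rw [Nat.mem_primesBelow] at hp ⊢
    exact ⟨by omega, hp.2⟩
  refine (mul_dvd_mul (hsub i (i + j) (by omega)) (hsub j (i + j) (by omega))).trans ?_
  rw [← Finset.prod_mul_distrib]
  refine Finset.prod_dvd_prod_of_dvd _ _ fun p hp => ?_
  rw [← pow_add]
  refine pow_dvd_pow _ ?_
  unfold denomExp
  split_ifs
  · exact le_rfl
  · rw [mul_add]
    exact Nat.div_add_div_le_add_div

theorem denomBound_dvd (B : ℕ) {i j : ℕ} (h : i ≤ j) : denomBound B i ∣ denomBound B j := by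
  obtain ⟨k, rfl⟩ := Nat.exists_eq_add_of_le h
  exact (dvd_mul_right _ _).trans (denomBound_mul_dvd B i k)

theorem padicValNat_factorial_le (B : ℕ) {p : ℕ} (hp : p.Prime) (m : ℕ) :
    padicValNat p m.factorial ≤ denomExp B p m + if p < B then 0 else m / p := by
  have := Fact.mk hp
  have hle : ∀ n, (p - 1) * padicValNat p n.factorial ≤ n := fun n => by
    rw [sub_one_mul_padicValNat_factorial]
    exact Nat.sub_le _ _
  have h2 := hp.two_le
  unfold denomExp
  split_ifs with hB
  · refine le_trans ?_ (hle m)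
    exact Nat.le_mul_of_pos_left _ (by omega)
  · rw [← padicValNat_mul_div_factorial (p := p), padicValNat_factorial_mul]
    gcongr
    rw [Nat.le_div_iff_mul_le (by positivity)]
    have h3 := hle (m / p)
    set v := padicValNat p (m / p).factorial
    obtain ⟨q, rfl⟩ : ∃ q, p = q + 2 := ⟨p - 2, by omega⟩
    have h4 : (q + 2) * (m / (q + 2)) ≤ m := Nat.mul_div_le m (q + 2)
    rw [show q + 2 - 1 = q + 1 by omega] at h3
    calc v * (q + 2) ^ 2 ≤ 2 * ((q + 2) * ((q + 1) * v)) := by nlinarith [Nat.zero_le (q * v), Nat.zero_le (q * q * v)]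
      _ ≤ 2 * ((q + 2) * (m / (q + 2))) := by gcongr
      _ ≤ 2 * m := by gcongr

theorem factorial_dvd_denomBound_mul (B m : ℕ) {A : ℤ}
    (hA : ∀ p : ℕ, p.Prime → B ≤ p → (p : ℤ) ^ (m / p) ∣ A) :
    (m.factorial : ℤ) ∣ denomBound B m * A := by
  rw [← Int.natAbs_dvd_natAbs, Int.natAbs_mul, Int.natAbs_natCast, Int.natAbs_natCast,
    Nat.dvd_iff_prime_pow_dvd_dvd]
  intro p k hp hk
  have := Fact.mk hp
  have hk' : k ≤ padicValNat p m.factorial :=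
    (padicValNat_dvd_iff_le (Nat.factorial_ne_zero m)).mp hk
  have h1 := hk'.trans (padicValNat_factorial_le B hp m)
  rcases Nat.eq_zero_or_pos k with rfl | hk0
  · simp
  have hpm : p ≤ m := (hp.dvd_factorial).mp ((dvd_pow_self p hk0.ne').trans hk)
  refine (pow_dvd_pow p h1).trans ?_
  rw [pow_add]
  refine mul_dvd_mul ?_ ?_
  · exact Finset.dvd_prod_of_mem (fun p => p ^ denomExp B p m)
      (Nat.mem_primesBelow.2 ⟨by omega, hp⟩)
  · split_ifs with hB
    · simp
    · have := Int.natAbs_dvd_natAbs.mpr (hA p hp (by omega))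
      rwa [Int.natAbs_pow, Int.natAbs_natCast] at this

theorem denomBound_mul_coeff_expo_mem_intQ {B : ℕ} {b : ℕ → ℤ}
    (hb : ∀ p : ℕ, p.Prime → B ≤ p → DworkAt p b) (m : ℕ) :
    (denomBound B m : ℚ) * coeff m (expo fun k => (b k : ℚ)) ∈ intQ := by
  obtain ⟨z, hz⟩ := factorial_dvd_denomBound_mul B m (A := expoNum b m)
    fun p hp hB => pow_dvd_expoNum hp (hb p hp hB) m
  refine ⟨z, ?_⟩
  have h1 := factorial_mul_coeff_expo b m
  have h2 : (denomBound B m : ℚ) * expoNum b m = m.factorial * z := by exact_mod_cast hz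
  rw [← h1] at h2
  have h3 : (m.factorial : ℚ) ≠ 0 := by exact_mod_cast Nat.factorial_ne_zero m
  apply mul_left_cancel₀ h3
  rw [eq_intCast, ← h2]
  ring

theorem exists_denomBound_le_pow (B : ℕ) : ∃ C : ℕ, 1 ≤ C ∧ ∀ m, denomBound B m ≤ C ^ m := by
  have hsum : Summable fun k : ℕ => (k : ℝ) ^ (-(3 / 2) : ℝ) := by
    rw [Real.summable_nat_rpow]
    norm_num
  set S : ℝ := ∑' k : ℕ, (k : ℝ) ^ (-(3 / 2) : ℝ)
  set E : ℝ := ∑ k ∈ Finset.range B, Real.log k + 4 * S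
  obtain ⟨C, hC⟩ := exists_nat_ge (Real.exp E)
  have hlog0 : ∀ k : ℕ, 0 ≤ Real.log k := fun k => Real.log_natCast_nonneg k
  refine ⟨C, ?_, fun m => ?_⟩
  · have : (0 : ℝ) < C := (Real.exp_pos E).trans_le hC
    exact_mod_cast this
  have hterm : ∀ p ∈ Nat.primesBelow (m + 1), (denomExp B p m : ℝ) * Real.log p ≤
      m * ((if p < B then Real.log p else 0) + 4 * (p : ℝ) ^ (-(3 / 2) : ℝ)) := by
    intro p hp
    have hp0 : (0 : ℝ) < p := by exact_mod_cast (Nat.prime_of_mem_primesBelow hp).pos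
    have hr : 0 ≤ (p : ℝ) ^ (-(3 / 2) : ℝ) := by positivity
    unfold denomExp
    split_ifs with hB
    · gcongr
      linarith
    · have h1 : ((2 * m / p ^ 2 : ℕ) : ℝ) ≤ 2 * m / p ^ 2 := by
        refine Nat.cast_div_le.trans ?_
        push_cast
        exact le_rfl
      have h2 : Real.log p ≤ 2 * (p : ℝ) ^ (1 / 2 : ℝ) := by
        have := Real.log_le_rpow_div hp0.le (ε := 1 / 2) (by norm_num)
        linarith
      have h3 : (p : ℝ) ^ (-(3 / 2) : ℝ) = (p : ℝ) ^ (1 / 2 : ℝ) / p ^ 2 := by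
        rw [show (-(3 / 2) : ℝ) = 1 / 2 - (2 : ℕ) by norm_num, Real.rpow_sub hp0,
          Real.rpow_natCast]
      calc ((2 * m / p ^ 2 : ℕ) : ℝ) * Real.log p
          ≤ (2 * m / p ^ 2) * (2 * (p : ℝ) ^ (1 / 2 : ℝ)) := by
            gcongr
        _ = m * (0 + 4 * (p : ℝ) ^ (-(3 / 2) : ℝ)) := by rw [h3]; ring
  have hlog : Real.log (denomBound B m) ≤ m * E := by
    rw [denomBound, Nat.cast_prod, Real.log_prod]
    · calc ∑ p ∈ Nat.primesBelow (m + 1), Real.log ((p ^ denomExp B p m : ℕ) : ℝ)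
          = ∑ p ∈ Nat.primesBelow (m + 1), (denomExp B p m : ℝ) * Real.log p := by
            refine Finset.sum_congr rfl fun p _ => ?_
            rw [Nat.cast_pow, Real.log_pow]
        _ ≤ ∑ p ∈ Nat.primesBelow (m + 1),
            m * ((if p < B then Real.log p else 0) + 4 * (p : ℝ) ^ (-(3 / 2) : ℝ)) :=
            Finset.sum_le_sum hterm
        _ ≤ m * E := by
            rw [← Finset.mul_sum, Finset.sum_add_distrib, ← Finset.mul_sum]
            refine mul_le_mul_of_nonneg_left (add_le_add ?_
              (mul_le_mul_of_nonneg_left ?_ (by norm_num))) (by positivity)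
            · rw [← Finset.sum_filter]
              refine Finset.sum_le_sum_of_subset_of_nonneg (fun p hp => ?_) fun p _ _ => hlog0 p
              rw [Finset.mem_filter] at hp
              exact Finset.mem_range.mpr hp.2
            · exact hsum.sum_le_tsum _ fun k _ => by positivity
    · intro p hp
      exact_mod_cast (pow_pos (Nat.prime_of_mem_primesBelow hp).pos _).ne'
  have h1 : (denomBound B m : ℝ) ≤ (C : ℝ) ^ m := by
    rw [← Real.exp_log (Nat.cast_pos.mpr (denomBound_pos B m) : (0 : ℝ) < denomBound B m)]
    refine (Real.exp_le_exp.mpr hlog).trans ?_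
    rw [Real.exp_nat_mul]
    gcongr
  exact_mod_cast h1

/-- The weighted `ℓ¹` norm of a Laurent series. -/
noncomputable def lNorm (ρ : ℝ≥0∞) (g : LaurentSeries ℚ) : ℝ≥0∞ :=
  ∑' k : ℤ, ‖g.coeff k‖ₑ * ρ ^ k

theorem enorm_coeff_mul_le_lNorm (ρ : ℝ≥0∞) (g : LaurentSeries ℚ) (k : ℤ) :
    ‖g.coeff k‖ₑ * ρ ^ k ≤ lNorm ρ g :=
  ENNReal.le_tsum k

theorem lNorm_single (ρ : ℝ≥0∞) (k : ℤ) (a : ℚ) :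
    lNorm ρ (HahnSeries.single k a) = ‖a‖ₑ * ρ ^ k := by
  unfold lNorm
  rw [tsum_eq_single k]
  · simp
  · intro j hj
    rw [HahnSeries.coeff_single_of_ne hj]
    simp

theorem isExtNorm_lNorm {ρ : ℝ≥0∞} (h0 : ρ ≠ 0) (h1 : ρ ≠ ∞) : IsExtNorm (lNorm ρ) where
  zero := by simp [lNorm]
  one := by
    rw [← HahnSeries.single_zero_one, lNorm_single]
    simp
  neg x := by simp [lNorm]
  add x y := by
    unfold lNorm
    rw [← ENNReal.tsum_add]
    refine ENNReal.tsum_le_tsum fun k => ?_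
    rw [HahnSeries.coeff_add, ← add_mul]
    gcongr
    exact enorm_add_le _ _
  mul x y := by
    have h2 : ∀ k, ‖(x * y).coeff k‖ₑ * ρ ^ k ≤
        ∑' i : ℤ, (‖x.coeff i‖ₑ * ρ ^ i) * (‖y.coeff (k - i)‖ₑ * ρ ^ (k - i)) := by
      intro k
      rw [HahnSeries.coeff_mul]
      refine (mul_le_mul_left (enorm_sum_le _ _) _).trans ?_
      rw [Finset.sum_mul]
      set s := Finset.antidiagonal x.isPWO_support y.isPWO_support k
      have hs : ∀ p ∈ s, p.2 = k - p.1 := fun p hp => by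
        have := (Finset.mem_antidiagonal.mp hp).2.2
        omega
      calc ∑ p ∈ s, ‖x.coeff p.1 * y.coeff p.2‖ₑ * ρ ^ k
          = ∑ p ∈ s, (‖x.coeff p.1‖ₑ * ρ ^ p.1) * (‖y.coeff (k - p.1)‖ₑ * ρ ^ (k - p.1)) := by
            refine Finset.sum_congr rfl fun p hp => ?_
            rw [hs p hp, enorm_mul, ← add_sub_cancel p.1 k, ENNReal.zpow_add h0 h1,
              add_sub_cancel]
            ring
        _ = ∑ i ∈ s.image Prod.fst,
            (‖x.coeff i‖ₑ * ρ ^ i) * (‖y.coeff (k - i)‖ₑ * ρ ^ (k - i)) := by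
            rw [Finset.sum_image]
            intro p hp q hq hpq
            exact Prod.ext hpq (by rw [hs p hp, hs q hq, hpq])
        _ ≤ _ := ENNReal.sum_le_tsum _
    refine (ENNReal.tsum_le_tsum h2).trans ?_
    rw [ENNReal.tsum_comm]
    refine le_of_eq ?_
    unfold lNorm
    rw [← ENNReal.tsum_mul_right]
    refine tsum_congr fun i => ?_
    rw [ENNReal.tsum_mul_left]
    congr 1
    exact (Equiv.subRight i).tsum_eq fun j => ‖y.coeff j‖ₑ * ρ ^ j

theorem lNorm_ofPowerSeries (ρ : ℝ≥0∞) (g : PowerSeries ℚ) :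
    lNorm ρ (HahnSeries.ofPowerSeries ℤ ℚ g) = psNorm ρ g := by
  rw [psNorm_eq, lNorm, ← Function.Injective.tsum_eq (g := fun n : ℕ => (n : ℤ)) Nat.cast_injective]
  · refine tsum_congr fun n => ?_
    rw [LaurentSeries.coeff_coe_powerSeries, zpow_natCast]
  · intro k hk
    rw [Function.mem_support, PowerSeries.coeff_coe] at hk
    split_ifs at hk with h
    · simp at hk
    · exact ⟨k.toNat, Int.toNat_of_nonneg (not_lt.mp h)⟩

/-- Laurent series of order at least `M`. -/
def ordGE (M : ℤ) : Submodule ℚ (LaurentSeries ℚ) where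
  carrier := {g | ∀ k < M, g.coeff k = 0}
  zero_mem' k _ := by simp
  add_mem' hx hy k hk := by rw [HahnSeries.coeff_add, hx k hk, hy k hk, add_zero]
  smul_mem' c x hx k hk := by rw [HahnSeries.coeff_smul, hx k hk, smul_zero]

/-- Laurent series without terms of exponent larger than `M`. -/
def degLE (M : ℤ) : Submodule ℚ (LaurentSeries ℚ) where
  carrier := {g | ∀ k > M, g.coeff k = 0}
  zero_mem' k _ := by simp
  add_mem' hx hy k hk := by rw [HahnSeries.coeff_add, hx k hk, hy k hk, add_zero]
  smul_mem' c x hx k hk := by rw [HahnSeries.coeff_smul, hx k hk, smul_zero]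

theorem ordGE_mono {M N : ℤ} (h : M ≤ N) : ordGE N ≤ ordGE M :=
  fun _ hg k hk => hg k (hk.trans_le h)

theorem degLE_mono {M N : ℤ} (h : M ≤ N) : degLE M ≤ degLE N :=
  fun _ hg k hk => hg k (lt_of_le_of_lt h hk)

theorem mul_mem_ordGE {M N : ℤ} {x y : LaurentSeries ℚ} (hx : x ∈ ordGE M) (hy : y ∈ ordGE N) :
    x * y ∈ ordGE (M + N) := by
  intro k hk
  rw [HahnSeries.coeff_mul]
  refine Finset.sum_eq_zero fun p hp => ?_
  have := (Finset.mem_antidiagonal.mp hp).2.2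
  rcases lt_or_ge p.1 M with h | h
  · rw [hx _ h, zero_mul]
  · rw [hy p.2 (by omega), mul_zero]

theorem mul_mem_degLE {M N : ℤ} {x y : LaurentSeries ℚ} (hx : x ∈ degLE M) (hy : y ∈ degLE N) :
    x * y ∈ degLE (M + N) := by
  intro k hk
  rw [HahnSeries.coeff_mul]
  refine Finset.sum_eq_zero fun p hp => ?_
  have := (Finset.mem_antidiagonal.mp hp).2.2
  rcases lt_or_ge M p.1 with h | h
  · rw [hx _ h, zero_mul]
  · rw [hy p.2 (by omega), mul_zero]

theorem coeff_mul_of_mem_ordGE {M N : ℤ} {x y : LaurentSeries ℚ} (hx : x ∈ ordGE M)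
    (hy : y ∈ ordGE N) : (x * y).coeff (M + N) = x.coeff M * y.coeff N := by
  rw [HahnSeries.coeff_mul, Finset.sum_eq_single (M, N)]
  · intro p hp hne
    have := (Finset.mem_antidiagonal.mp hp).2.2
    rcases lt_trichotomy p.1 M with h | h | h
    · rw [hx _ h, zero_mul]
    · exact absurd (Prod.ext h (by simp only; omega)) hne
    · rw [hy p.2 (by omega), mul_zero]
  · intro h
    by_contra hne
    refine h (Finset.mem_antidiagonal.mpr ⟨fun h0 => hne ?_, fun h0 => hne ?_, rfl⟩)
    · rw [h0, zero_mul]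
    · rw [h0, mul_zero]

theorem exists_mem_ordGE (g : LaurentSeries ℚ) : ∃ M, g ∈ ordGE M :=
  ⟨g.order, fun _ hk => HahnSeries.coeff_eq_zero_of_lt_order hk⟩

theorem single_mem_ordGE {M k : ℤ} (h : M ≤ k) (a : ℚ) : HahnSeries.single k a ∈ ordGE M :=
  fun j hj => HahnSeries.coeff_single_of_ne (by omega)

theorem single_mem_degLE {M k : ℤ} (h : k ≤ M) (a : ℚ) : HahnSeries.single k a ∈ degLE M :=
  fun j hj => HahnSeries.coeff_single_of_ne (by omega)

/-- The Laurent series of order at least `0`. -/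
def integers : Subring (LaurentSeries ℚ) where
  carrier := ordGE 0
  mul_mem' hx hy := by simpa using mul_mem_ordGE hx hy
  add_mem' hx hy := add_mem hx hy
  zero_mem' := zero_mem _
  one_mem' := single_mem_ordGE le_rfl 1
  neg_mem' hx := neg_mem hx

/-- The polynomials in `t⁻¹`. -/
def polys : Subring (LaurentSeries ℚ) where
  carrier := degLE 0
  mul_mem' hx hy := by simpa using mul_mem_degLE hx hy
  add_mem' hx hy := add_mem hx hy
  zero_mem' := zero_mem _
  one_mem' := single_mem_degLE le_rfl 1
  neg_mem' hx := neg_mem hx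

theorem mem_polys {g : LaurentSeries ℚ} : g ∈ polys ↔ g ∈ degLE 0 := Iff.rfl

theorem ofPowerSeries_mem_ordGE (g : PowerSeries ℚ) :
    HahnSeries.ofPowerSeries ℤ ℚ g ∈ ordGE 0 := by
  intro k hk
  rw [PowerSeries.coeff_coe, if_pos hk]

theorem finite_support_of_mem_degLE {M : ℤ} {g : LaurentSeries ℚ} (hg : g ∈ degLE M) :
    g.coeff.support.Finite := by
  obtain ⟨N, hN⟩ := exists_mem_ordGE g
  refine (Set.finite_Icc N M).subset fun k hk => ⟨?_, ?_⟩
  · by_contra h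
    exact hk (hN k (not_le.mp h))
  · by_contra h
    exact hk (hg k (not_le.mp h))

theorem lNorm_lt_top_of_mem_degLE {ρ : ℝ≥0∞} (h0 : ρ ≠ 0) (h1 : ρ ≠ ∞) {M : ℤ}
    {g : LaurentSeries ℚ} (hg : g ∈ degLE M) : lNorm ρ g < ∞ := by
  unfold lNorm
  rw [tsum_eq_sum (s := (finite_support_of_mem_degLE hg).toFinset)]
  · exact ENNReal.sum_lt_top.2 fun k _ =>
      ENNReal.mul_lt_top enorm_lt_top (ENNReal.zpow_lt_top h0 h1 k)
  · intro k hk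
    have : g.coeff k = 0 := by simpa using hk
    simp [this]

/-- The polynomial in `t⁻¹` formed by the terms of nonpositive exponent. -/
theorem exists_polys_sub_mem_ordGE (g : LaurentSeries ℚ) : ∃ p ∈ polys, g - p ∈ ordGE 1 := by
  obtain ⟨N, hN⟩ := exists_mem_ordGE g
  refine ⟨∑ k ∈ Finset.Icc N 0, HahnSeries.single k (g.coeff k), ?_, ?_⟩
  · exact Subring.sum_mem _ fun k hk => single_mem_degLE (Finset.mem_Icc.mp hk).2 _
  · intro j hj
    rw [HahnSeries.coeff_sub, HahnSeries.coeff_sum]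
    by_cases hjN : N ≤ j
    · rw [Finset.sum_eq_single j]
      · simp
      · intro k _ hk
        exact HahnSeries.coeff_single_of_ne hk.symm
      · intro h
        exact absurd (Finset.mem_Icc.mpr ⟨hjN, by omega⟩) h
    · rw [hN j (by omega), Finset.sum_eq_zero, sub_zero]
      intro k hk
      exact HahnSeries.coeff_single_of_ne (by have := Finset.mem_Icc.mp hk; omega)

theorem exists_poly_over_polys {f : PowerSeries ℚ} (hf : IsAlgebraicPS f) :
    ∃ p : Polynomial polys, p ≠ 0 ∧
      p.eval₂ polys.subtype (HahnSeries.ofPowerSeries ℤ ℚ f) = 0 := by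
  obtain ⟨P, hP0, hP⟩ := hf
  set M := P.support.sup fun j => (P.coeff j).natDegree
  set u : LaurentSeries ℚ := HahnSeries.single (-(M : ℤ)) 1
  have hu : u ≠ 0 := by simp [u]
  have hmem : ∀ j, u * HahnSeries.ofPowerSeries ℤ ℚ (P.coeff j : PowerSeries ℚ) ∈ polys := by
    intro j
    by_cases hj : j ∈ P.support
    · rw [mem_polys]
      intro k hk
      rw [mul_comm, HahnSeries.coeff_mul_single, PowerSeries.coeff_coe, if_neg (by omega),
        Polynomial.coeff_coe, Polynomial.coeff_eq_zero_of_natDegree_lt, zero_mul]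
      have h1 : (P.coeff j).natDegree ≤ M := Finset.le_sup (f := fun j => (P.coeff j).natDegree) hj
      omega
    · simp only [Polynomial.notMem_support_iff.mp hj, Polynomial.coe_zero, map_zero, mul_zero]
      exact zero_mem _
  refine ⟨∑ j ∈ Finset.range (P.natDegree + 1), Polynomial.monomial j ⟨_, hmem j⟩, ?_, ?_⟩
  · intro h
    have h1 := congrArg (fun q => Polynomial.coeff q P.natDegree) h
    simp only [Polynomial.finsetSum_coeff, Polynomial.coeff_monomial, Polynomial.coeff_zero] at h1
    rw [Finset.sum_ite_eq' , if_pos (by simp)] at h1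
    have h2 := congrArg Subtype.val h1
    simp only [ZeroMemClass.coe_zero] at h2
    rcases mul_eq_zero.mp h2 with h3 | h3
    · exact hu h3
    · rw [← map_zero (HahnSeries.ofPowerSeries ℤ ℚ)] at h3
      have h4 := HahnSeries.ofPowerSeries_injective h3
      rw [Polynomial.coe_eq_zero_iff] at h4
      exact hP0 (Polynomial.leadingCoeff_eq_zero.mp h4)
  · rw [Polynomial.eval₂_finsetSum]
    simp only [Polynomial.eval₂_monomial, Subring.subtype_apply]
    have h1 := congrArg (HahnSeries.ofPowerSeries ℤ ℚ) hP
    rw [Polynomial.eval₂_eq_sum_range, map_sum, map_zero] at h1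
    simp only [map_mul, map_pow, mul_assoc] at h1 ⊢
    rw [← Finset.mul_sum]
    exact mul_eq_zero_of_right _ h1

/-- A nonzero multiple of an algebraic Laurent series is integral over the ring of polynomials
in `t⁻¹`, of degree equal to its algebraic degree. -/
theorem exists_integral_multiple {F : LaurentSeries ℚ} {p : Polynomial polys} (hp : p ≠ 0)
    (hpF : p.eval₂ polys.subtype F = 0) :
    ∃ (α : polys) (m : Polynomial polys) (e : ℕ), α ≠ 0 ∧ m.Monic ∧ m.natDegree = e + 1 ∧
      m.eval₂ polys.subtype (α * F) = 0 ∧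
      ∀ q : Polynomial polys, q ≠ 0 → q.eval₂ polys.subtype (α * F) = 0 → e + 1 ≤ q.natDegree := by
  classical
  have hex : ∃ d, ∃ p : Polynomial polys, p ≠ 0 ∧ p.eval₂ polys.subtype F = 0 ∧ p.natDegree = d :=
    ⟨_, p, hp, hpF, rfl⟩
  obtain ⟨p, hp, hpF, hd⟩ := Nat.find_spec hex
  have hmin : ∀ q : Polynomial polys, q ≠ 0 → q.eval₂ polys.subtype F = 0 →
      p.natDegree ≤ q.natDegree := fun q h1 h2 => by
    rw [hd]
    exact Nat.find_min' hex ⟨q, h1, h2, rfl⟩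
  have hinj : ∀ x : polys, polys.subtype x = 0 → x = 0 := fun x hx => Subtype.ext hx
  have hp1 : p.natDegree ≠ 0 := by
    intro h0
    rw [Polynomial.eq_C_of_natDegree_eq_zero h0, Polynomial.eval₂_C] at hpF
    exact hp (by rw [Polynomial.eq_C_of_natDegree_eq_zero h0, hinj _ hpF, Polynomial.C_0])
  obtain ⟨e, he⟩ := Nat.exists_eq_succ_of_ne_zero hp1
  have hα : p.leadingCoeff ≠ 0 := Polynomial.leadingCoeff_ne_zero.mpr hp
  refine ⟨p.leadingCoeff, p.integralNormalization, e, hα,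
    Polynomial.monic_integralNormalization hp, ?_,
    Polynomial.integralNormalization_eval₂_eq_zero _ hpF hinj, fun q hq hqF => ?_⟩
  · rw [Polynomial.natDegree_integralNormalization, he]
  · have h1 : (q.comp (Polynomial.C p.leadingCoeff * Polynomial.X)).natDegree = q.natDegree := by
      rw [Polynomial.natDegree_comp, Polynomial.natDegree_C_mul_X _ hα, mul_one]
    rw [← h1, ← Nat.succ_eq_add_one, ← he]
    refine hmin _ ?_ ?_
    · intro h
      rw [Polynomial.comp_eq_zero_iff] at h
      rcases h with h | ⟨_, h⟩
      · exact hq h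
      · have := congrArg Polynomial.natDegree h
        rw [Polynomial.natDegree_C_mul_X _ hα, Polynomial.natDegree_C] at this
        omega
    · rw [Polynomial.eval₂_comp]
      simpa using hqF

/-- Multiplication by a root of a monic polynomial in the basis of powers. -/
theorem exists_mulVec_eq {K L : Type*} [CommRing K] [CommRing L] (φ : K →+* L)
    {m : Polynomial K} {e : ℕ} {η : L} (hm : m.Monic) (hd : m.natDegree = e + 1)
    (hη : m.eval₂ φ η = 0) :
    ∃ Θ : Matrix (Unit ⊕ Fin e) (Unit ⊕ Fin e) K,
      (Θ.map φ).mulVec (Sum.elim (fun _ => 1) fun i => η ^ (i.val + 1)) =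
        η • (Sum.elim (fun _ => 1) fun i => η ^ (i.val + 1) : Unit ⊕ Fin e → L) := by
  set v : Unit ⊕ Fin e → L := Sum.elim (fun _ => 1) fun i => η ^ (i.val + 1) with hv
  have key : ∀ j ≤ e, ∃ c : Unit ⊕ Fin e → K, ∑ i, φ (c i) * v i = η ^ (j + 1) := by
    intro j hj
    rcases hj.lt_or_eq with hj | rfl
    · refine ⟨Pi.single (Sum.inr ⟨j, hj⟩) 1, ?_⟩
      rw [Finset.sum_eq_single (Sum.inr ⟨j, hj⟩)]
      · simp [hv]
      · intro i _ hi
        simp [Pi.single_eq_of_ne hi]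
      · simp
    · refine ⟨Sum.elim (fun _ => -m.coeff 0) fun i => -m.coeff (i.val + 1), ?_⟩
      rw [Polynomial.eval₂_eq_sum_range, hd, Finset.sum_range_succ, ← hd,
        Polynomial.coeff_natDegree, hm.leadingCoeff, hd, Finset.sum_range_succ'] at hη
      rw [Fintype.sum_sum_type]
      simp only [hv, Sum.elim_inl, Sum.elim_inr, map_neg, neg_mul, Finset.univ_unique,
        Finset.sum_const, Finset.card_singleton, one_smul, mul_one, Finset.sum_neg_distrib]
      rw [Fin.sum_univ_eq_sum_range fun i => φ (m.coeff (i + 1)) * η ^ (i + 1)]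
      simp only [map_one, one_mul, pow_zero, mul_one] at hη
      linear_combination -hη
  have key2 : ∀ i : Unit ⊕ Fin e, ∃ c : Unit ⊕ Fin e → K, ∑ k, φ (c k) * v k = η * v i := by
    rintro (i | i)
    · simpa [hv] using key 0 (by omega)
    · have := key (i + 1) (by omega)
      simpa [hv, pow_succ'] using this
  choose c hc using key2
  refine ⟨Matrix.of c, ?_⟩
  ext i
  simp [Matrix.mulVec, dotProduct, hc]

/-- The shear with first column `(1, k)`. -/
def shear {L J : Type*} [CommRing L] [DecidableEq J] (k : J → L) :
    Matrix (Unit ⊕ J) (Unit ⊕ J) L :=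
  Matrix.fromBlocks 1 0 (Matrix.of fun i _ => k i) 1

section shear
variable {L J : Type*} [CommRing L] [DecidableEq J] [Fintype J]

theorem shear_mul_shear (k l : J → L) : shear k * shear l = shear (k + l) := by
  unfold shear
  rw [Matrix.fromBlocks_multiply]
  congr 1
  · simp
  · simp
  · ext i j
    simp
  · simp

omit [Fintype J] in
theorem shear_zero : shear (0 : J → L) = 1 := by
  unfold shear
  rw [← Matrix.fromBlocks_one]
  congr 1

theorem shear_neg_mul (k : J → L) : shear (-k) * shear k = 1 := by
  rw [shear_mul_shear, neg_add_cancel, shear_zero]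

theorem shear_mul_neg (k : J → L) : shear k * shear (-k) = 1 := by
  rw [shear_mul_shear, add_neg_cancel, shear_zero]

/-- Conjugation by a shear. -/
def shearConj (k : J → L) (A : Matrix (Unit ⊕ J) (Unit ⊕ J) L) :
    Matrix (Unit ⊕ J) (Unit ⊕ J) L := shear (-k) * A * shear k

theorem shearConj_mul (k : J → L) (A B : Matrix (Unit ⊕ J) (Unit ⊕ J) L) :
    shearConj k (A * B) = shearConj k A * shearConj k B := by
  unfold shearConj
  have h : shear k * (shear (-k) * (B * shear k)) = B * shear k := by
    rw [← Matrix.mul_assoc, shear_mul_neg, Matrix.one_mul]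
  simp only [Matrix.mul_assoc, h]

theorem shearConj_add (k : J → L) (A B : Matrix (Unit ⊕ J) (Unit ⊕ J) L) :
    shearConj k (A + B) = shearConj k A + shearConj k B := by
  simp only [shearConj, Matrix.mul_add, Matrix.add_mul]

theorem shearConj_smul (k : J → L) (c : L) (A : Matrix (Unit ⊕ J) (Unit ⊕ J) L) :
    shearConj k (c • A) = c • shearConj k A := by
  simp only [shearConj, Matrix.mul_smul, Matrix.smul_mul]

theorem shearConj_one (k : J → L) : shearConj k 1 = 1 := by
  rw [shearConj, Matrix.mul_one, shear_neg_mul]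

theorem shearConj_aeval (k : J → L) (A : Matrix (Unit ⊕ J) (Unit ⊕ J) L) (p : Polynomial L) :
    shearConj k (Polynomial.aeval A p) = Polynomial.aeval (shearConj k A) p := by
  induction p using Polynomial.induction_on' with
  | add p q hp hq => rw [map_add, map_add, shearConj_add, hp, hq]
  | monomial n a =>
    have h : shearConj k (A ^ n) = shearConj k A ^ n := by
      induction n with
      | zero => rw [pow_zero, pow_zero, shearConj_one]
      | succ n ih => rw [pow_succ, pow_succ, shearConj_mul, ih]
    rw [Polynomial.aeval_monomial, Polynomial.aeval_monomial, ← Algebra.smul_def,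
      ← Algebra.smul_def, shearConj_smul, h]

theorem trace_shearConj (k : J → L) (A : Matrix (Unit ⊕ J) (Unit ⊕ J) L) :
    (shearConj k A).trace = A.trace := by
  rw [shearConj, Matrix.trace_mul_cycle, shear_mul_neg, Matrix.one_mul]

theorem det_shearConj (k : J → L) (A : Matrix (Unit ⊕ J) (Unit ⊕ J) L) :
    (shearConj k A).det = A.det := by
  rw [shearConj, Matrix.det_mul_comm, ← Matrix.mul_assoc, shear_mul_neg, Matrix.one_mul]

theorem charpoly_shearConj (k : J → L) (A : Matrix (Unit ⊕ J) (Unit ⊕ J) L) :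
    (shearConj k A).charpoly = A.charpoly := by
  have h := Matrix.charpoly_units_conj
    (⟨shear (-k), shear k, shear_neg_mul k, shear_mul_neg k⟩ : (Matrix (Unit ⊕ J) (Unit ⊕ J) L)ˣ) A
  rw [← h, shearConj]
  congr 2
  exact (Matrix.inv_eq_right_inv (shear_neg_mul k)).symm

theorem shearConj_map {L' : Type*} [CommRing L'] (φ : L →+* L') (k : J → L)
    (A : Matrix (Unit ⊕ J) (Unit ⊕ J) L) :
    (shearConj k A).map φ = shearConj (fun i => φ (k i)) (A.map φ) := by
  have h : ∀ k : J → L, (shear k).map φ = shear fun i => φ (k i) := by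
    intro k
    unfold shear
    rw [Matrix.fromBlocks_map]
    congr 1
    · simp
    · simp
    · simp
  unfold shearConj
  rw [Matrix.map_mul, Matrix.map_mul, h, h]
  congr 3
  ext i
  simp

/-- Conjugation by the shear of an eigenvector makes a matrix block triangular. -/
theorem exists_shearConj_eq {k : J → L} {A : Matrix (Unit ⊕ J) (Unit ⊕ J) L} {η : L}
    (h : A.mulVec (Sum.elim (fun _ => 1) k) = η • (Sum.elim (fun _ => 1) k : Unit ⊕ J → L)) :
    ∃ r D, shearConj k A = Matrix.fromBlocks (Matrix.of fun _ _ => η) r 0 D := by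
  refine ⟨(shearConj k A).toBlocks₁₂, (shearConj k A).toBlocks₂₂, ?_⟩
  have h1 : ∀ (B : Matrix (Unit ⊕ J) (Unit ⊕ J) L) i,
      (B * shear k) i (Sum.inl ()) = B.mulVec (Sum.elim (fun _ => 1) k) i := by
    intro B i
    simp only [Matrix.mul_apply, Matrix.mulVec, dotProduct]
    refine Finset.sum_congr rfl fun j _ => ?_
    rcases j with j | j <;> simp [shear]
  have h2 : (shear (-k)).mulVec (Sum.elim (fun _ => 1) k) = Pi.single (Sum.inl ()) 1 := by
    ext i
    rw [← h1, shear_neg_mul]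
    rcases i with i | i <;> simp
  have h3 : ∀ i, shearConj k A i (Sum.inl ()) = η * (Pi.single (Sum.inl ()) 1 : _ → L) i := by
    intro i
    rw [shearConj, h1, ← Matrix.mulVec_mulVec, h, Matrix.mulVec_smul, h2]
    rfl
  conv_lhs => rw [← Matrix.fromBlocks_toBlocks (shearConj k A)]
  congr 1
  · ext i j
    have := h3 (Sum.inl ())
    simpa [Matrix.toBlocks₁₁] using this
  · ext i j
    have := h3 (Sum.inr i)
    simpa [Matrix.toBlocks₂₁] using this

theorem exists_aeval_fromBlocks (η : L) (r : Matrix Unit J L) (D : Matrix J J L)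
    (p : Polynomial L) :
    ∃ r' : Matrix Unit J L, Polynomial.aeval
      (Matrix.fromBlocks (Matrix.of fun _ _ => η) r 0 D : Matrix (Unit ⊕ J) (Unit ⊕ J) L) p =
      Matrix.fromBlocks (Matrix.of fun _ _ => p.eval η) r' 0 (Polynomial.aeval D p) := by
  induction p using Polynomial.induction_on' with
  | add p q hp hq =>
    obtain ⟨r₁, h₁⟩ := hp
    obtain ⟨r₂, h₂⟩ := hq
    refine ⟨r₁ + r₂, ?_⟩
    rw [map_add, h₁, h₂, Matrix.fromBlocks_add, map_add, zero_add]
    congr 1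
    ext i j
    simp
  | monomial n a =>
    have h : ∃ r' : Matrix Unit J L,
        (Matrix.fromBlocks (Matrix.of fun _ _ => η) r 0 D : Matrix (Unit ⊕ J) (Unit ⊕ J) L) ^ n =
        Matrix.fromBlocks (Matrix.of fun _ _ => η ^ n) r' 0 (D ^ n) := by
      induction n with
      | zero =>
        refine ⟨0, ?_⟩
        rw [pow_zero, pow_zero, ← Matrix.fromBlocks_one]
        congr 1
      | succ n ih =>
        obtain ⟨r', hr⟩ := ih
        refine ⟨(Matrix.of fun _ _ => η ^ n) * r + r' * D, ?_⟩
        rw [pow_succ, hr, Matrix.fromBlocks_multiply]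
        congr 1
        · ext i j
          simp [Matrix.mul_apply, pow_succ]
        · simp
        · simp [pow_succ]
    obtain ⟨r', hr⟩ := h
    refine ⟨a • r', ?_⟩
    rw [Polynomial.aeval_monomial, ← Algebra.smul_def, hr, Polynomial.aeval_monomial,
      ← Algebra.smul_def, Matrix.fromBlocks_smul]
    congr 1
    · ext i j
      simp
    · simp

end shear

/-- `g` is the eigenvalue of the matrix `A`, which has entries in `β ℚ[t⁻¹]`, on the vector
`(1, k)`, the quotient matrix being `D`. -/
structure IsPolar {e : ℕ} (ρ : ℝ≥0∞) (β : LaurentSeries ℚ) (k : Fin e → LaurentSeries ℚ) (M : ℤ)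
    (g : LaurentSeries ℚ) (A : Matrix (Unit ⊕ Fin e) (Unit ⊕ Fin e) (LaurentSeries ℚ))
    (D : Matrix (Fin e) (Fin e) (LaurentSeries ℚ)) : Prop where
  entries : ∀ i j, ∃ b ∈ polys, A i j = β * b
  conj : ∃ r, shearConj k A = Matrix.fromBlocks (Matrix.of fun _ _ => g) r 0 D
  quotient : ∀ i j, D i j ∈ ordGE M
  norm_lt_top : lNorm ρ g < ∞

namespace IsPolar
variable {e : ℕ} {ρ : ℝ≥0∞} {β : LaurentSeries ℚ} {k : Fin e → LaurentSeries ℚ} {M : ℤ}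
  {g g₁ g₂ : LaurentSeries ℚ} {A A₁ A₂ : Matrix (Unit ⊕ Fin e) (Unit ⊕ Fin e) (LaurentSeries ℚ)}
  {D D₁ D₂ : Matrix (Fin e) (Fin e) (LaurentSeries ℚ)}

theorem add (h0 : ρ ≠ 0) (hρ : ρ ≠ ∞) (h₁ : IsPolar ρ β k M g₁ A₁ D₁)
    (h₂ : IsPolar ρ β k M g₂ A₂ D₂) : IsPolar ρ β k M (g₁ + g₂) (A₁ + A₂) (D₁ + D₂) where
  entries i j := by
    obtain ⟨b₁, hb₁, e₁⟩ := h₁.entries i j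
    obtain ⟨b₂, hb₂, e₂⟩ := h₂.entries i j
    exact ⟨b₁ + b₂, add_mem hb₁ hb₂, by rw [Matrix.add_apply, e₁, e₂, mul_add]⟩
  conj := by
    obtain ⟨r₁, e₁⟩ := h₁.conj
    obtain ⟨r₂, e₂⟩ := h₂.conj
    refine ⟨r₁ + r₂, ?_⟩
    rw [shearConj_add, e₁, e₂, Matrix.fromBlocks_add, add_zero]
    congr 1
  quotient i j := add_mem (h₁.quotient i j) (h₂.quotient i j)
  norm_lt_top := (isExtNorm_lNorm h0 hρ).finite.add_mem h₁.norm_lt_top h₂.norm_lt_top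

theorem mul (h0 : ρ ≠ 0) (hρ : ρ ≠ ∞) (hβ : β ∈ polys) (hM : 0 ≤ M)
    (h₁ : IsPolar ρ β k M g₁ A₁ D₁)
    (h₂ : IsPolar ρ β k M g₂ A₂ D₂) : IsPolar ρ β k M (g₁ * g₂) (A₁ * A₂) (D₁ * D₂) where
  entries i j := by
    choose b₁ hb₁ e₁ using h₁.entries
    choose b₂ hb₂ e₂ using h₂.entries
    refine ⟨∑ l, b₁ i l * (β * b₂ l j),
      sum_mem fun l _ => mul_mem (hb₁ _ _) (mul_mem hβ (hb₂ _ _)), ?_⟩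
    rw [Matrix.mul_apply, Finset.mul_sum]
    refine Finset.sum_congr rfl fun l _ => ?_
    rw [e₁, e₂, mul_assoc]
  conj := by
    obtain ⟨r₁, e₁⟩ := h₁.conj
    obtain ⟨r₂, e₂⟩ := h₂.conj
    refine ⟨(Matrix.of fun _ _ => g₁) * r₂ + r₁ * D₂, ?_⟩
    rw [shearConj_mul, e₁, e₂, Matrix.fromBlocks_multiply]
    congr 1
    · ext i j
      simp [Matrix.mul_apply]
    · simp
    · simp
  quotient i j := by
    rw [Matrix.mul_apply]
    refine sum_mem fun l _ => ?_
    exact ordGE_mono (by omega) (mul_mem_ordGE (h₁.quotient i l) (h₂.quotient l j))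
  norm_lt_top := (isExtNorm_lNorm h0 hρ).finite.mul_mem h₁.norm_lt_top h₂.norm_lt_top

theorem smul (h0 : ρ ≠ 0) (hρ : ρ ≠ ∞) (c : ℚ) (h : IsPolar ρ β k M g A D) :
    IsPolar ρ β k M (c • g) ((HahnSeries.single 0 c : LaurentSeries ℚ) • A)
      ((HahnSeries.single 0 c : LaurentSeries ℚ) • D) where
  entries i j := by
    obtain ⟨b, hb, e⟩ := h.entries i j
    refine ⟨HahnSeries.single 0 c * b, mul_mem (single_mem_degLE le_rfl c) hb, ?_⟩
    rw [Matrix.smul_apply, e, smul_eq_mul]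
    ring
  conj := by
    obtain ⟨r, e⟩ := h.conj
    refine ⟨(HahnSeries.single 0 c : LaurentSeries ℚ) • r, ?_⟩
    rw [shearConj_smul, e, Matrix.fromBlocks_smul, smul_zero]
    congr 1
    ext i j : 2
    simp
  quotient i j := by
    rw [Matrix.smul_apply, smul_eq_mul, ← zero_add M]
    exact mul_mem_ordGE (single_mem_ordGE le_rfl c) (h.quotient i j)
  norm_lt_top := by
    rw [← HahnSeries.single_zero_mul_eq_smul]
    exact (isExtNorm_lNorm h0 hρ).finite.mul_mem
      (lNorm_lt_top_of_mem_degLE h0 hρ (single_mem_degLE le_rfl c)) h.norm_lt_top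

theorem zero : IsPolar ρ β k M 0 0 0 where
  entries i j := ⟨0, zero_mem _, by simp⟩
  conj := ⟨0, by
    rw [shearConj, Matrix.mul_zero, Matrix.zero_mul, ← Matrix.fromBlocks_zero]
    congr 1⟩
  quotient i j := zero_mem _
  norm_lt_top := by simp [lNorm]

theorem det_eq {B ι : Type*} [CommRing B] (φ : LaurentSeries ℚ →+* B) (s : Finset ι)
    {g : ι → LaurentSeries ℚ} {A : ι → Matrix (Unit ⊕ Fin e) (Unit ⊕ Fin e) (LaurentSeries ℚ)}
    {D : ι → Matrix (Fin e) (Fin e) (LaurentSeries ℚ)}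
    (h : ∀ l, IsPolar ρ β k M (g l) (A l) (D l)) (x : ι → B) :
    (1 + ∑ l ∈ s, x l • (A l).map φ).det =
      (1 + ∑ l ∈ s, x l * φ (g l)) * (1 + ∑ l ∈ s, x l • (D l).map φ).det := by
  set k' : Fin e → B := fun i => φ (k i)
  have key : ∃ r, shearConj k' (1 + ∑ l ∈ s, x l • (A l).map φ) =
      Matrix.fromBlocks (Matrix.of fun _ _ => 1 + ∑ l ∈ s, x l * φ (g l)) r 0
        (1 + ∑ l ∈ s, x l • (D l).map φ) := by
    classical
    induction s using Finset.induction_on with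
    | empty =>
      refine ⟨0, ?_⟩
      rw [Finset.sum_empty, Finset.sum_empty, Finset.sum_empty, add_zero, add_zero, add_zero,
        shearConj_one, ← Matrix.fromBlocks_one]
      congr 1
    | insert l s hl ih =>
      obtain ⟨r, hr⟩ := ih
      obtain ⟨r₁, hr₁⟩ := (h l).conj
      have h2 : shearConj k' ((A l).map φ) =
          Matrix.fromBlocks (Matrix.of fun _ _ => φ (g l)) (r₁.map φ) 0 ((D l).map φ) := by
        rw [← shearConj_map, hr₁, Matrix.fromBlocks_map]
        congr 1
        · ext i j
          simp
      refine ⟨x l • r₁.map φ + r, ?_⟩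
      rw [Finset.sum_insert hl, Finset.sum_insert hl, Finset.sum_insert hl, add_left_comm,
        shearConj_add, hr, shearConj_smul, h2, Matrix.fromBlocks_smul, Matrix.fromBlocks_add,
        smul_zero, add_zero, add_left_comm 1]
      congr 1
      ext i j
      simp
      ring
  obtain ⟨r, hr⟩ := key
  rw [← det_shearConj k', hr, Matrix.det_fromBlocks_zero₂₁, Matrix.det_unique]
  simp

theorem coeff_mul_eq_zero {F α : LaurentSeries ℚ} {Θ : Matrix (Unit ⊕ Fin e) (Unit ⊕ Fin e) polys}
    {r : Matrix Unit (Fin e) (LaurentSeries ℚ)} {Θ' : Matrix (Fin e) (Fin e) (LaurentSeries ℚ)}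
    (hα : α ≠ 0) (hΘ : shearConj k (Θ.map polys.subtype) =
      Matrix.fromBlocks (Matrix.of fun _ _ => α * F) r 0 Θ')
    (hM : ∀ i j, α⁻¹ * Θ' i j ∈ ordGE (-M)) (hβ : β = α * HahnSeries.single (-2) 1)
    (h : IsPolar ρ β k M g A D) : (F * g).coeff (-1) = 0 := by
  obtain ⟨r₁, hr₁⟩ := h.conj
  have htr : ((Θ.map polys.subtype) * A).trace = α * F * g + (Θ' * D).trace := by
    rw [← trace_shearConj k, shearConj_mul, hΘ, hr₁, Matrix.fromBlocks_multiply]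
    simp [Matrix.trace, Matrix.mul_apply]
  have h1 : F * g = α⁻¹ * ((Θ.map polys.subtype) * A).trace - α⁻¹ * (Θ' * D).trace := by
    rw [htr]
    field_simp
    ring
  have h2 : α⁻¹ * ((Θ.map polys.subtype) * A).trace ∈ degLE (-2) := by
    choose b hb eb using h.entries
    simp only [Matrix.trace, Matrix.diag_apply, Matrix.mul_apply, Finset.mul_sum]
    refine sum_mem fun i _ => sum_mem fun j _ => ?_
    rw [eb, hβ, Matrix.map_apply]
    have : α⁻¹ * (polys.subtype (Θ i j) * (α * HahnSeries.single (-2) 1 * b j i)) =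
        HahnSeries.single (-2) 1 * (polys.subtype (Θ i j) * b j i) := by
      field_simp
    rw [this, ← add_zero (-2 : ℤ)]
    exact mul_mem_degLE (single_mem_degLE (by norm_num) 1)
      (mem_polys.mp (mul_mem (Θ i j).2 (hb j i)))
  have h3 : α⁻¹ * (Θ' * D).trace ∈ ordGE 0 := by
    simp only [Matrix.trace, Matrix.diag_apply, Matrix.mul_apply, Finset.mul_sum]
    refine sum_mem fun i _ => sum_mem fun j _ => ?_
    rw [← mul_assoc, ← neg_add_cancel M]
    exact mul_mem_ordGE (hM i j) (h.quotient j i)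
  rw [h1, HahnSeries.coeff_sub, h2 _ (by norm_num), h3 _ (by norm_num), sub_zero]

end IsPolar

/-- A linear map to a finite dimensional space kills polynomials in `t⁻¹` of all but finitely
many degrees. -/
theorem exists_polys_apply_eq_zero {W : Type*} [AddCommGroup W] [Module ℚ W]
    [FiniteDimensional ℚ W] (T : LaurentSeries ℚ →ₗ[ℚ] W) :
    ∃ k₀ : ℕ, ∀ k : ℕ, k₀ ≤ k → ∃ q ∈ polys, q ∈ ordGE (-k) ∧ q.coeff (-k) = 1 ∧ T q = 0 := by
  set x : ℕ → LaurentSeries ℚ := fun k => HahnSeries.single (-(k : ℤ)) 1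
  set U : ℕ → Submodule ℚ (LaurentSeries ℚ) := fun k => Submodule.span ℚ (x '' Set.Iio k)
  have hU : Monotone U := fun i j hij => Submodule.span_mono
    (Set.image_mono (Set.Iio_subset_Iio hij))
  obtain ⟨k₀, hk₀⟩ := monotone_stabilizes_iff_noetherian.mpr (inferInstance : IsNoetherian ℚ W)
    ⟨fun k => (U k).map T, fun i j hij => Submodule.map_mono (hU hij)⟩
  refine ⟨k₀, fun k hk => ?_⟩
  have h1 : T (x k) ∈ (U k).map T := by
    have h2 : (U k).map T = (U (k + 1)).map T :=
      (hk₀ k hk).symm.trans (hk₀ (k + 1) (by omega))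
    rw [h2]
    exact Submodule.mem_map_of_mem (Submodule.subset_span ⟨k, Nat.lt_succ_self k, rfl⟩)
  obtain ⟨y, hy, hTy⟩ := h1
  have hy1 : y ∈ degLE 0 := by
    refine (Submodule.span_le.mpr ?_) hy
    rintro _ ⟨j, _, rfl⟩
    exact single_mem_degLE (by omega) 1
  have hy2 : y ∈ ordGE (-k + 1) := by
    refine (Submodule.span_le.mpr ?_) hy
    rintro _ ⟨j, hj, rfl⟩
    rw [Set.mem_Iio] at hj
    exact single_mem_ordGE (by omega) 1
  refine ⟨x k - y, sub_mem (single_mem_degLE (by omega) 1) hy1,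
    sub_mem (single_mem_ordGE le_rfl 1) (ordGE_mono (by omega) hy2), ?_, ?_⟩
  · rw [HahnSeries.coeff_sub, hy2 _ (by omega)]
    simp [x]
  · rw [map_sub, hTy, sub_self]

theorem exists_forall_mem_ordGE {ι : Type*} [Finite ι] (g : ι → LaurentSeries ℚ) :
    ∃ N, ∀ i, g i ∈ ordGE N := by
  choose N hN using fun i => exists_mem_ordGE (g i)
  obtain ⟨B, hB⟩ := (Set.finite_range N).bddBelow
  exact ⟨B, fun i => ordGE_mono (hB ⟨i, rfl⟩) (hN i)⟩

/-- The coefficients of `t, …, t ^ M` in the products of the argument with the `x i`. -/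
noncomputable def coeffWindow {e : ℕ} (x : Fin e → LaurentSeries ℚ) (M : ℕ) :
    LaurentSeries ℚ →ₗ[ℚ] (Fin e → Fin M → ℚ) where
  toFun q i j := (q * x i).coeff (j + 1)
  map_add' p q := by
    ext i j
    simp [add_mul]
  map_smul' c q := by
    ext i j
    rw [RingHom.id_apply, Pi.smul_apply, Pi.smul_apply, ← HahnSeries.coeff_smul,
      ← HahnSeries.single_zero_mul_eq_smul, ← HahnSeries.single_zero_mul_eq_smul, mul_assoc]

theorem exists_isPolar {e : ℕ} {ρ : ℝ≥0∞} (h0 : ρ ≠ 0) (hρ : ρ ≠ ∞) {β η : LaurentSeries ℚ}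
    {k : Fin e → LaurentSeries ℚ} {Θ : Matrix (Unit ⊕ Fin e) (Unit ⊕ Fin e) polys}
    {r : Matrix Unit (Fin e) (LaurentSeries ℚ)} {Θ' : Matrix (Fin e) (Fin e) (LaurentSeries ℚ)}
    (hΘ : shearConj k (Θ.map polys.subtype) =
      Matrix.fromBlocks (Matrix.of fun _ _ => η) r 0 Θ')
    (hκ : Θ'.charpoly.eval η ≠ 0) (hβ : β ∈ polys) (hβ0 : β ≠ 0) (hη : lNorm ρ η < ∞) (M : ℤ) :
    ∃ n₀ : ℕ, ∀ j : ℕ, n₀ < j → ∃ g A D, IsPolar ρ β k M g A D ∧ g ∈ ordGE (-j) ∧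
      g.coeff (-j) = 1 := by
  set κ := Θ'.charpoly
  have hκe : κ.natDegree = e := by
    rw [Matrix.charpoly_natDegree_eq_dim, Fintype.card_fin]
  have hκm : κ.Monic := Matrix.charpoly_monic _
  set c := β * κ.eval η with hc
  have hc0 : c ≠ 0 := mul_ne_zero hβ0 hκ
  have hco : c ∈ ordGE c.order := fun _ hk => HahnSeries.coeff_eq_zero_of_lt_order hk
  have hcc : c.coeff c.order ≠ 0 := fun h => hc0 (HahnSeries.coeff_order_eq_zero.mp h)
  obtain ⟨N₀, hN₀⟩ := exists_forall_mem_ordGE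
    fun x : Fin e × Fin e × Fin e => (Θ' ^ (x.1 : ℕ)) x.2.1 x.2.2
  obtain ⟨N₁, hN₁⟩ := exists_forall_mem_ordGE fun i : Fin e => η ^ (i : ℕ)
  obtain ⟨N₂, hN₂⟩ := exists_mem_ordGE β
  set M₁ : ℕ := (M - N₂ - N₀).toNat + (-N₂ - N₁).toNat with hM₁
  obtain ⟨k₀, hk₀⟩ := exists_polys_apply_eq_zero (coeffWindow (fun i : Fin e => κ.coeff i) M₁)
  refine ⟨k₀ + c.order.natAbs, fun j hj => ?_⟩
  obtain ⟨kk, hkk⟩ : ∃ kk : ℕ, (kk : ℤ) = j + c.order := ⟨(j + c.order).toNat, by omega⟩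
  obtain ⟨q, hq, hqo, hqc, hqT⟩ := hk₀ kk (by omega)
  choose p hp hpq using fun i : Fin e => exists_polys_sub_mem_ordGE (q * κ.coeff i)
  set s : Fin e → LaurentSeries ℚ := fun i => p i - q * κ.coeff i with hs
  have hs1 : ∀ i, s i ∈ ordGE M₁ := by
    intro i a ha
    by_cases h1 : a < 1
    · have := hpq i a h1
      rw [hs, HahnSeries.coeff_sub]
      rw [HahnSeries.coeff_sub] at this
      linarith
    · obtain ⟨b, rfl⟩ : ∃ b : ℕ, a = b + 1 := ⟨(a - 1).toNat, by omega⟩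
      have h2 : (q * κ.coeff i).coeff (b + 1) = 0 :=
        congrFun (congrFun hqT i) ⟨b, by omega⟩
      rw [hs, HahnSeries.coeff_sub, h2, sub_zero]
      exact hp i _ (by omega)
  set w : Polynomial (LaurentSeries ℚ) := Polynomial.C q * κ +
    ∑ i : Fin e, Polynomial.C (s i) * Polynomial.X ^ (i : ℕ) with hw
  have hwc : ∀ i, w.coeff i ∈ polys := by
    intro i
    rw [hw, Polynomial.coeff_add, Polynomial.coeff_C_mul, Polynomial.finsetSum_coeff]
    simp only [Polynomial.coeff_C_mul_X_pow]
    rcases lt_trichotomy i e with h | rfl | h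
    · rw [Finset.sum_eq_single ⟨i, h⟩]
      · rw [if_pos rfl, hs]
        simpa using hp ⟨i, h⟩
      · intro b _ hb
        rw [if_neg]
        intro h3
        exact hb (Fin.ext h3.symm)
      · simp
    · rw [Finset.sum_eq_zero fun b _ => if_neg (by omega), add_zero, ← hκe, hκm.coeff_natDegree,
        mul_one]
      exact hq
    · rw [Finset.sum_eq_zero fun b _ => if_neg (by omega), add_zero,
        Polynomial.coeff_eq_zero_of_natDegree_lt (by omega), mul_zero]
      exact zero_mem _
  set ΘL := Θ.map polys.subtype
  have hpol : IsPolar ρ β k M ((Polynomial.C β * w).eval η)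
      (Polynomial.aeval ΘL (Polynomial.C β * w)) (Polynomial.aeval Θ' (Polynomial.C β * w)) := by
    refine ⟨fun a b => ?_, ?_, fun a b => ?_, ?_⟩
    · refine ⟨Polynomial.aeval ΘL w a b, ?_, ?_⟩
      · rw [Polynomial.aeval_eq_sum_range, Matrix.sum_apply]
        refine sum_mem fun i _ => mul_mem (hwc i) ?_
        have h1 : ΘL ^ i = (Θ ^ i).map polys.subtype := (Matrix.map_pow _ _ _).symm
        rw [h1]
        exact ((Θ ^ i) a b).2
      · rw [map_mul, Polynomial.aeval_C, ← Algebra.smul_def]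
        rfl
    · rw [shearConj_aeval, hΘ]
      exact exists_aeval_fromBlocks _ _ _ _
    · rw [map_mul, Polynomial.aeval_C, ← Algebra.smul_def, hw, map_add, map_mul,
        Matrix.aeval_self_charpoly, mul_zero, zero_add, map_sum, Matrix.smul_apply,
        Matrix.sum_apply, smul_eq_mul]
      refine ordGE_mono (show M ≤ N₂ + (M₁ + N₀) by omega)
        (mul_mem_ordGE hN₂ (sum_mem fun i _ => ?_))
      rw [map_mul, Polynomial.aeval_C, ← Algebra.smul_def, map_pow, Polynomial.aeval_X]
      exact mul_mem_ordGE (hs1 i) (hN₀ ⟨i, a, b⟩)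
    · refine (isExtNorm_lNorm h0 hρ).finite.mem_carrier.mp ?_
      rw [Polynomial.eval_mul, Polynomial.eval_C, Polynomial.eval_eq_sum_range]
      refine mul_mem (lNorm_lt_top_of_mem_degLE h0 hρ hβ) (sum_mem fun i _ => mul_mem
        (lNorm_lt_top_of_mem_degLE h0 hρ (hwc i)) 
        (pow_mem (show η ∈ (isExtNorm_lNorm h0 hρ).finite from hη) i))
  have hg : (Polynomial.C β * w).eval η = q * c + β * ∑ i : Fin e, s i * η ^ (i : ℕ) := by
    rw [hw, hc]
    simp only [Polynomial.eval_mul, Polynomial.eval_add, Polynomial.eval_C,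
      Polynomial.eval_finsetSum, Polynomial.eval_pow, Polynomial.eval_X]
    ring
  have hg2 : β * ∑ i : Fin e, s i * η ^ (i : ℕ) ∈ ordGE 0 :=
    ordGE_mono (show 0 ≤ N₂ + (M₁ + N₁) by omega)
      (mul_mem_ordGE hN₂ (sum_mem fun i _ => mul_mem_ordGE (hs1 i) (hN₁ i)))
  have hj : -(j : ℤ) = -kk + c.order := by omega
  refine ⟨_, _, _, hpol.smul h0 hρ (c.coeff c.order)⁻¹, ?_, ?_⟩
  · refine Submodule.smul_mem _ _ ?_
    rw [hg, hj]
    exact add_mem (mul_mem_ordGE hqo hco) (ordGE_mono (by omega) hg2)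
  · rw [HahnSeries.coeff_smul, hg, HahnSeries.coeff_add, hg2 _ (by omega), hj,
      coeff_mul_of_mem_ordGE hqo hco, hqc, one_mul, add_zero, smul_eq_mul, inv_mul_cancel₀ hcc]

/-- An algebra of Laurent series with poles of almost all orders and orthogonal to `F` under the
residue pairing, realised by eigenvalues of matrices. -/
structure PoleAlgebra (F : LaurentSeries ℚ) (ρ : ℝ≥0∞) where
  V : Submodule ℚ (LaurentSeries ℚ)
  mul_mem : ∀ g₁ ∈ V, ∀ g₂ ∈ V, g₁ * g₂ ∈ V
  coeff_mul_eq_zero : ∀ g ∈ V, (F * g).coeff (-1) = 0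
  norm_lt_top : ∀ g ∈ V, lNorm ρ g < ∞
  n₀ : ℕ
  exists_pole : ∀ j : ℕ, n₀ < j → ∃ g ∈ V, g ∈ ordGE (-j) ∧ g.coeff (-j) = 1
  e : ℕ
  A : V → Matrix (Unit ⊕ Fin e) (Unit ⊕ Fin e) (LaurentSeries ℚ)
  D : V → Matrix (Fin e) (Fin e) (LaurentSeries ℚ)
  A_mem : ∀ g i j, A g i j ∈ degLE (-1)
  D_mem : ∀ g i j, D g i j ∈ ordGE 0
  det_eq : ∀ {B ι : Type} [CommRing B] (φ : LaurentSeries ℚ →+* B) (s : Finset ι)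
    (g : ι → V) (x : ι → B), (1 + ∑ l ∈ s, x l • (A (g l)).map φ).det =
      (1 + ∑ l ∈ s, x l * φ (g l)) * (1 + ∑ l ∈ s, x l • (D (g l)).map φ).det

theorem nonempty_poleAlgebra {f : PowerSeries ℚ} (hf : IsAlgebraicPS f) {ρ : ℝ≥0∞} (h0 : ρ ≠ 0)
    (hρ : ρ ≠ ∞) (hfρ : psNorm ρ f < ∞) :
    Nonempty (PoleAlgebra (HahnSeries.ofPowerSeries ℤ ℚ f) ρ) := by
  set F := HahnSeries.ofPowerSeries ℤ ℚ f
  obtain ⟨p, hp, hpF⟩ := exists_poly_over_polys hf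
  obtain ⟨α, m, e, hα, hm, hme, hmη, hmin⟩ := exists_integral_multiple hp hpF
  set η : LaurentSeries ℚ := α * F with hη
  obtain ⟨Θ, hΘ⟩ := exists_mulVec_eq polys.subtype hm hme hmη
  set k : Fin e → LaurentSeries ℚ := fun i => η ^ (i.val + 1)
  obtain ⟨r, Θ', hr⟩ := exists_shearConj_eq hΘ
  have hα' : (α : LaurentSeries ℚ) ≠ 0 := fun h => hα (Subtype.ext h)
  have : IsAddTorsionFree polys := ⟨fun n hn x y h => by
    refine Subtype.ext (HahnSeries.ext (funext fun i => ?_))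
    have h1 : (n • (x : LaurentSeries ℚ)).coeff i = (n • (y : LaurentSeries ℚ)).coeff i :=
      congrArg (fun z : polys => (z : LaurentSeries ℚ).coeff i) h
    rw [HahnSeries.coeff_nsmul, HahnSeries.coeff_nsmul] at h1
    exact nsmul_right_injective hn h1⟩
  have hτ : (HahnSeries.single (-2 : ℤ) (1 : ℚ)) ≠ 0 := by simp
  have hκ : Θ'.charpoly.eval η ≠ 0 := by
    have h1 : Θ.charpoly.map polys.subtype = (Polynomial.X - Polynomial.C η) * Θ'.charpoly := by
      rw [← Matrix.charpoly_map, ← charpoly_shearConj k, hr, Matrix.charpoly_fromBlocks_zero₂₁]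
      congr 1
      rw [Matrix.charpoly, Matrix.det_unique]
      simp
    have h2 : Θ.charpoly.derivative.eval₂ polys.subtype η = Θ'.charpoly.eval η := by
      rw [← Polynomial.eval_map, ← Polynomial.derivative_map, h1, Polynomial.derivative_mul]
      simp
    intro h3
    rw [h3] at h2
    have h4 : Θ.charpoly.natDegree = e + 1 := by
      rw [Matrix.charpoly_natDegree_eq_dim]
      simp [add_comm]
    have h5 : Θ.charpoly.derivative ≠ 0 := by
      intro h6
      have := Polynomial.derivative_eq_zero.mp h6
      omega
    have h7 := hmin _ h5 h2
    have h8 := Polynomial.natDegree_derivative_lt (p := Θ.charpoly) (by omega)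
    omega
  obtain ⟨N, hN⟩ := exists_forall_mem_ordGE
    fun x : Fin e × Fin e => (α : LaurentSeries ℚ)⁻¹ * Θ' x.1 x.2
  set M : ℤ := (N.natAbs : ℤ)
  set β : LaurentSeries ℚ := (α : LaurentSeries ℚ) * HahnSeries.single (-2) 1 with hβ
  have hβ2 : β ∈ degLE (-2) := by
    have := mul_mem_degLE α.2 (single_mem_degLE (le_refl (-2)) 1)
    rwa [zero_add] at this
  have hβp : β ∈ polys := degLE_mono (by norm_num) hβ2
  have hηρ : lNorm ρ η < ∞ := (isExtNorm_lNorm h0 hρ).finite.mul_mem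
    (lNorm_lt_top_of_mem_degLE h0 hρ α.2) (by
      show lNorm ρ F < ∞
      rwa [lNorm_ofPowerSeries])
  obtain ⟨n₀, hn₀⟩ := exists_isPolar h0 hρ hr hκ hβp (mul_ne_zero hα' hτ) hηρ M
  let V : Submodule ℚ (LaurentSeries ℚ) :=
    { carrier := {g | ∃ A D, IsPolar ρ β k M g A D}
      zero_mem' := ⟨_, _, IsPolar.zero⟩
      add_mem' := fun ⟨_, _, h₁⟩ ⟨_, _, h₂⟩ => ⟨_, _, h₁.add h0 hρ h₂⟩
      smul_mem' := fun c _ ⟨_, _, h⟩ => ⟨_, _, h.smul h0 hρ c⟩ }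
  have hV : ∀ g : V, ∃ A D, IsPolar ρ β k M g A D := fun g => g.2
  choose A D hAD using hV
  exact ⟨{
    V := V
    mul_mem := fun _ ⟨_, _, h₁⟩ _ ⟨_, _, h₂⟩ =>
      ⟨_, _, h₁.mul h0 hρ hβp (by omega) h₂⟩
    coeff_mul_eq_zero := fun _ ⟨_, _, h⟩ => h.coeff_mul_eq_zero hα' hr
      (fun i j => ordGE_mono (by omega) (hN ⟨i, j⟩)) hβ
    norm_lt_top := fun _ ⟨_, _, h⟩ => h.norm_lt_top
    n₀ := n₀
    exists_pole := fun j hj => by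
      obtain ⟨g, A, D, h, h1, h2⟩ := hn₀ j hj
      exact ⟨g, ⟨A, D, h⟩, h1, h2⟩
    e := e
    A := A
    D := D
    A_mem := fun g i j => by
      obtain ⟨b, hb, h⟩ := (hAD g).entries i j
      rw [h]
      exact degLE_mono (by norm_num) (mul_mem_degLE hβ2 hb)
    D_mem := fun g i j => ordGE_mono (by omega) ((hAD g).quotient i j)
    det_eq := fun φ s g x => IsPolar.det_eq φ s (fun l => hAD (g l)) x }⟩

noncomputable instance instAlgebraLaurent : Algebra ℚ (LaurentSeries ℚ) := HahnSeries.instAlgebra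

section
variable {σ A : Type} [CommRing A]

/-- The ideal of power series all of whose terms have degree at least `K`. -/
def degGE (σ A : Type) [CommRing A] (K : ℕ) : Ideal (MvPowerSeries σ A) where
  carrier := {g | ∀ α : σ →₀ ℕ, α.degree < K → MvPowerSeries.coeff α g = 0}
  zero_mem' := fun _ _ => map_zero _
  add_mem' := fun hx hy α h => by rw [map_add, hx α h, hy α h, add_zero]
  smul_mem' := fun c x hx α h => by
    classical
    rw [smul_eq_mul, MvPowerSeries.coeff_mul]
    refine Finset.sum_eq_zero fun p hp => ?_
    rw [← Finset.HasAntidiagonal.mem_antidiagonal.mp hp, map_add] at h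
    rw [hx p.2 (by omega), mul_zero]

theorem mem_degGE {K : ℕ} {g : MvPowerSeries σ A} :
    g ∈ degGE σ A K ↔ ∀ α : σ →₀ ℕ, α.degree < K → MvPowerSeries.coeff α g = 0 := Iff.rfl

theorem degGE_mono {K M : ℕ} (h : K ≤ M) : degGE σ A M ≤ degGE σ A K :=
  fun _ hg α hα => hg α (hα.trans_le h)

theorem mem_degGE_one {g : MvPowerSeries σ A} :
    g ∈ degGE σ A 1 ↔ MvPowerSeries.constantCoeff g = 0 := by
  rw [mem_degGE]
  constructor
  · intro h
    exact h 0 (by simp)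
  · intro h α hα
    rw [(Finsupp.degree_eq_zero_iff α).mp (by omega)]
    exact h

theorem mul_mem_degGE {K M : ℕ} {g h : MvPowerSeries σ A} (hg : g ∈ degGE σ A K)
    (hh : h ∈ degGE σ A M) : g * h ∈ degGE σ A (K + M) := by
  classical
  intro α hα
  rw [MvPowerSeries.coeff_mul]
  refine Finset.sum_eq_zero fun p hp => ?_
  rw [← Finset.HasAntidiagonal.mem_antidiagonal.mp hp, map_add] at hα
  by_cases h1 : p.1.degree < K
  · rw [hg _ h1, zero_mul]
  · rw [hh _ (by omega), mul_zero]

theorem pow_mem_degGE {g : MvPowerSeries σ A} (hg : g ∈ degGE σ A 1) (k : ℕ) :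
    g ^ k ∈ degGE σ A k := by
  induction k with
  | zero => exact fun α hα => absurd hα (by omega)
  | succ k ih => exact pow_succ g k ▸ mul_mem_degGE ih hg

/-- The Euler operator `∑ c ∂/∂c`. -/
noncomputable def euler (g : MvPowerSeries σ A) : MvPowerSeries σ A :=
  fun α => (α.degree : A) * MvPowerSeries.coeff α g

theorem coeff_euler (α : σ →₀ ℕ) (g : MvPowerSeries σ A) :
    MvPowerSeries.coeff α (euler g) = (α.degree : A) * MvPowerSeries.coeff α g := rfl

theorem euler_add (g h : MvPowerSeries σ A) : euler (g + h) = euler g + euler h := by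
  ext α
  simp only [coeff_euler, map_add, mul_add]

theorem euler_neg (g : MvPowerSeries σ A) : euler (-g) = -euler g := by
  ext α
  simp only [coeff_euler, map_neg, mul_neg]

theorem euler_sub (g h : MvPowerSeries σ A) : euler (g - h) = euler g - euler h := by
  rw [sub_eq_add_neg, euler_add, euler_neg, sub_eq_add_neg]

theorem euler_one : euler (1 : MvPowerSeries σ A) = 0 := by
  classical
  ext α
  rw [coeff_euler, MvPowerSeries.coeff_one]
  split_ifs with h
  · simp [h]
  · simp

theorem euler_mul (g h : MvPowerSeries σ A) : euler (g * h) = euler g * h + g * euler h := by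
  classical
  ext α
  rw [map_add, coeff_euler, MvPowerSeries.coeff_mul, MvPowerSeries.coeff_mul,
    MvPowerSeries.coeff_mul, Finset.mul_sum, ← Finset.sum_add_distrib]
  refine Finset.sum_congr rfl fun p hp => ?_
  rw [coeff_euler, coeff_euler, ← Finset.HasAntidiagonal.mem_antidiagonal.mp hp, map_add]
  push_cast
  ring

theorem euler_pow_succ (g : MvPowerSeries σ A) (k : ℕ) :
    euler (g ^ (k + 1)) = ((k : MvPowerSeries σ A) + 1) * (g ^ k * euler g) := by
  induction k with
  | zero => simp
  | succ k ih =>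
    rw [pow_succ, euler_mul, ih]
    push_cast
    ring

theorem isUnit_of_sub_one_mem {u : MvPowerSeries σ A} (hu : u - 1 ∈ degGE σ A 1) : IsUnit u := by
  rw [MvPowerSeries.isUnit_iff_constantCoeff]
  have := mem_degGE_one.mp hu
  rw [map_sub, map_one, sub_eq_zero] at this
  rw [this]
  exact isUnit_one

theorem mul_sub_one_mem {u v : MvPowerSeries σ A} {K : ℕ} (hu : u - 1 ∈ degGE σ A K)
    (hv : v - 1 ∈ degGE σ A K) : u * v - 1 ∈ degGE σ A K := by
  have : u * v - 1 = v * (u - 1) + (v - 1) := by ring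
  rw [this]
  exact add_mem (Ideal.mul_mem_left _ _ hu) hv

variable [Algebra ℚ A]

theorem coeff_subst_eq_sum (g : PowerSeries ℚ) {h : MvPowerSeries σ A}
    (hh : h ∈ degGE σ A 1) {α : σ →₀ ℕ} {K : ℕ} (hα : α.degree < K) :
    MvPowerSeries.coeff α (g.subst h) =
      ∑ k ∈ Finset.range K, coeff k g • MvPowerSeries.coeff α (h ^ k) := by
  rw [PowerSeries.coeff_subst (HasSubst.of_constantCoeff_zero (mem_degGE_one.mp hh))]
  refine finsum_eq_sum_of_support_subset _ fun k hk => ?_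
  by_contra h1
  rw [Finset.mem_coe, Finset.mem_range] at h1
  refine hk ?_
  dsimp only
  rw [pow_mem_degGE hh k α (by omega), smul_zero]

theorem euler_subst (g : PowerSeries ℚ) {h : MvPowerSeries σ A} (hh : h ∈ degGE σ A 1) :
    euler (g.subst h) = (PowerSeries.derivative ℚ g).subst h * euler h := by
  classical
  ext α
  have h1 : MvPowerSeries.coeff α ((PowerSeries.derivative ℚ g).subst h * euler h) =
      ∑ k ∈ Finset.range (α.degree + 1), coeff k (PowerSeries.derivative ℚ g) •
        MvPowerSeries.coeff α (h ^ k * euler h) := by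
    simp_rw [MvPowerSeries.coeff_mul, Finset.smul_sum]
    rw [Finset.sum_comm]
    refine Finset.sum_congr rfl fun p hp => ?_
    have h2 : p.1.degree < α.degree + 1 := by
      rw [← Finset.HasAntidiagonal.mem_antidiagonal.mp hp, map_add]
      omega
    rw [coeff_subst_eq_sum _ hh h2, Finset.sum_mul]
    simp_rw [smul_mul_assoc]
  rw [h1, coeff_euler, coeff_subst_eq_sum g hh (show α.degree < α.degree + 2 by omega),
    Finset.sum_range_succ', mul_add, Finset.mul_sum, mul_smul_comm _ _ (MvPowerSeries.coeff α _),
    pow_zero, ← coeff_euler, euler_one, map_zero, smul_zero, add_zero]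
  refine Finset.sum_congr rfl fun k _ => ?_
  rw [mul_smul_comm, ← coeff_euler, euler_pow_succ, coeff_derivative, mul_smul]
  congr 1
  have : (k : MvPowerSeries σ A) + 1 = MvPowerSeries.C ((k : A) + 1) := by simp
  rw [this, MvPowerSeries.coeff_C_mul, Algebra.smul_def]
  simp

theorem eq_zero_of_euler_eq_mul {D H : MvPowerSeries σ A} (hD : D ∈ degGE σ A 1)
    (hH : H ∈ degGE σ A 1) (h : euler D = H * D) : D = 0 := by
  classical
  have key : ∀ K, D ∈ degGE σ A K := by
    intro K
    induction K with
    | zero => exact fun α hα => absurd hα (by omega)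
    | succ K ih =>
      intro α hα
      rcases Nat.eq_zero_or_pos α.degree with h0 | h0
      · exact hD α (by omega)
      have h1 := congrArg (MvPowerSeries.coeff α) h
      rw [coeff_euler, mul_mem_degGE hH ih α (by omega)] at h1
      have h2 : IsUnit ((α.degree : A)) := by
        have : IsUnit (algebraMap ℚ A (α.degree : ℚ)) :=
          (isUnit_iff_ne_zero.mpr (by exact_mod_cast h0.ne')).map _
        simpa using this
      exact (h2.mul_right_eq_zero).mp h1
  ext α
  exact key (α.degree + 1) α (by omega)

theorem subst_mem_degGE {g : PowerSeries ℚ} (hg : constantCoeff g = 0) {h : MvPowerSeries σ A}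
    {K : ℕ} (hK : 1 ≤ K) (hh : h ∈ degGE σ A K) : g.subst h ∈ degGE σ A K := by
  intro α hα
  rw [coeff_subst_eq_sum g (degGE_mono hK hh) (Nat.lt_succ_self _)]
  refine Finset.sum_eq_zero fun k _ => ?_
  rcases k with _ | k
  · rw [coeff_zero_eq_constantCoeff_apply, hg, zero_smul]
  · rw [pow_succ, Ideal.mul_mem_left _ _ hh α hα, smul_zero]

/-- The logarithm of a power series with constant coefficient `1`. -/
noncomputable def logL (u : MvPowerSeries σ A) : MvPowerSeries σ A :=
  (PowerSeries.log ℚ).subst (u - 1)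

theorem logL_mem_degGE {K : ℕ} (hK : 1 ≤ K) {u : MvPowerSeries σ A}
    (hu : u - 1 ∈ degGE σ A K) : logL u ∈ degGE σ A K :=
  subst_mem_degGE (by rw [← coeff_zero_eq_constantCoeff_apply, coeff_log, if_pos rfl]) hK hu

theorem euler_logL_mul {u : MvPowerSeries σ A} (hu : u - 1 ∈ degGE σ A 1) :
    euler (logL u) * u = euler u := by
  have hs := HasSubst.of_constantCoeff_zero (mem_degGE_one.mp hu)
  have h1 : PowerSeries.derivative ℚ (PowerSeries.log ℚ) * (1 + PowerSeries.X) = 1 := by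
    rw [PowerSeries.deriv_log]
    ext k
    rw [mul_add, mul_one, map_add, coeff_mk]
    rcases k with _ | k
    · simp
    · rw [coeff_succ_mul_X, coeff_mk, coeff_one, if_neg (by omega)]
      simp [pow_succ]
  have h2 := congrArg (PowerSeries.subst (u - 1)) h1
  rw [subst_mul hs, subst_add hs, subst_X hs, ← PowerSeries.coe_substAlgHom hs, map_one,
    PowerSeries.coe_substAlgHom hs, add_sub_cancel] at h2
  rw [logL, euler_subst _ hu, euler_sub, euler_one, sub_zero, mul_right_comm, h2, one_mul]

theorem logL_mul {u v : MvPowerSeries σ A} (hu : u - 1 ∈ degGE σ A 1)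
    (hv : v - 1 ∈ degGE σ A 1) : logL (u * v) = logL u + logL v := by
  have huv := mul_sub_one_mem hu hv
  rw [← sub_eq_zero]
  refine eq_zero_of_euler_eq_mul (H := 0) (sub_mem (logL_mem_degGE le_rfl huv)
    (add_mem (logL_mem_degGE le_rfl hu) (logL_mem_degGE le_rfl hv))) (zero_mem _) ?_
  refine (isUnit_of_sub_one_mem huv).mul_left_injective ?_
  dsimp only
  rw [euler_sub, euler_add, sub_mul, euler_logL_mul huv, euler_mul]
  linear_combination (-v) * euler_logL_mul hu - u * euler_logL_mul hv

theorem euler_exp {h : MvPowerSeries σ A} (hh : h ∈ degGE σ A 1) :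
    euler ((PowerSeries.exp ℚ).subst h) = euler h * (PowerSeries.exp ℚ).subst h := by
  rw [euler_subst _ hh, PowerSeries.derivative_exp, mul_comm]

theorem exp_sub_one_mem {h : MvPowerSeries σ A} {K : ℕ} (hK : 1 ≤ K) (hh : h ∈ degGE σ A K) :
    (PowerSeries.exp ℚ).subst h - 1 ∈ degGE σ A K := by
  have hs := HasSubst.of_constantCoeff_zero (mem_degGE_one.mp (degGE_mono hK hh))
  have h1 : (PowerSeries.exp ℚ).subst h - 1 = (PowerSeries.exp ℚ - 1).subst h := by
    rw [subst_sub hs, ← PowerSeries.coe_substAlgHom hs, map_one]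
  rw [h1]
  exact subst_mem_degGE (by simp) hK hh

theorem exp_add {h₁ h₂ : MvPowerSeries σ A} (hh₁ : h₁ ∈ degGE σ A 1) (hh₂ : h₂ ∈ degGE σ A 1) :
    (PowerSeries.exp ℚ).subst (h₁ + h₂) =
      (PowerSeries.exp ℚ).subst h₁ * (PowerSeries.exp ℚ).subst h₂ := by
  have hE : ∀ {h : MvPowerSeries σ A}, h ∈ degGE σ A 1 → euler h ∈ degGE σ A 1 :=
    fun hh α hα => by rw [coeff_euler, hh α hα, mul_zero]
  rw [← sub_eq_zero]
  refine eq_zero_of_euler_eq_mul (H := euler (h₁ + h₂)) ?_ (hE (add_mem hh₁ hh₂)) ?_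
  · have := sub_mem (exp_sub_one_mem le_rfl (add_mem hh₁ hh₂))
      (mul_sub_one_mem (exp_sub_one_mem le_rfl hh₁) (exp_sub_one_mem le_rfl hh₂))
    rwa [sub_sub_sub_cancel_right] at this
  · rw [euler_sub, euler_exp (add_mem hh₁ hh₂), euler_mul, euler_exp hh₁, euler_exp hh₂, euler_add]
    ring

/-- Apply a linear functional to all coefficients. -/
def mapLin (l : A →ₗ[ℚ] ℚ) : MvPowerSeries σ A →+ MvPowerSeries σ ℚ where
  toFun g := fun α => l (MvPowerSeries.coeff α g)
  map_zero' := by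
    ext α
    exact (congrArg l (map_zero _)).trans (map_zero l)
  map_add' g h := by
    ext α
    exact (congrArg l (map_add _ g h)).trans (map_add l _ _)

theorem coeff_mapLin (l : A →ₗ[ℚ] ℚ) (α : σ →₀ ℕ) (g : MvPowerSeries σ A) :
    MvPowerSeries.coeff α (mapLin l g) = l (MvPowerSeries.coeff α g) := rfl

theorem mapLin_mem_degGE (l : A →ₗ[ℚ] ℚ) {K : ℕ} {g : MvPowerSeries σ A}
    (hg : g ∈ degGE σ A K) : mapLin l g ∈ degGE σ ℚ K :=
  fun α hα => by rw [coeff_mapLin, hg α hα, map_zero]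

/-- The multiplicative functional `u ↦ exp (- l (log u))`. -/
noncomputable def expLog (l : A →ₗ[ℚ] ℚ) (u : MvPowerSeries σ A) : MvPowerSeries σ ℚ :=
  (PowerSeries.exp ℚ).subst (-mapLin l (logL u))

variable {l : A →ₗ[ℚ] ℚ}

theorem expLog_sub_one_mem {u : MvPowerSeries σ A} {K : ℕ} (hK : 1 ≤ K)
    (hu : u - 1 ∈ degGE σ A K) : expLog l u - 1 ∈ degGE σ ℚ K :=
  exp_sub_one_mem hK (neg_mem (mapLin_mem_degGE l (logL_mem_degGE hK hu)))

theorem expLog_mul {u v : MvPowerSeries σ A} (hu : u - 1 ∈ degGE σ A 1)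
    (hv : v - 1 ∈ degGE σ A 1) : expLog l (u * v) = expLog l u * expLog l v := by
  rw [expLog, logL_mul hu hv, map_add, neg_add]
  exact exp_add (neg_mem (mapLin_mem_degGE l (logL_mem_degGE le_rfl hu)))
    (neg_mem (mapLin_mem_degGE l (logL_mem_degGE le_rfl hv)))

theorem expLog_eq_one {W : Submodule ℚ A} (hW : ∀ x ∈ W, ∀ y ∈ W, x * y ∈ W)
    (hlW : ∀ x ∈ W, l x = 0) {u : MvPowerSeries σ A} (hu : u - 1 ∈ degGE σ A 1)
    (huW : ∀ α, MvPowerSeries.coeff α (u - 1) ∈ W) : expLog l u = 1 := by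
  classical
  have hp : ∀ k α, MvPowerSeries.coeff α ((u - 1) ^ (k + 1)) ∈ W := by
    intro k
    induction k with
    | zero => simpa using huW
    | succ k ih =>
      intro α
      rw [pow_succ, MvPowerSeries.coeff_mul]
      exact sum_mem fun p _ => hW _ (ih _) _ (huW _)
  have h1 : mapLin l (logL u) = 0 := by
    ext α
    rw [coeff_mapLin, map_zero, logL, coeff_subst_eq_sum _ hu (Nat.lt_succ_self _)]
    refine hlW _ (sum_mem fun k _ => ?_)
    rcases k with _ | k
    · rw [coeff_log, if_pos rfl, zero_smul]
      exact zero_mem _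
    · exact W.smul_mem _ (hp k α)
  rw [expLog, h1, neg_zero, ← sub_eq_zero]
  ext α
  exact exp_sub_one_mem (K := α.degree + 1) (by omega) (zero_mem _) α (by omega)

theorem expLog_one_sub {x : MvPowerSeries σ ℚ} (hx : x ∈ degGE σ ℚ 1) (w : A) (b : ℕ → ℚ)
    (hb : ∀ k, 1 ≤ k → l (w ^ k) = b k) :
    expLog l (1 - MvPowerSeries.map (algebraMap ℚ A) x * MvPowerSeries.C w) =
      (expo b).subst x := by
  have hxs := HasSubst.of_constantCoeff_zero (mem_degGE_one.mp hx)
  have hs : (HasSubst (logSeries b)) := hasSubst_logSeries b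
  have hu : -(MvPowerSeries.map (algebraMap ℚ A) x * MvPowerSeries.C w) ∈ degGE σ A 1 := by
    refine neg_mem (Ideal.mul_mem_right _ _ fun α hα => ?_)
    rw [MvPowerSeries.coeff_map, hx α hα, map_zero]
  rw [expo, subst_comp_subst_apply hs hxs, expLog, logL]
  congr 1
  ext α
  rw [sub_sub_cancel_left, map_neg, coeff_mapLin, coeff_subst_eq_sum _ hu (Nat.lt_succ_self _),
    coeff_subst_eq_sum _ hx (Nat.lt_succ_self _), map_sum, ← Finset.sum_neg_distrib]
  refine Finset.sum_congr rfl fun k _ => ?_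
  rcases k with _ | k
  · simp [logSeries]
  · have h1 : (-(MvPowerSeries.map (algebraMap ℚ A) x * MvPowerSeries.C w)) ^ (k + 1) =
      MvPowerSeries.C ((-1) ^ (k + 1) * w ^ (k + 1)) *
        MvPowerSeries.map (algebraMap ℚ A) (x ^ (k + 1)) := by
      rw [neg_pow, mul_pow, map_mul, map_pow, map_pow, map_pow, map_neg, map_one]
      ring
    have h2 : (-1) ^ (k + 1) * w ^ (k + 1) *
        algebraMap ℚ A (MvPowerSeries.coeff α (x ^ (k + 1))) =
        ((-1 : ℚ) ^ (k + 1) * MvPowerSeries.coeff α (x ^ (k + 1))) • w ^ (k + 1) := by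
      rw [Algebra.smul_def, map_mul, map_pow (algebraMap ℚ A), map_neg, map_one]
      ring
    rw [h1, MvPowerSeries.coeff_C_mul, MvPowerSeries.coeff_map, h2, map_smul, map_smul,
      hb _ (by omega), coeff_log, if_neg (by omega), logSeries, coeff_mk]
    have h3 : ((-1 : ℚ) ^ (k + 1)) * (-1) ^ (k + 1) = 1 := by
      rw [← mul_pow]
      norm_num
    simp only [smul_eq_mul, Algebra.algebraMap_self, RingHom.id_apply, pow_succ _ (k + 1)]
    linear_combination (b (k + 1) / ((k + 1 : ℕ) : ℚ) * MvPowerSeries.coeff α (x ^ (k + 1))) * h3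

end

section
variable {σ A : Type} [CommRing A] [Algebra ℚ A] {l : A →ₗ[ℚ] ℚ}

theorem mapLin_subst [Finite σ] {μ : σ → MvPowerSeries σ ℚ} (hμ : ∀ i, μ i ∈ degGE σ ℚ 1)
    (g : MvPowerSeries σ A) :
    MvPowerSeries.subst μ (mapLin l g) =
      mapLin l (MvPowerSeries.subst (fun i => MvPowerSeries.map (algebraMap ℚ A) (μ i)) g) := by
  have h1 : MvPowerSeries.HasSubst μ :=
    MvPowerSeries.hasSubst_of_constantCoeff_zero fun i => mem_degGE_one.mp (hμ i)
  have h2 : MvPowerSeries.HasSubst fun i => MvPowerSeries.map (algebraMap ℚ A) (μ i) := by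
    refine MvPowerSeries.hasSubst_of_constantCoeff_zero fun i => ?_
    rw [← mem_degGE_one]
    intro α hα
    rw [MvPowerSeries.coeff_map, hμ i α hα, map_zero]
  ext α
  rw [coeff_mapLin, MvPowerSeries.coeff_subst h1, MvPowerSeries.coeff_subst h2]
  refine Eq.trans ?_ ((l : A →+ ℚ).map_finsum (MvPowerSeries.coeff_subst_finite h2 g α)).symm
  refine finsum_congr fun d => ?_
  have h3 : (d.prod fun s e => MvPowerSeries.map (algebraMap ℚ A) (μ s) ^ e) =
      MvPowerSeries.map (algebraMap ℚ A) (d.prod fun s e => μ s ^ e) := by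
    rw [Finsupp.prod, Finsupp.prod, map_prod]
    simp_rw [map_pow]
  rw [h3, MvPowerSeries.coeff_map, smul_eq_mul, smul_eq_mul, mul_comm (MvPowerSeries.coeff d g),
    ← Algebra.smul_def, coeff_mapLin, mul_comm]
  exact (l.map_smul _ _).symm

theorem expLog_subst [Finite σ] {μ : σ → MvPowerSeries σ ℚ} (hμ : ∀ i, μ i ∈ degGE σ ℚ 1)
    {u : MvPowerSeries σ A} (hu : u - 1 ∈ degGE σ A 1) :
    MvPowerSeries.subst μ (expLog l u) = expLog l
      (MvPowerSeries.subst (fun i => MvPowerSeries.map (algebraMap ℚ A) (μ i)) u) := by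
  have h1 : MvPowerSeries.HasSubst μ :=
    MvPowerSeries.hasSubst_of_constantCoeff_zero fun i => mem_degGE_one.mp (hμ i)
  have h2 : MvPowerSeries.HasSubst fun i => MvPowerSeries.map (algebraMap ℚ A) (μ i) := by
    refine MvPowerSeries.hasSubst_of_constantCoeff_zero fun i => ?_
    rw [← mem_degGE_one]
    intro α hα
    rw [MvPowerSeries.coeff_map, hμ i α hα, map_zero]
  have h3 : HasSubst (u - 1) := HasSubst.of_constantCoeff_zero (mem_degGE_one.mp hu)
  have h4 : HasSubst (-mapLin l (logL u)) := HasSubst.of_constantCoeff_zero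
    (mem_degGE_one.mp (neg_mem (mapLin_mem_degGE l (logL_mem_degGE le_rfl hu))))
  rw [expLog, expLog, PowerSeries.subst, PowerSeries.subst,
    MvPowerSeries.subst_comp_subst_apply h4.const h1]
  congr 1
  funext _
  rw [← MvPowerSeries.coe_substAlgHom h1, map_neg, MvPowerSeries.coe_substAlgHom h1,
    mapLin_subst hμ, logL, logL, PowerSeries.subst, PowerSeries.subst,
    MvPowerSeries.subst_comp_subst_apply h3.const h2]
  congr 3
  funext _
  rw [← MvPowerSeries.coe_substAlgHom h2, map_sub, map_one]

theorem expLog_neg_mul {u : MvPowerSeries σ A} (hu : u - 1 ∈ degGE σ A 1) :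
    expLog (-l) u * expLog l u = 1 := by
  have h1 := neg_mem (mapLin_mem_degGE l (logL_mem_degGE le_rfl hu))
  have h2 := neg_mem (mapLin_mem_degGE (-l) (logL_mem_degGE le_rfl hu))
  rw [expLog, expLog, ← exp_add h2 h1]
  have h3 : -mapLin (-l) (logL u) + -mapLin l (logL u) = 0 := by
    ext α
    simp [coeff_mapLin]
  rw [h3, ← sub_eq_zero]
  ext α
  exact exp_sub_one_mem (K := α.degree + 1) (by omega) (zero_mem _) α (by omega)

theorem expLog_pow {u : MvPowerSeries σ A} (hu : u - 1 ∈ degGE σ A 1) (k : ℕ) :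
    u ^ k - 1 ∈ degGE σ A 1 ∧ expLog l (u ^ k) = expLog l u ^ k := by
  induction k with
  | zero =>
    refine ⟨by simp, ?_⟩
    rw [pow_zero, pow_zero]
    exact expLog_eq_one (W := ⊥) (by simp) (by simp) (by simp) (by simp)
  | succ k ih =>
    rw [pow_succ, pow_succ]
    exact ⟨mul_sub_one_mem ih.1 hu, by rw [expLog_mul ih.1 hu, ih.2]⟩

theorem mvNorm_subst_le {ν : A → ℝ≥0∞} (hν : IsExtNorm ν)
    (hs : ∀ (q : ℚ) x, ν (q • x) ≤ ‖q‖ₑ * ν x) (r : ℝ≥0∞) (g : PowerSeries ℚ)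
    {h : MvPowerSeries σ A} (hh : h ∈ degGE σ A 1) :
    mvNorm ν r (g.subst h) ≤ ∑' k, ‖coeff k g‖ₑ * mvNorm ν r h ^ k := by
  calc mvNorm ν r (g.subst h)
      ≤ ∑' α : σ →₀ ℕ, ∑' k, ‖coeff k g‖ₑ * (ν (MvPowerSeries.coeff α (h ^ k)) *
          r ^ α.degree) := by
        refine ENNReal.tsum_le_tsum fun α => ?_
        rw [coeff_subst_eq_sum g hh (Nat.lt_succ_self _)]
        refine (mul_le_mul_left (hν.sum_le _ _) _).trans ?_
        rw [Finset.sum_mul]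
        refine (Finset.sum_le_sum fun k _ => ?_).trans (ENNReal.sum_le_tsum _)
        rw [← mul_assoc]
        exact mul_le_mul_left (hs _ _) _
    _ = ∑' k, ‖coeff k g‖ₑ * mvNorm ν r (h ^ k) := by
        rw [ENNReal.tsum_comm]
        simp_rw [ENNReal.tsum_mul_left]
        rfl
    _ ≤ _ := ENNReal.tsum_le_tsum fun k =>
        mul_le_mul_right ((isExtNorm_mvNorm hν r).pow_le h k) _

theorem tsum_exp_lt_top {M : ℝ≥0∞} (hM : M < ∞) :
    ∑' k, ‖coeff k (PowerSeries.exp ℚ)‖ₑ * M ^ k < ∞ := by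
  lift M to NNReal using hM.ne
  have h1 : Summable fun k : ℕ => M ^ k / (k.factorial : NNReal) := by
    rw [← NNReal.summable_coe]
    simpa using Real.summable_pow_div_factorial (M : ℝ)
  have h2 : ∀ k, ‖coeff k (PowerSeries.exp ℚ)‖ₑ * (M : ℝ≥0∞) ^ k =
      ((M ^ k / (k.factorial : NNReal) : NNReal) : ℝ≥0∞) := by
    intro k
    rw [coeff_exp, enorm_eq_nnnorm, ← ENNReal.coe_pow, ← ENNReal.coe_mul]
    congr 1
    have h3 : ‖(1 : ℚ) / k.factorial‖₊ = 1 / (k.factorial : NNReal) := by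
      rw [nnnorm_div, nnnorm_one]
      congr 1
      ext
      rw [coe_nnnorm, ← Rat.norm_cast_real]
      simp
    rw [Algebra.algebraMap_self, RingHom.id_apply, h3, mul_comm, mul_one_div]
  simp_rw [h2]
  exact (ENNReal.tsum_coe_ne_top_iff_summable.mpr h1).lt_top

theorem mvNorm_expLog_lt_top {ν : A → ℝ≥0∞} (hν : IsExtNorm ν)
    (hs : ∀ (q : ℚ) x, ν (q • x) ≤ ‖q‖ₑ * ν x) {C : ℝ≥0∞} (hC : C ≠ ∞)
    (hl : ∀ x, ‖l x‖ₑ ≤ C * ν x) {r : ℝ≥0∞} {u : MvPowerSeries σ A}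
    (hu : u - 1 ∈ degGE σ A 1) (hur : mvNorm ν r (u - 1) ≤ 2⁻¹) :
    mvNorm (fun q : ℚ => ‖q‖ₑ) r (expLog l u) < ∞ := by
  have h1 : mvNorm ν r (logL u) ≤ 2 := by
    refine (mvNorm_subst_le hν hs r _ hu).trans ?_
    rw [← ENNReal.tsum_geometric_two]
    refine ENNReal.tsum_le_tsum fun k => ?_
    rw [← one_mul (2⁻¹ ^ k)]
    refine mul_le_mul' ?_ (pow_le_pow_left' hur k)
    rw [coeff_log]
    split_ifs with hk
    · simp
    · have h2 : (1 : ℝ) ≤ k := by exact_mod_cast Nat.one_le_iff_ne_zero.mpr hk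
      have h3 : ‖(-1 : ℚ) ^ (k + 1) / k‖ ≤ 1 := by
        rw [norm_div, norm_pow, norm_neg, norm_one, one_pow, one_div, ← Rat.norm_cast_real]
        simpa using inv_le_one_of_one_le₀ h2
      rw [enorm_eq_nnnorm]
      exact_mod_cast h3
  have h2 : mvNorm (fun q : ℚ => ‖q‖ₑ) r (-mapLin l (logL u)) ≤ C * 2 := by
    refine ((isExtNorm_mvNorm isExtNorm_enorm r).neg _).trans (le_trans ?_
      (mul_le_mul_right h1 C))
    rw [mvNorm, mvNorm, ← ENNReal.tsum_mul_left]
    refine ENNReal.tsum_le_tsum fun α => ?_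
    rw [coeff_mapLin, ← mul_assoc]
    exact mul_le_mul_left (hl _) _
  refine (mvNorm_subst_le isExtNorm_enorm (fun q x => (enorm_mul q x).le) r _
    (neg_mem (mapLin_mem_degGE l (logL_mem_degGE le_rfl hu)))).trans_lt ?_
  exact tsum_exp_lt_top (h2.trans_lt (ENNReal.mul_lt_top hC.lt_top (by simp)))

end

/-- The residue of the product with `f`. -/
noncomputable def resMul (f : PowerSeries ℚ) : LaurentSeries ℚ →ₗ[ℚ] ℚ where
  toFun g := (HahnSeries.ofPowerSeries ℤ ℚ f * g).coeff (-1)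
  map_add' g h := by rw [mul_add, HahnSeries.coeff_add]
  map_smul' c g := by
    rw [RingHom.id_apply, ← HahnSeries.coeff_smul, ← HahnSeries.single_zero_mul_eq_smul,
      ← HahnSeries.single_zero_mul_eq_smul, mul_left_comm]

theorem resMul_apply (f : PowerSeries ℚ) (g : LaurentSeries ℚ) :
    resMul f g = (HahnSeries.ofPowerSeries ℤ ℚ f * g).coeff (-1) := rfl

theorem resMul_of_mem_ordGE (f : PowerSeries ℚ) {g : LaurentSeries ℚ} (hg : g ∈ ordGE 0) :
    resMul f g = 0 := by
  have := mul_mem_ordGE (ofPowerSeries_mem_ordGE f) hg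
  exact this _ (by norm_num)

theorem resMul_single (f : PowerSeries ℚ) {m : ℕ} (hm : 1 ≤ m) :
    resMul f (HahnSeries.single (-(m : ℤ)) 1) = coeff (m - 1) f := by
  have h : (-1 : ℤ) = ((m - 1 : ℕ) : ℤ) + -(m : ℤ) := by omega
  rw [resMul_apply, h, HahnSeries.coeff_mul_single_add, mul_one,
    LaurentSeries.coeff_coe_powerSeries]

theorem lNorm_smul_le {ρ : ℝ≥0∞} (h0 : ρ ≠ 0) (hρ : ρ ≠ ∞) (q : ℚ) (x : LaurentSeries ℚ) :
    lNorm ρ (q • x) ≤ ‖q‖ₑ * lNorm ρ x := by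
  rw [← HahnSeries.single_zero_mul_eq_smul]
  refine ((isExtNorm_lNorm h0 hρ).mul _ _).trans ?_
  rw [lNorm_single, zpow_zero, mul_one]

theorem enorm_coeff_le {ρ : ℝ≥0∞} (h0 : ρ ≠ 0) (hρ : ρ ≠ ∞) (g : LaurentSeries ℚ) (k : ℤ) :
    ‖g.coeff k‖ₑ ≤ ρ ^ (-k) * lNorm ρ g := by
  have h1 : ρ ^ (-k) * ρ ^ k = 1 := by
    rw [← ENNReal.zpow_add h0 hρ]
    simp
  calc ‖g.coeff k‖ₑ = ρ ^ (-k) * (‖g.coeff k‖ₑ * ρ ^ k) := by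
        rw [mul_left_comm, h1, mul_one]
    _ ≤ _ := mul_le_mul_right (enorm_coeff_mul_le_lNorm ρ g k) _

theorem enorm_resMul_le {ρ : ℝ≥0∞} (h0 : ρ ≠ 0) (hρ : ρ ≠ ∞) (f : PowerSeries ℚ)
    (g : LaurentSeries ℚ) : ‖resMul f g‖ₑ ≤ (ρ * psNorm ρ f) * lNorm ρ g := by
  refine (enorm_coeff_le h0 hρ (HahnSeries.ofPowerSeries ℤ ℚ f * g) (-1)).trans ?_
  rw [neg_neg, zpow_one, mul_assoc, ← lNorm_ofPowerSeries]
  exact mul_le_mul_right ((isExtNorm_lNorm h0 hρ).mul _ _) _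

section Integrality
variable {σ : Type}

/-- Power series with all coefficients in a non-unital subring. -/
def coeffsIn {A : Type} [CommRing A] (W : NonUnitalSubring A) :
    NonUnitalSubring (MvPowerSeries σ A) where
  carrier := {g | ∀ α, MvPowerSeries.coeff α g ∈ W}
  zero_mem' α := by
    rw [map_zero]
    exact zero_mem W
  add_mem' hx hy α := by
    rw [map_add]
    exact add_mem (hx α) (hy α)
  neg_mem' hx α := by
    rw [map_neg]
    exact neg_mem (hx α)
  mul_mem' hx hy α := by
    classical
    rw [MvPowerSeries.coeff_mul]
    exact sum_mem fun p _ => mul_mem (hx _) (hy _)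

/-- `t⁻¹ ℤ[t⁻¹]`. -/
def negInt : NonUnitalSubring (LaurentSeries ℚ) where
  carrier := {g | g ∈ degLE (-1) ∧ ∀ k, g.coeff k ∈ intQ}
  zero_mem' := ⟨zero_mem _, fun k => by simp⟩
  add_mem' := fun hx hy => ⟨add_mem hx.1 hy.1, fun k => by
    rw [HahnSeries.coeff_add]
    exact add_mem (hx.2 k) (hy.2 k)⟩
  neg_mem' := fun hx => ⟨neg_mem hx.1, fun k => by
    rw [HahnSeries.coeff_neg]
    exact neg_mem (hx.2 k)⟩
  mul_mem' := fun hx hy => ⟨degLE_mono (by norm_num) (mul_mem_degLE hx.1 hy.1), fun k => by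
    rw [HahnSeries.coeff_mul]
    exact sum_mem fun p _ => mul_mem (hx.2 _) (hy.2 _)⟩

theorem single_mem_negInt {w : ℕ} (hw : 1 ≤ w) {z : ℚ} (hz : z ∈ intQ) :
    HahnSeries.single (-(w : ℤ)) z ∈ negInt := by
  refine ⟨single_mem_degLE (by omega) z, fun k => ?_⟩
  rw [HahnSeries.coeff_single]
  split_ifs
  · exact hz
  · exact zero_mem _

theorem monomial_mem_coeffsIn {A : Type} [CommRing A] {W : NonUnitalSubring A} {x : A}
    (hx : x ∈ W) (β : σ →₀ ℕ) : MvPowerSeries.monomial β x ∈ coeffsIn (σ := σ) W := by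
  classical
  intro α
  rw [MvPowerSeries.coeff_monomial]
  split_ifs
  · exact hx
  · exact zero_mem _

theorem monomial_mem_degGE {A : Type} [CommRing A] (x : A) (β : σ →₀ ℕ) :
    MvPowerSeries.monomial β x ∈ degGE σ A β.degree := by
  classical
  intro α hα
  rw [MvPowerSeries.coeff_monomial, if_neg]
  rintro rfl
  exact lt_irrefl _ hα

/-- Power series which are integral in degrees below `M` after multiplication with `denomBound`. -/
def denomRing (σ : Type) (B M : ℕ) : Subring (MvPowerSeries σ ℚ) where
  carrier := {g | ∀ α : σ →₀ ℕ, α.degree < M →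
    (denomBound B α.degree : ℚ) * MvPowerSeries.coeff α g ∈ intQ}
  zero_mem' α _ := by simp
  one_mem' α _ := by
    classical
    rw [MvPowerSeries.coeff_one]
    split_ifs with h
    · simp [h, denomBound_zero]
    · simp
  add_mem' hx hy α h := by
    rw [map_add, mul_add]
    exact add_mem (hx α h) (hy α h)
  neg_mem' hx α h := by
    rw [map_neg, mul_neg]
    exact neg_mem (hx α h)
  mul_mem' hx hy α h := by
    classical
    rw [MvPowerSeries.coeff_mul, Finset.mul_sum]
    refine sum_mem fun p hp => ?_
    have h1 := Finset.HasAntidiagonal.mem_antidiagonal.mp hp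
    have h2 : p.1.degree + p.2.degree = α.degree := by rw [← h1, map_add]
    obtain ⟨d, hd⟩ := denomBound_mul_dvd B p.1.degree p.2.degree
    rw [h2] at hd
    have h3 := mul_mem (natCast_mem_intQ d)
      (mul_mem (hx p.1 (by omega)) (hy p.2 (by omega)))
    rw [hd]
    convert h3 using 1
    push_cast
    ring

theorem subst_monomial_mem_denomRing {B : ℕ} {b : ℕ → ℤ}
    (hb : ∀ p : ℕ, p.Prime → B ≤ p → DworkAt p b) (M : ℕ) {β : σ →₀ ℕ} (hβ : 1 ≤ β.degree)
    {z : ℚ} (hz : z ∈ intQ) :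
    (expo fun k => (b k : ℚ)).subst (MvPowerSeries.monomial β z) ∈ denomRing σ B M := by
  classical
  intro α _
  rw [coeff_subst_eq_sum _ (degGE_mono hβ (monomial_mem_degGE z β)) (Nat.lt_succ_self _),
    Finset.mul_sum]
  refine sum_mem fun k _ => ?_
  rw [MvPowerSeries.monomial_pow, MvPowerSeries.coeff_monomial]
  split_ifs with h
  · have h1 : k ≤ α.degree := by
      rw [h, map_nsmul, smul_eq_mul]
      exact Nat.le_mul_of_pos_right k hβ
    obtain ⟨d, hd⟩ := denomBound_dvd B h1
    have h3 := mul_mem (natCast_mem_intQ d)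
      (mul_mem (denomBound_mul_coeff_expo_mem_intQ hb k) (pow_mem hz k))
    rw [hd]
    convert h3 using 1
    rw [smul_eq_mul]
    push_cast
    ring
  · simp

variable {a : ℕ → ℤ} {f : PowerSeries ℚ} {B : ℕ}

theorem expLog_neg_factor_mem_denomRing (hf : f = PowerSeries.mk fun k => (a (k + 1) : ℚ))
    (hB : ∀ p : ℕ, p.Prime → B ≤ p → DworkAt p a) (M : ℕ) {β : σ →₀ ℕ} (hβ : 1 ≤ β.degree)
    {z : ℚ} (hz : z ∈ intQ) {w : ℕ} (hw : 1 ≤ w) :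
    expLog (-resMul f) (1 - MvPowerSeries.map (algebraMap ℚ (LaurentSeries ℚ))
      (MvPowerSeries.monomial β z) * MvPowerSeries.C (HahnSeries.single (-(w : ℤ)) 1)) ∈
      denomRing σ B M := by
  rw [expLog_one_sub (degGE_mono hβ (monomial_mem_degGE z β)) _
    (fun k => ((-a (w * k) : ℤ) : ℚ))]
  · refine subst_monomial_mem_denomRing (fun p hp hBp n hn => ?_) M hβ hz
    show (p : ℤ) ∣ -a (w * (n * p)) - -a (w * n)
    rw [← mul_assoc, neg_sub_neg, ← dvd_neg, neg_sub]
    exact hB p hp hBp (w * n) (Nat.mul_pos hw hn)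
  · intro k hk
    have h1 : (HahnSeries.single (-(w : ℤ)) (1 : ℚ)) ^ k =
        HahnSeries.single (-((w * k : ℕ) : ℤ)) 1 := by
      have h0 : k • (-(w : ℤ)) = -((w * k : ℕ) : ℤ) := by
        rw [nsmul_eq_mul]
        push_cast
        ring
      rw [HahnSeries.single_pow, one_pow, h0]
    have h2 : 1 ≤ w * k := Nat.mul_pos hw hk
    rw [h1, LinearMap.neg_apply, resMul_single f h2, hf, coeff_mk, Nat.sub_add_cancel h2]
    push_cast
    rfl

theorem one_add_mul_sub_one {R : Type*} [CommRing R] (u v : R) :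
    u * v - 1 = (u - 1) * (v - 1) + (u - 1) + (v - 1) := by ring

theorem exists_factor (hf : f = PowerSeries.mk fun k => (a (k + 1) : ℚ))
    (hB : ∀ p : ℕ, p.Prime → B ≤ p → DworkAt p a) (M : ℕ) {K : ℕ} (hK : 1 ≤ K) [Finite σ]
    {h : MvPowerSeries σ (LaurentSeries ℚ)} (hh : h ∈ coeffsIn negInt)
    (hhK : h ∈ degGE σ _ K) :
    ∃ v : MvPowerSeries σ (LaurentSeries ℚ), v - 1 ∈ coeffsIn negInt ∧ v - 1 ∈ degGE σ _ K ∧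
      expLog (-resMul f) v ∈ denomRing σ B M ∧ v - 1 + h ∈ degGE σ _ (K + 1) := by
  classical
  set P : MvPowerSeries σ (LaurentSeries ℚ) → Prop := fun h =>
    ∃ v : MvPowerSeries σ (LaurentSeries ℚ), v - 1 ∈ coeffsIn negInt ∧ v - 1 ∈ degGE σ _ K ∧
      expLog (-resMul f) v ∈ denomRing σ B M ∧ v - 1 + h ∈ degGE σ _ (K + 1) with hP
  have hzero : P 0 := by
    refine ⟨1, by simp [zero_mem], by simp, ?_, by simp⟩
    rw [expLog_eq_one (W := ⊥) (by simp) (by simp) (by simp) (by simp)]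
    exact one_mem _
  have hadd : ∀ g₁ g₂, P g₁ → P g₂ → P (g₁ + g₂) := by
    rintro g₁ g₂ ⟨v₁, h11, h12, h13, h14⟩ ⟨v₂, h21, h22, h23, h24⟩
    have h3 := mul_mem_degGE h12 h22
    refine ⟨v₁ * v₂, ?_, mul_sub_one_mem h12 h22, ?_, ?_⟩
    · rw [one_add_mul_sub_one]
      exact add_mem (add_mem (mul_mem h11 h21) h11) h21
    · rw [expLog_mul (degGE_mono hK h12) (degGE_mono hK h22)]
      exact mul_mem h13 h23
    · rw [one_add_mul_sub_one]
      convert add_mem (add_mem (degGE_mono (show K + 1 ≤ K + K by omega) h3) h14) h24 using 1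
      ring
  have hmono : ∀ (β : σ →₀ ℕ) (w : ℕ) (z : ℚ), β.degree = K → 1 ≤ w → z ∈ intQ →
      P (MvPowerSeries.monomial β (HahnSeries.single (-(w : ℤ)) z)) := by
    intro β w z hβ hw hz
    have h1 : MvPowerSeries.map (algebraMap ℚ (LaurentSeries ℚ))
        (MvPowerSeries.monomial β z) * MvPowerSeries.C (HahnSeries.single (-(w : ℤ)) 1) =
        MvPowerSeries.monomial β (HahnSeries.single (-(w : ℤ)) z) := by
      ext1 α
      rw [MvPowerSeries.coeff_mul_C, MvPowerSeries.coeff_map, MvPowerSeries.coeff_monomial,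
        MvPowerSeries.coeff_monomial]
      split_ifs
      · rw [← Algebra.smul_def, ← HahnSeries.single_zero_mul_eq_smul, HahnSeries.single_mul_single,
          zero_add, mul_one]
      · rw [map_zero, zero_mul]
    have h2 := expLog_neg_factor_mem_denomRing (σ := σ) hf hB M (hβ.symm ▸ hK) hz hw
    rw [h1] at h2
    refine ⟨_, ?_, ?_, h2, ?_⟩
    · rw [sub_sub_cancel_left]
      exact neg_mem (monomial_mem_coeffsIn (single_mem_negInt hw hz) β)
    · rw [sub_sub_cancel_left, ← hβ]
      exact neg_mem (monomial_mem_degGE _ β)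
    · rw [sub_sub_cancel_left, neg_add_cancel]
      exact zero_mem _
  have hmono2 : ∀ (β : σ →₀ ℕ) (x : LaurentSeries ℚ), β.degree = K → x ∈ negInt →
      P (MvPowerSeries.monomial β x) := by
    intro β x hβ hx
    have hfin := finite_support_of_mem_degLE hx.1
    have h1 : x = ∑ k ∈ hfin.toFinset, HahnSeries.single k (x.coeff k) := by
      ext k
      rw [HahnSeries.coeff_sum, Finset.sum_eq_single k]
      · rw [HahnSeries.coeff_single_same]
      · intro j _ hj
        exact HahnSeries.coeff_single_of_ne hj.symm
      · intro h
        rw [HahnSeries.coeff_single_same]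
        simpa using h
    rw [h1, map_sum]
    refine Finset.sum_induction _ P hadd hzero fun k hk => ?_
    have hk1 : k ≤ -1 := by
      by_contra h
      exact (hfin.mem_toFinset.mp hk) (hx.1 k (by omega))
    obtain ⟨w, rfl⟩ : ∃ w : ℕ, k = -(w : ℤ) := ⟨(-k).toNat, by omega⟩
    exact hmono β w _ hβ (by omega) (hx.2 _)
  have hfin : {β : σ →₀ ℕ | β.degree = K}.Finite :=
    Finsupp.finite_of_degree_eq K
  obtain ⟨v, h1, h2, h3, h4⟩ : P (∑ β ∈ hfin.toFinset,
      MvPowerSeries.monomial β (MvPowerSeries.coeff β h)) :=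
    Finset.sum_induction _ P hadd hzero fun β hβ => hmono2 β _ (hfin.mem_toFinset.mp hβ) (hh β)
  refine ⟨v, h1, h2, h3, ?_⟩
  have h5 : h - ∑ β ∈ hfin.toFinset, MvPowerSeries.monomial β (MvPowerSeries.coeff β h) ∈
      degGE σ (LaurentSeries ℚ) (K + 1) := by
    intro α hα
    rw [map_sub, map_sum]
    simp_rw [MvPowerSeries.coeff_monomial]
    rw [Finset.sum_ite_eq]
    split_ifs with h6
    · rw [sub_self]
    · rw [sub_zero]
      refine hhK α ?_
      have : α.degree ≠ K := by simpa using h6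
      omega
  convert add_mem h4 h5 using 1
  ring

/-- The integrality of the values of the functional. -/
theorem expLog_mem_denomRing (hf : f = PowerSeries.mk fun k => (a (k + 1) : ℚ))
    (hB : ∀ p : ℕ, p.Prime → B ≤ p → DworkAt p a) [Finite σ]
    {u : MvPowerSeries σ (LaurentSeries ℚ)} (hu : u - 1 ∈ coeffsIn negInt)
    (hu1 : u - 1 ∈ degGE σ _ 1) (M : ℕ) : expLog (resMul f) u ∈ denomRing σ B M := by
  have key : ∀ d K : ℕ, 1 ≤ K → M ≤ K + d → ∀ u : MvPowerSeries σ (LaurentSeries ℚ),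
      u - 1 ∈ coeffsIn negInt → u - 1 ∈ degGE σ _ K →
      expLog (resMul f) u ∈ denomRing σ B M := by
    intro d
    induction d with
    | zero =>
      intro K hK hM u _ huK
      have h1 : expLog (resMul f) u - 1 ∈ denomRing σ B M := by
        intro α hα
        rw [expLog_sub_one_mem hK huK α (by omega), mul_zero]
        exact zero_mem _
      have := add_mem h1 (one_mem _)
      rwa [sub_add_cancel] at this
    | succ d ih =>
      intro K hK hM u hu huK
      obtain ⟨v, h1, h2, h3, h4⟩ := exists_factor hf hB M hK hu huK
      have huv : u * v - 1 ∈ degGE σ _ (K + 1) := by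
        rw [one_add_mul_sub_one]
        convert add_mem (degGE_mono (show K + 1 ≤ K + K by omega) (mul_mem_degGE huK h2)) h4
          using 1
        ring
      have h5 := ih (K + 1) (by omega) (by omega) (u * v) (by
        rw [one_add_mul_sub_one]
        exact add_mem (add_mem (mul_mem hu h1) hu) h1) huv
      rw [expLog_mul (degGE_mono hK huK) (degGE_mono hK h2)] at h5
      have h6 := mul_mem h5 h3
      rwa [mul_assoc, mul_comm (expLog (resMul f) v), expLog_neg_mul (degGE_mono hK h2),
        mul_one] at h6
  exact key M 1 le_rfl (by omega) u hu hu1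

end Integrality

theorem mapLin_map_mul {σ A : Type} [CommRing A] [Algebra ℚ A] (l : A →ₗ[ℚ] ℚ)
    (x : MvPowerSeries σ ℚ) (g : MvPowerSeries σ A) :
    mapLin l (MvPowerSeries.map (algebraMap ℚ A) x * g) = x * mapLin l g := by
  classical
  ext α
  rw [coeff_mapLin, MvPowerSeries.coeff_mul, MvPowerSeries.coeff_mul, map_sum]
  refine Finset.sum_congr rfl fun p _ => ?_
  rw [MvPowerSeries.coeff_map, ← Algebra.smul_def, map_smul, smul_eq_mul, coeff_mapLin]

theorem det_one_add_sub_one_mem {ι R : Type*} [Fintype ι] [DecidableEq ι] [CommRing R]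
    {I : Ideal R} {M : Matrix ι ι R} (hM : ∀ i j, M i j ∈ I) : (1 + M).det - 1 ∈ I := by
  rw [← Ideal.Quotient.eq, RingHom.map_det, map_one]
  have h : (Ideal.Quotient.mk I).mapMatrix (1 + M) = 1 := by
    rw [map_add, map_one]
    have : (Ideal.Quotient.mk I).mapMatrix M = 0 := by
      ext i j
      exact Ideal.Quotient.eq_zero_iff_mem.mpr (hM i j)
    rw [this, add_zero]
  rw [h, Matrix.det_one]

theorem det_mem {ι R : Type*} [Fintype ι] [DecidableEq ι] [CommRing R]
    {S : Subring R} {M : Matrix ι ι R} (hM : ∀ i j, M i j ∈ S) : M.det ∈ S := by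
  rw [Matrix.det_apply]
  exact sum_mem fun σ _ => zsmul_mem (prod_mem fun i _ => hM _ _) _

theorem adjugate_mem {ι R : Type*} [Fintype ι] [DecidableEq ι] [CommRing R]
    {S : Subring R} {M : Matrix ι ι R} (hM : ∀ i j, M i j ∈ S) (i j : ι) :
    M.adjugate i j ∈ S := by
  rw [Matrix.adjugate_apply]
  refine det_mem fun a b => ?_
  rw [Matrix.updateRow_apply]
  split_ifs
  · rw [Pi.single_apply]
    split_ifs
    · exact one_mem _
    · exact zero_mem _
  · exact hM _ _

/-- The coefficient of `t ^ k` as a linear functional. -/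
noncomputable def coeffLin (k : ℤ) : LaurentSeries ℚ →ₗ[ℚ] ℚ where
  toFun g := g.coeff k
  map_add' _ _ := rfl
  map_smul' _ _ := rfl

theorem coeffLin_apply (k : ℤ) (g : LaurentSeries ℚ) : coeffLin k g = g.coeff k := rfl

/-- Power series with coefficients in a space of Laurent series. -/
def seriesIn {σ : Type} (W : Submodule ℚ (LaurentSeries ℚ)) :
    AddSubgroup (MvPowerSeries σ (LaurentSeries ℚ)) where
  carrier := {g | ∀ α, MvPowerSeries.coeff α g ∈ W}
  zero_mem' α := by
    rw [map_zero]
    exact zero_mem W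
  add_mem' hx hy α := by
    rw [map_add]
    exact add_mem (hx α) (hy α)
  neg_mem' hx α := by
    rw [map_neg]
    exact neg_mem (hx α)

section
variable {σ : Type}

theorem mul_mem_seriesIn {W₁ W₂ W₃ : Submodule ℚ (LaurentSeries ℚ)}
    (h : ∀ x ∈ W₁, ∀ y ∈ W₂, x * y ∈ W₃) {g₁ g₂ : MvPowerSeries σ (LaurentSeries ℚ)}
    (h₁ : g₁ ∈ seriesIn W₁) (h₂ : g₂ ∈ seriesIn W₂) : g₁ * g₂ ∈ seriesIn W₃ := by
  classical
  intro α
  rw [MvPowerSeries.coeff_mul]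
  exact sum_mem fun p _ => h _ (h₁ _) _ (h₂ _)

theorem C_mem_seriesIn {W : Submodule ℚ (LaurentSeries ℚ)} {x : LaurentSeries ℚ} (hx : x ∈ W) :
    MvPowerSeries.C x ∈ seriesIn (σ := σ) W := by
  classical
  intro α
  rw [MvPowerSeries.coeff_C]
  split_ifs
  · exact hx
  · exact zero_mem _

theorem map_mul_mem_seriesIn {W : Submodule ℚ (LaurentSeries ℚ)}
    (x : MvPowerSeries σ ℚ) {g : MvPowerSeries σ (LaurentSeries ℚ)} (hg : g ∈ seriesIn W) :
    MvPowerSeries.map (algebraMap ℚ (LaurentSeries ℚ)) x * g ∈ seriesIn W := by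
  classical
  intro α
  rw [MvPowerSeries.coeff_mul]
  refine sum_mem fun p _ => ?_
  rw [MvPowerSeries.coeff_map, ← Algebra.smul_def]
  exact W.smul_mem _ (hg _)

theorem one_mem_seriesIn {W : Submodule ℚ (LaurentSeries ℚ)} (h : 1 ∈ W) :
    (1 : MvPowerSeries σ (LaurentSeries ℚ)) ∈ seriesIn W := by
  rw [← map_one MvPowerSeries.C]
  exact C_mem_seriesIn h

theorem one_mem_ordGE : (1 : LaurentSeries ℚ) ∈ ordGE 0 := one_mem integers

theorem one_mem_degLE : (1 : LaurentSeries ℚ) ∈ degLE 0 := one_mem polys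

theorem ordGE_zero_mul : ∀ x ∈ ordGE 0, ∀ y ∈ ordGE 0, x * y ∈ ordGE 0 :=
  fun _ hx _ hy => mul_mem_ordGE hx hy

/-- Power series with coefficients in `ℚ⟦t⟧`. -/
def seriesIntegers (σ : Type) : Subring (MvPowerSeries σ (LaurentSeries ℚ)) :=
  { seriesIn (ordGE 0) with
    one_mem' := one_mem_seriesIn one_mem_ordGE
    mul_mem' := fun hx hy => mul_mem_seriesIn ordGE_zero_mul hx hy }

/-- Power series with coefficients in `ℚ[t⁻¹]`. -/
def seriesPolys (σ : Type) : Subring (MvPowerSeries σ (LaurentSeries ℚ)) :=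
  { seriesIn (degLE 0) with
    one_mem' := one_mem_seriesIn one_mem_degLE
    mul_mem' := fun hx hy =>
      mul_mem_seriesIn (fun _ hx _ hy => by simpa using mul_mem_degLE hx hy) hx hy }

theorem mem_seriesPolys {g : MvPowerSeries σ (LaurentSeries ℚ)} :
    g ∈ seriesPolys σ ↔ g ∈ seriesIn (degLE 0) := Iff.rfl

theorem det_one_add_sub_one_mem_seriesIn {ι : Type} [Fintype ι] [DecidableEq ι]
    {M : Matrix ι ι (MvPowerSeries σ (LaurentSeries ℚ))} (hM : ∀ i j, M i j ∈ seriesIn (degLE (-1))) :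
    (1 + M).det - 1 ∈ seriesIn (degLE (-1)) := by
  let I : Ideal (seriesPolys σ) :=
    { carrier := {x | (x : MvPowerSeries σ (LaurentSeries ℚ)) ∈ seriesIn (degLE (-1))}
      zero_mem' := (seriesIn (σ := σ) (degLE (-1))).zero_mem
      add_mem' := fun {x y} hx hy => (seriesIn (σ := σ) (degLE (-1))).add_mem hx hy
      smul_mem' := fun c x hx => mul_mem_seriesIn
        (fun _ hx _ hy => by simpa using mul_mem_degLE hx hy) (mem_seriesPolys.mp c.2) hx }
  let M' : Matrix ι ι (seriesPolys σ) := fun i j =>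
    ⟨M i j, fun α => degLE_mono (by norm_num) (hM i j α)⟩
  have h := det_one_add_sub_one_mem (I := I) (M := M') fun i j => hM i j
  have h2 : (((1 + M').det - 1 : seriesPolys σ) : MvPowerSeries σ (LaurentSeries ℚ)) =
      (1 + M).det - 1 := by
    have h3 : (seriesPolys σ).subtype.mapMatrix M' = M := rfl
    rw [← Subring.subtype_apply, map_sub, map_one, RingHom.map_det, map_add, map_one, h3]
  rw [← h2]
  exact h

variable {n : ℕ}

/-- The combination `∑ xⱼ t⁻ʲ`, `1 ≤ j ≤ n`. -/
noncomputable def tauSum (x : Fin n → MvPowerSeries σ ℚ) : MvPowerSeries σ (LaurentSeries ℚ) :=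
  ∑ j : Fin n, MvPowerSeries.map (algebraMap ℚ (LaurentSeries ℚ)) (x j) *
    MvPowerSeries.C (HahnSeries.single (-((j : ℤ) + 1)) 1)

theorem tauSum_mem_seriesIn_degLE (x : Fin n → MvPowerSeries σ ℚ) :
    tauSum x ∈ seriesIn (degLE (-1)) :=
  sum_mem fun j _ => map_mul_mem_seriesIn _ (C_mem_seriesIn (single_mem_degLE (by omega) 1))

theorem tauSum_mem_seriesIn_ordGE (x : Fin n → MvPowerSeries σ ℚ) :
    tauSum x ∈ seriesIn (ordGE (-n)) :=
  sum_mem fun j _ => map_mul_mem_seriesIn _ (C_mem_seriesIn (single_mem_ordGE (by omega) 1))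

theorem map_mem_degGE {x : MvPowerSeries σ ℚ} {K : ℕ} (hx : x ∈ degGE σ ℚ K) :
    MvPowerSeries.map (algebraMap ℚ (LaurentSeries ℚ)) x ∈ degGE σ _ K := by
  intro α hα
  rw [MvPowerSeries.coeff_map, hx α hα, map_zero]

theorem tauSum_mem_degGE {x : Fin n → MvPowerSeries σ ℚ} {K : ℕ} (hx : ∀ j, x j ∈ degGE σ ℚ K) :
    tauSum x ∈ degGE σ _ K :=
  sum_mem fun j _ => Ideal.mul_mem_right _ _ (map_mem_degGE (hx j))

theorem mapLin_C (l : LaurentSeries ℚ →ₗ[ℚ] ℚ) (x : LaurentSeries ℚ) :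
    mapLin (σ := σ) l (MvPowerSeries.C x) = MvPowerSeries.C (l x) := by
  classical
  ext α
  rw [coeff_mapLin, MvPowerSeries.coeff_C, MvPowerSeries.coeff_C]
  split_ifs
  · rfl
  · exact map_zero l

theorem mapLin_tauSum (x : Fin n → MvPowerSeries σ ℚ) (j : Fin n) :
    mapLin (coeffLin (-((j : ℤ) + 1))) (tauSum x) = x j := by
  rw [tauSum, map_sum, Finset.sum_eq_single j]
  · rw [mapLin_map_mul, mapLin_C, coeffLin_apply, HahnSeries.coeff_single_same, map_one, mul_one]
  · intro i _ hij
    rw [mapLin_map_mul, mapLin_C, coeffLin_apply, HahnSeries.coeff_single_of_ne, map_zero, mul_zero]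
    intro h
    exact hij (Fin.ext (by omega))
  · simp

theorem mapLin_eq_zero_of_mem_ordGE {M k : ℤ} (h : k < M)
    {g : MvPowerSeries σ (LaurentSeries ℚ)} (hg : g ∈ seriesIn (ordGE M)) :
    mapLin (coeffLin k) g = 0 := by
  ext α
  exact hg α k h

theorem eq_tauSum {g : MvPowerSeries σ (LaurentSeries ℚ)} (h1 : g ∈ seriesIn (degLE (-1)))
    (h2 : g ∈ seriesIn (ordGE (-n))) :
    g = tauSum fun j : Fin n => mapLin (coeffLin (-((j : ℤ) + 1))) g := by
  ext α k
  rcases lt_or_ge k (-n) with hk | hk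
  · rw [h2 α k hk, tauSum_mem_seriesIn_ordGE _ α k hk]
  rcases lt_or_ge (-1) k with hk' | hk'
  · rw [h1 α k hk', tauSum_mem_seriesIn_degLE _ α k hk']
  obtain ⟨j, rfl⟩ : ∃ j : Fin n, k = -((j : ℤ) + 1) := ⟨⟨(-k - 1).toNat, by omega⟩, by
    show k = -(((-k - 1).toNat : ℤ) + 1)
    omega⟩
  have := congrArg (MvPowerSeries.coeff α) (mapLin_tauSum
    (fun j : Fin n => mapLin (coeffLin (-((j : ℤ) + 1))) g) j)
  exact this.symm

end

section
variable {σ A : Type} [CommRing A] [Algebra ℚ A]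

/-- The inverse of a power series with constant coefficient `1`, as a geometric series. -/
noncomputable def geomInv (u : MvPowerSeries σ A) : MvPowerSeries σ A :=
  (PowerSeries.mk fun k => (-1 : ℚ) ^ k).subst (u - 1)

theorem geomInv_mul {u : MvPowerSeries σ A} (hu : u - 1 ∈ degGE σ A 1) : geomInv u * u = 1 := by
  have hs := HasSubst.of_constantCoeff_zero (mem_degGE_one.mp hu)
  have h1 : (PowerSeries.mk fun k => (-1 : ℚ) ^ k) * (1 + PowerSeries.X) = 1 := by
    ext k
    rw [mul_add, mul_one, map_add]
    rcases k with _ | k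
    · simp
    · rw [coeff_succ_mul_X, coeff_mk, coeff_mk, coeff_one, if_neg (by omega), pow_succ]
      ring
  have h2 := congrArg (PowerSeries.substAlgHom (R := ℚ) hs) h1
  rw [map_mul, map_add, map_one, PowerSeries.coe_substAlgHom hs, PowerSeries.subst_X hs,
    add_sub_cancel] at h2
  exact h2

theorem geomInv_sub_one_mem {u : MvPowerSeries σ A} {K : ℕ} (hu : u - 1 ∈ degGE σ A 1)
    (huK : u - 1 ∈ degGE σ A K) : geomInv u - 1 ∈ degGE σ A K := by
  have h : geomInv u - 1 = -(geomInv u * (u - 1)) := by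
    rw [mul_sub, geomInv_mul hu]
    ring
  rw [h]
  exact neg_mem (Ideal.mul_mem_left _ _ huK)

theorem geomInv_pow_sub_one_add_mem {u : MvPowerSeries σ A} (hu : u - 1 ∈ degGE σ A 1) (N : ℕ) :
    geomInv u ^ N - 1 + (N : MvPowerSeries σ A) * (u - 1) ∈ degGE σ A 2 := by
  have h1 := geomInv_sub_one_mem hu hu
  induction N with
  | zero => simp
  | succ N ih =>
    have h : geomInv u ^ (N + 1) - 1 + ((N + 1 : ℕ) : MvPowerSeries σ A) * (u - 1) =
        geomInv u * (geomInv u ^ N - 1 + (N : MvPowerSeries σ A) * (u - 1)) -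
          ((N : MvPowerSeries σ A) + 1) * ((geomInv u - 1) * (u - 1)) +
          (geomInv u * u - 1) := by
      push_cast
      ring
    rw [h, geomInv_mul hu, sub_self, add_zero]
    exact sub_mem (Ideal.mul_mem_left _ _ ih) (Ideal.mul_mem_left _ _ (mul_mem_degGE h1 hu))

theorem mvNorm_geomInv_le {ν : A → ℝ≥0∞} (hν : IsExtNorm ν)
    (hs : ∀ (q : ℚ) x, ν (q • x) ≤ ‖q‖ₑ * ν x) {r : ℝ≥0∞} {u : MvPowerSeries σ A}
    (hu : u - 1 ∈ degGE σ A 1) (hur : mvNorm ν r (u - 1) ≤ 2⁻¹) :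
    mvNorm ν r (geomInv u) ≤ 2 := by
  refine (mvNorm_subst_le hν hs r _ hu).trans ?_
  rw [← ENNReal.tsum_geometric_two]
  refine ENNReal.tsum_le_tsum fun k => ?_
  rw [coeff_mk]
  have : ‖(-1 : ℚ) ^ k‖ₑ = 1 := by
    rw [enorm_pow]
    simp
  rw [this, one_mul]
  gcongr

theorem coeff_geomInv_sub_one_mem {W : Submodule ℚ A} (hW : ∀ x ∈ W, ∀ y ∈ W, x * y ∈ W)
    {u : MvPowerSeries σ A} (hu : u - 1 ∈ degGE σ A 1)
    (huW : ∀ α, MvPowerSeries.coeff α (u - 1) ∈ W) (α : σ →₀ ℕ) :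
    MvPowerSeries.coeff α (geomInv u - 1) ∈ W := by
  classical
  have hp : ∀ k α, MvPowerSeries.coeff α ((u - 1) ^ (k + 1)) ∈ W := by
    intro k
    induction k with
    | zero => simpa using huW
    | succ k ih =>
      intro α
      rw [pow_succ, MvPowerSeries.coeff_mul]
      exact sum_mem fun p _ => hW _ (ih _) _ (huW _)
  rw [map_sub, geomInv, coeff_subst_eq_sum _ hu (Nat.lt_succ_self _), Finset.sum_range_succ']
  rw [pow_zero, coeff_mk, pow_zero, one_smul, add_sub_cancel_right]
  exact sum_mem fun k _ => W.smul_mem _ (hp _ _)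

end

section
variable {σ : Type}

theorem mul_sub_one_mem_seriesIn {W : Submodule ℚ (LaurentSeries ℚ)}
    (hW : ∀ x ∈ W, ∀ y ∈ W, x * y ∈ W) {u v : MvPowerSeries σ (LaurentSeries ℚ)}
    (hu : u - 1 ∈ seriesIn W) (hv : v - 1 ∈ seriesIn W) : u * v - 1 ∈ seriesIn W := by
  rw [one_add_mul_sub_one]
  exact add_mem (add_mem (mul_mem_seriesIn hW hu hv) hu) hv

theorem pow_sub_one_mem_seriesIn {W : Submodule ℚ (LaurentSeries ℚ)}
    (hW : ∀ x ∈ W, ∀ y ∈ W, x * y ∈ W) {u : MvPowerSeries σ (LaurentSeries ℚ)}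
    (hu : u - 1 ∈ seriesIn W) (N : ℕ) : u ^ N - 1 ∈ seriesIn W := by
  induction N with
  | zero => simp
  | succ N ih => exact pow_succ u N ▸ mul_sub_one_mem_seriesIn hW ih hu

theorem pow_mem_seriesIn_ordGE {n : ℕ} {u : MvPowerSeries σ (LaurentSeries ℚ)}
    (hu : u ∈ seriesIn (ordGE (-n))) (N : ℕ) : u ^ N ∈ seriesIn (ordGE (-((n * N : ℕ) : ℤ))) := by
  induction N with
  | zero => simpa using one_mem_seriesIn one_mem_ordGE
  | succ N ih =>
    rw [pow_succ]
    refine mul_mem_seriesIn (fun x hx y hy => ?_) ih hu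
    have := mul_mem_ordGE hx hy
    refine ordGE_mono (le_of_eq ?_) this
    push_cast
    ring

theorem degLE_neg_one_mul : ∀ x ∈ degLE (-1), ∀ y ∈ degLE (-1), x * y ∈ degLE (-1) :=
  fun _ hx _ hy => degLE_mono (by norm_num) (mul_mem_degLE hx hy)

theorem exists_degLE_sub_mem_ordGE (M : ℤ) (g : LaurentSeries ℚ) :
    ∃ p ∈ degLE M, g - p ∈ ordGE (M + 1) := by
  obtain ⟨N, hN⟩ := exists_mem_ordGE g
  refine ⟨∑ k ∈ Finset.Icc N M, HahnSeries.single k (g.coeff k), ?_, ?_⟩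
  · exact sum_mem fun k hk => single_mem_degLE (Finset.mem_Icc.mp hk).2 _
  · intro k hk
    rw [HahnSeries.coeff_sub, HahnSeries.coeff_sum]
    by_cases hkN : N ≤ k
    · rw [Finset.sum_eq_single_of_mem k (Finset.mem_Icc.mpr ⟨hkN, by omega⟩)]
      · simp
      · intro j _ hj
        exact HahnSeries.coeff_single_of_ne (Ne.symm hj)
    · rw [hN k (by omega), Finset.sum_eq_zero, sub_zero]
      intro j hj
      rw [Finset.mem_Icc] at hj
      exact HahnSeries.coeff_single_of_ne (by omega)

/-- A division principle: a quotient of `φ` by `u` whose poles of order between `n + 1` and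
`m` vanish has no pole of order larger than `n`. -/
theorem mem_seriesIn_ordGE_of_mul_mem {n m : ℕ} (hnm : n ≤ m)
    {u φ ψ : MvPowerSeries σ (LaurentSeries ℚ)} (hu : IsUnit u)
    (hu1 : u ∈ seriesIn (degLE 0)) (hu2 : u ∈ seriesIn (ordGE (-((m - n : ℕ) : ℤ))))
    (hφ : φ ∈ seriesIn (ordGE (-m))) (hψ : u * ψ = φ)
    (h : ∀ k : ℕ, n < k → k ≤ m → mapLin (coeffLin (-k)) ψ = 0) : ψ ∈ seriesIn (ordGE (-n)) := by
  choose p hp1 hp2 using fun α => exists_degLE_sub_mem_ordGE (-m - 1) (MvPowerSeries.coeff α ψ)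
  let ψ₁ : MvPowerSeries σ (LaurentSeries ℚ) := p
  have h1 : ψ₁ ∈ seriesIn (degLE (-m - 1)) := hp1
  have h2 : ψ - ψ₁ ∈ seriesIn (ordGE (-n)) := by
    intro α k hk
    rcases lt_or_ge k (-m) with hkm | hkm
    · exact hp2 α k (by omega)
    · have h3 : (p α).coeff k = 0 := hp1 α k (by omega)
      have h4 : (MvPowerSeries.coeff α ψ).coeff k = 0 := by
        have := congrArg (MvPowerSeries.coeff α) (h (-k).toNat (by omega) (by omega))
        rw [coeff_mapLin, coeffLin_apply, map_zero] at this
        rwa [show -((-k).toNat : ℤ) = k by omega] at this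
      rw [map_sub, HahnSeries.coeff_sub, h4, zero_sub, neg_eq_zero]
      exact h3
  have h3 : u * ψ₁ ∈ seriesIn (degLE (-m - 1)) :=
    mul_mem_seriesIn (fun x hx y hy => by simpa using mul_mem_degLE hx hy) hu1 h1
  have h4 : u * ψ₁ ∈ seriesIn (ordGE (-m)) := by
    have : u * ψ₁ = φ - u * (ψ - ψ₁) := by
      rw [← hψ]
      ring
    rw [this]
    refine sub_mem hφ (mul_mem_seriesIn (fun x hx y hy => ?_) hu2 h2)
    exact ordGE_mono (by omega) (mul_mem_ordGE hx hy)
  have h5 : u * ψ₁ = 0 := by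
    ext α k
    rcases lt_or_ge k (-m) with hkm | hkm
    · exact h4 α k hkm
    · exact h3 α k (by omega)
  rw [(hu.mul_right_eq_zero).mp h5, sub_zero] at h2
  exact h2

theorem mvNorm_mapLin_coeffLin_le {ρ : ℝ≥0∞} (h0 : ρ ≠ 0) (hρ : ρ ≠ ∞) (r : ℝ≥0∞) (k : ℤ)
    (g : MvPowerSeries σ (LaurentSeries ℚ)) :
    mvNorm (fun q : ℚ => ‖q‖ₑ) r (mapLin (coeffLin k) g) ≤ ρ ^ (-k) * mvNorm (lNorm ρ) r g := by
  unfold mvNorm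
  rw [← ENNReal.tsum_mul_left]
  refine ENNReal.tsum_le_tsum fun α => ?_
  rw [← mul_assoc]
  gcongr
  exact enorm_coeff_le h0 hρ _ k

theorem mvNorm_map (ρ r : ℝ≥0∞) (x : MvPowerSeries σ ℚ) :
    mvNorm (lNorm ρ) r (MvPowerSeries.map (algebraMap ℚ (LaurentSeries ℚ)) x) =
      mvNorm (fun q : ℚ => ‖q‖ₑ) r x := by
  unfold mvNorm
  refine tsum_congr fun α => ?_
  have : lNorm ρ (algebraMap ℚ (LaurentSeries ℚ) (MvPowerSeries.coeff α x)) =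
      ‖MvPowerSeries.coeff α x‖ₑ := by
    have := lNorm_single ρ 0 (MvPowerSeries.coeff α x)
    rwa [zpow_zero, mul_one] at this
  rw [MvPowerSeries.coeff_map, this]

end

section
variable {n : ℕ}

/-- The universal polynomial `1 + X₁ t⁻¹ + ⋯ + Xₙ t⁻ⁿ`. -/
noncomputable def univPoly (n : ℕ) : MvPowerSeries (Fin n) (LaurentSeries ℚ) :=
  1 + tauSum MvPowerSeries.X

theorem X_mem_degGE (i : Fin n) : (MvPowerSeries.X i : MvPowerSeries (Fin n) ℚ) ∈ degGE (Fin n) ℚ 1 :=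
  mem_degGE_one.mpr (MvPowerSeries.constantCoeff_X i)

theorem univPoly_sub_one : univPoly n - 1 = tauSum MvPowerSeries.X := add_sub_cancel_left _ _

theorem univPoly_sub_one_mem : univPoly n - 1 ∈ degGE (Fin n) _ 1 := by
  rw [univPoly_sub_one]
  exact tauSum_mem_degGE X_mem_degGE

theorem subst_univPoly {μ : Fin n → MvPowerSeries (Fin n) ℚ} (hμ : ∀ i, μ i ∈ degGE (Fin n) ℚ 1) :
    MvPowerSeries.subst (fun i => MvPowerSeries.map (algebraMap ℚ (LaurentSeries ℚ)) (μ i))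
      (univPoly n) = 1 + tauSum μ := by
  have hs : MvPowerSeries.HasSubst
      fun i => MvPowerSeries.map (algebraMap ℚ (LaurentSeries ℚ)) (μ i) :=
    MvPowerSeries.hasSubst_of_constantCoeff_zero
      fun i => mem_degGE_one.mp (map_mem_degGE (hμ i))
  rw [univPoly, tauSum, tauSum, ← MvPowerSeries.coe_substAlgHom (R := LaurentSeries ℚ) hs, map_add,
    map_one, map_sum]
  congr 1
  refine Finset.sum_congr rfl fun j _ => ?_
  rw [map_mul, MvPowerSeries.map_X, MvPowerSeries.coe_substAlgHom, MvPowerSeries.subst_X hs,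
    MvPowerSeries.subst_C]

/-- For every system of Laurent series with prescribed poles, the combination of them which cancels
the poles of a given series `δ`. -/
theorem exists_cancel_poles {σ : Type} {ℓ n : ℕ} (v : Fin ℓ → LaurentSeries ℚ)
    (hv : ∀ l : Fin ℓ, v l ∈ ordGE (-((n + 1 + l : ℕ) : ℤ)))
    (hv1 : ∀ l : Fin ℓ, (v l).coeff (-((n + 1 + l : ℕ) : ℤ)) = 1)
    {δ : MvPowerSeries σ (LaurentSeries ℚ)} (hδ : δ - 1 ∈ degGE σ _ 1)
    (hδ2 : ∀ k : ℕ, n < k → mapLin (coeffLin (-k)) δ ∈ degGE σ ℚ 2)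
    {ρ r : ℝ≥0∞} (h0 : ρ ≠ 0) (hρ : ρ ≠ ∞) (hδr : mvNorm (lNorm ρ) r δ < ∞)
    (hvr : ∀ l, lNorm ρ (v l) < ∞) :
    ∃ (Δ : MvPowerSeries σ ℚ) (s : Fin ℓ → MvPowerSeries σ ℚ), Δ - 1 ∈ degGE σ ℚ 1 ∧
      mvNorm (fun q : ℚ => ‖q‖ₑ) r Δ < ∞ ∧ (∀ l, mvNorm (fun q : ℚ => ‖q‖ₑ) r (Δ * s l) < ∞) ∧
      (∀ l, s l ∈ degGE σ ℚ 2) ∧ ∀ k : ℕ, n < k → k ≤ n + ℓ → mapLin (coeffLin (-k))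
        ((1 + ∑ l, MvPowerSeries.map (algebraMap ℚ (LaurentSeries ℚ)) (s l) *
          MvPowerSeries.C (v l)) * δ) = 0 := by
  have NL := isExtNorm_mvNorm (σ := σ) (isExtNorm_lNorm h0 hρ) r
  have NQ := isExtNorm_mvNorm (σ := σ) isExtNorm_enorm r
  obtain ⟨G, hGdef⟩ : ∃ G : Matrix (Fin ℓ) (Fin ℓ) (MvPowerSeries σ ℚ), ∀ i l, G i l =
      mapLin (coeffLin (-((n + 1 + i : ℕ) : ℤ))) (MvPowerSeries.C (v l) * δ) := ⟨_, fun _ _ => rfl⟩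
  obtain ⟨T, hTdef⟩ : ∃ T : Fin ℓ → MvPowerSeries σ ℚ, ∀ i, T i =
      mapLin (coeffLin (-((n + 1 + i : ℕ) : ℤ))) δ := ⟨_, fun _ => rfl⟩
  have hρk : ∀ k : ℤ, ρ ^ k < ∞ := fun k => (ENNReal.zpow_lt_top h0 hρ k)
  have hG : ∀ i l, G i l ∈ NQ.finite := fun i l => hGdef i l ▸
    (mvNorm_mapLin_coeffLin_le h0 hρ r _ _).trans_lt (ENNReal.mul_lt_top (hρk _)
      ((NL.mul _ _).trans_lt (ENNReal.mul_lt_top (by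
        rw [mvNorm_C (isExtNorm_lNorm h0 hρ)]
        exact hvr l) hδr)))
  have hT : ∀ i, T i ∈ NQ.finite := fun i => hTdef i ▸
    (mvNorm_mapLin_coeffLin_le h0 hρ r _ _).trans_lt (ENNReal.mul_lt_top (hρk _) hδr)
  have hδ0 : MvPowerSeries.constantCoeff δ = 1 := by
    have := mem_degGE_one.mp hδ
    rwa [map_sub, map_one, sub_eq_zero] at this
  have hGc : ∀ i l, MvPowerSeries.constantCoeff (G i l) =
      (v l).coeff (-((n + 1 + i : ℕ) : ℤ)) := by
    intro i l
    rw [hGdef]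
    show coeffLin (-((n + 1 + i : ℕ) : ℤ)) (MvPowerSeries.constantCoeff (MvPowerSeries.C (v l) * δ)) = _
    rw [map_mul, hδ0, mul_one, MvPowerSeries.constantCoeff_C, coeffLin_apply]
  have hdet : G.det - 1 ∈ degGE σ ℚ 1 := by
    rw [mem_degGE_one, map_sub, map_one, RingHom.map_det, Matrix.det_of_isUpperTriangular (fun i l hil => ?_),
      Finset.prod_eq_one, sub_self]
    · intro i _
      exact (hGc i i).trans (hv1 i)
    · refine (hGc i l).trans (hv l _ ?_)
      have : (l : ℕ) < i := hil
      omega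
  obtain ⟨D, hD⟩ := (isUnit_of_sub_one_mem hdet).exists_right_inv
  obtain ⟨S, hSdef⟩ : ∃ S : Fin ℓ → MvPowerSeries σ ℚ, ∀ l, S l =
      -∑ i, G.adjugate l i * T i := ⟨_, fun _ => rfl⟩
  have hS : ∀ i, ∑ l, G i l * S l = -(G.det * T i) := by
    intro i
    have h1 : G.mulVec (G.adjugate.mulVec T) = G.det • T := by
      rw [Matrix.mulVec_mulVec, Matrix.mul_adjugate, Matrix.smul_mulVec, Matrix.one_mulVec]
    have h2 := congrFun h1 i
    rw [Pi.smul_apply, smul_eq_mul] at h2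
    rw [← h2]
    simp only [hSdef, mul_neg, Finset.sum_neg_distrib]
    rfl
  have hDS : ∀ l, G.det * (D * S l) = S l := fun l => by rw [← mul_assoc, hD, one_mul]
  have hT2 : ∀ i, T i ∈ degGE σ ℚ 2 := fun i => hTdef i ▸ hδ2 _ (by omega)
  refine ⟨G.det, fun l => D * S l, hdet, det_mem hG, fun l => ?_, fun l => ?_, fun k hk1 hk2 => ?_⟩
  · rw [hDS, hSdef]
    exact NQ.finite.neg_mem (NQ.finite.sum_mem fun i _ =>
      NQ.finite.mul_mem (adjugate_mem hG l i) (hT i))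
  · show D * S l ∈ _
    rw [hSdef]
    exact Ideal.mul_mem_left _ _ (neg_mem (sum_mem fun i _ => Ideal.mul_mem_left _ _ (hT2 i)))
  · obtain ⟨i, rfl⟩ : ∃ i : Fin ℓ, k = n + 1 + i := ⟨⟨k - n - 1, by omega⟩, by
      show k = n + 1 + (k - n - 1)
      omega⟩
    rw [add_mul, one_mul, Finset.sum_mul, map_add, map_sum]
    simp_rw [mul_assoc, mapLin_map_mul]
    have h1 : ∑ l, D * S l * mapLin (coeffLin (-((n + 1 + i : ℕ) : ℤ)))
        (MvPowerSeries.C (v l) * δ) = D * ∑ l, G i l * S l := by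
      rw [Finset.mul_sum]
      refine Finset.sum_congr rfl fun l _ => ?_
      rw [hGdef]
      ring
    have h2 : T i + D * ∑ l, G i l * S l = 0 := by
      rw [hS, mul_neg, ← mul_assoc, mul_comm D, hD, one_mul, add_neg_cancel]
    rw [← h2, ← h1, hTdef]

end

theorem natCast_mul_mem_seriesIn {σ : Type} {W : Submodule ℚ (LaurentSeries ℚ)} (N : ℕ)
    {g : MvPowerSeries σ (LaurentSeries ℚ)} (hg : g ∈ seriesIn W) :
    (N : MvPowerSeries σ (LaurentSeries ℚ)) * g ∈ seriesIn W := by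
  rw [← nsmul_eq_mul]
  exact nsmul_mem hg N

/-- The determinants attached to a combination of elements of a pole algebra. -/
theorem PoleAlgebra.exists_det {f : PowerSeries ℚ} {ρ : ℝ≥0∞}
    (P : PoleAlgebra (HahnSeries.ofPowerSeries ℤ ℚ f) ρ) {σ : Type} {ℓ : ℕ} (v : Fin ℓ → P.V)
    {s : Fin ℓ → MvPowerSeries σ ℚ} (hs : ∀ l, s l ∈ degGE σ ℚ 2) (h0 : ρ ≠ 0) (hρ : ρ ≠ ∞)
    {r : ℝ≥0∞} {Δ : MvPowerSeries σ ℚ} (hΔ : mvNorm (fun q : ℚ => ‖q‖ₑ) r Δ < ∞)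
    (hΔs : ∀ l, mvNorm (fun q : ℚ => ‖q‖ₑ) r (Δ * s l) < ∞)
    {φ : MvPowerSeries σ (LaurentSeries ℚ)} (hφ : φ = 1 + ∑ l,
      MvPowerSeries.map (algebraMap ℚ (LaurentSeries ℚ)) (s l) *
        MvPowerSeries.C ((v l : P.V) : LaurentSeries ℚ)) :
    ∃ W : MvPowerSeries σ (LaurentSeries ℚ), W ∈ seriesIn (ordGE 0) ∧ expLog (resMul f) (φ * W) = 1 ∧
      φ * W - 1 ∈ degGE σ _ 2 ∧ φ * W - 1 ∈ seriesIn (degLE (-1)) ∧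
      mvNorm (lNorm ρ) r (MvPowerSeries.map (algebraMap ℚ (LaurentSeries ℚ)) (Δ ^ (P.e + 1)) *
        (φ * W)) < ∞ := by
  have NL := isExtNorm_mvNorm (σ := σ) (isExtNorm_lNorm h0 hρ) r
  obtain ⟨x, hx⟩ : ∃ x : Fin ℓ → MvPowerSeries σ (LaurentSeries ℚ), ∀ l, x l =
    MvPowerSeries.map (algebraMap ℚ (LaurentSeries ℚ)) (s l) := ⟨_, fun _ => rfl⟩
  have hx2 : ∀ l, x l ∈ degGE σ _ 2 := fun l => hx l ▸ map_mem_degGE (hs l)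
  have hdet := P.det_eq (MvPowerSeries.C (σ := σ)) Finset.univ v x
  obtain ⟨MA, hMA⟩ : ∃ M, M = ∑ l, x l • (P.A (v l)).map (MvPowerSeries.C (σ := σ)) := ⟨_, rfl⟩
  obtain ⟨MD, hMD⟩ : ∃ M, M = ∑ l, x l • (P.D (v l)).map (MvPowerSeries.C (σ := σ)) := ⟨_, rfl⟩
  have hMA' : ∀ i j, MA i j = ∑ l, x l * MvPowerSeries.C (P.A (v l) i j) := fun i j => by
    rw [hMA, Matrix.sum_apply]
    rfl
  have hMD' : ∀ i j, MD i j = ∑ l, x l * MvPowerSeries.C (P.D (v l) i j) := fun i j => by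
    rw [hMD, Matrix.sum_apply]
    rfl
  have hφ' : φ = 1 + ∑ l, x l * MvPowerSeries.C ((v l : P.V) : LaurentSeries ℚ) := by
    simp_rw [hx]
    exact hφ
  rw [← hMA, ← hMD, ← hφ'] at hdet
  have hφ2 : φ - 1 ∈ degGE σ _ 1 := by
    rw [hφ', add_sub_cancel_left]
    exact sum_mem fun l _ => Ideal.mul_mem_right _ _ (degGE_mono one_le_two (hx2 l))
  have hA2 : ∀ i j, MA i j ∈ degGE σ _ 2 := fun i j => hMA' i j ▸
    sum_mem fun l _ => Ideal.mul_mem_right _ _ (hx2 l)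
  have hD2 : ∀ i j, MD i j ∈ degGE σ _ 2 := fun i j => hMD' i j ▸
    sum_mem fun l _ => Ideal.mul_mem_right _ _ (hx2 l)
  have hDint : ∀ i j, MD i j ∈ seriesIntegers σ := fun i j => hMD' i j ▸
    (seriesIntegers σ).sum_mem fun l _ => by
      rw [hx]
      exact map_mul_mem_seriesIn _ (C_mem_seriesIn (P.D_mem _ _ _))
  have hA1 : ∀ i j, MA i j ∈ seriesIn (degLE (-1)) := fun i j => hMA' i j ▸
    (seriesIn (degLE (-1))).sum_mem fun l _ => by
      rw [hx]
      exact map_mul_mem_seriesIn _ (C_mem_seriesIn (P.A_mem _ _ _))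
  have hW : (1 + MD).det ∈ seriesIntegers σ := det_mem fun i j => by
    refine (seriesIntegers σ).add_mem ?_ (hDint i j)
    rw [Matrix.one_apply]
    split_ifs
    · exact one_mem _
    · exact zero_mem _
  have hW2 := degGE_mono one_le_two (det_one_add_sub_one_mem hD2)
  refine ⟨(1 + MD).det, hW, ?_, ?_, ?_, ?_⟩
  · rw [expLog_mul hφ2 hW2, expLog_eq_one (W := P.V) P.mul_mem P.coeff_mul_eq_zero hφ2,
      expLog_eq_one (W := ordGE 0) ordGE_zero_mul (fun x hx => resMul_of_mem_ordGE f hx) hW2,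
      one_mul]
    · exact (seriesIntegers σ).sub_mem hW (one_mem _)
    · have : φ - 1 ∈ seriesIn P.V := by
        rw [hφ', add_sub_cancel_left]
        refine sum_mem fun l _ => ?_
        rw [hx]
        exact map_mul_mem_seriesIn _ (C_mem_seriesIn (v l).2)
      exact this
  · rw [← hdet]
    exact det_one_add_sub_one_mem hA2
  · rw [← hdet]
    exact det_one_add_sub_one_mem_seriesIn hA1
  · have hcard : Fintype.card (Unit ⊕ Fin P.e) = P.e + 1 := by
      rw [Fintype.card_sum, Fintype.card_unit, Fintype.card_fin, add_comm]
    rw [← hdet, map_pow, ← hcard, ← Matrix.det_smul]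
    have hfin : ∀ {y : MvPowerSeries σ ℚ}, mvNorm (fun q : ℚ => ‖q‖ₑ) r y < ∞ →
        MvPowerSeries.map (algebraMap ℚ (LaurentSeries ℚ)) y ∈ NL.finite := fun hy => by
      show mvNorm _ _ _ < ∞
      rwa [mvNorm_map]
    refine det_mem (S := NL.finite) fun i j => ?_
    rw [Matrix.smul_apply, Matrix.add_apply, smul_eq_mul, mul_add]
    refine NL.finite.add_mem (NL.finite.mul_mem (hfin hΔ) ?_) ?_
    · rw [Matrix.one_apply]
      split_ifs
      · exact one_mem _
      · exact zero_mem _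
    · rw [hMA', Finset.mul_sum]
      refine NL.finite.sum_mem fun l _ => ?_
      rw [← mul_assoc, hx, ← map_mul]
      refine NL.finite.mul_mem (hfin (hΔs l)) ?_
      show mvNorm _ _ _ < ∞
      rw [mvNorm_C (isExtNorm_lNorm h0 hρ)]
      exact lNorm_lt_top_of_mem_degLE h0 hρ (P.A_mem _ _ _)

/-- The multiplication by `-N` in the formal group attached to `univPoly n`. -/
theorem PoleAlgebra.exists_neg_mul {f : PowerSeries ℚ} {ρ : ℝ≥0∞} (h0 : ρ ≠ 0) (hρ : ρ ≠ ∞)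
    (P : PoleAlgebra (HahnSeries.ofPowerSeries ℤ ℚ f) ρ) {n : ℕ} (hn : 1 ≤ n) (hP : P.n₀ ≤ n)
    {r : ℝ≥0∞} (hr : mvNorm (lNorm ρ) r (univPoly n - 1) ≤ 2⁻¹) (N : ℕ) :
    ∃ (Δ : MvPowerSeries (Fin n) ℚ) (μ : Fin n → MvPowerSeries (Fin n) ℚ),
      Δ - 1 ∈ degGE (Fin n) ℚ 1 ∧ mvNorm (fun q : ℚ => ‖q‖ₑ) r Δ < ∞ ∧
      (∀ j, mvNorm (fun q : ℚ => ‖q‖ₑ) r (Δ * μ j) < ∞) ∧ (∀ j, μ j ∈ degGE (Fin n) ℚ 1) ∧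
      (∀ j, μ j + (N : MvPowerSeries (Fin n) ℚ) * MvPowerSeries.X j ∈ degGE (Fin n) ℚ 2) ∧
      MvPowerSeries.subst μ (expLog (resMul f) (univPoly n)) =
        expLog (-resMul f) (univPoly n) ^ N := by
  have NL := isExtNorm_mvNorm (σ := Fin n) (isExtNorm_lNorm h0 hρ) r
  have NQ := isExtNorm_mvNorm (σ := Fin n) isExtNorm_enorm r
  have hγ := univPoly_sub_one_mem (n := n)
  obtain ⟨u, hu⟩ : ∃ u, u = univPoly n := ⟨_, rfl⟩
  rw [← hu] at hγ hr ⊢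
  have huτ : u - 1 = tauSum MvPowerSeries.X := hu ▸ univPoly_sub_one
  have hdeg : u - 1 ∈ seriesIn (degLE (-1)) := huτ ▸ tauSum_mem_seriesIn_degLE _
  have hord : u - 1 ∈ seriesIn (ordGE (-n)) := huτ ▸ tauSum_mem_seriesIn_ordGE _
  have hone : (1 : MvPowerSeries (Fin n) (LaurentSeries ℚ)) ∈ seriesIn (ordGE (-n)) :=
    one_mem_seriesIn (ordGE_mono (by omega) one_mem_ordGE)
  have huord : u ∈ seriesIn (ordGE (-n)) := by
    have := add_mem hord hone
    rwa [sub_add_cancel] at this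
  obtain ⟨δ, hδ⟩ : ∃ δ, δ = geomInv u ^ N := ⟨_, rfl⟩
  have hδu : u ^ N * δ = 1 := by rw [hδ, mul_comm, ← mul_pow, geomInv_mul hγ, one_pow]
  have hδ1 : δ - 1 ∈ degGE (Fin n) _ 1 :=
    hδ ▸ (expLog_pow (l := resMul f) (geomInv_sub_one_mem hγ hγ) N).1
  have hδN : δ - 1 + (N : MvPowerSeries (Fin n) (LaurentSeries ℚ)) * (u - 1) ∈ degGE (Fin n) _ 2 :=
    hδ ▸ geomInv_pow_sub_one_add_mem hγ N
  have hδdeg : δ - 1 ∈ seriesIn (degLE (-1)) := hδ ▸ pow_sub_one_mem_seriesIn degLE_neg_one_mul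
    (coeff_geomInv_sub_one_mem degLE_neg_one_mul hγ hdeg) N
  have hδr : mvNorm (lNorm ρ) r δ < ∞ := by
    rw [hδ]
    refine NL.finite.pow_mem ?_ N
    exact (mvNorm_geomInv_le (isExtNorm_lNorm h0 hρ) (lNorm_smul_le h0 hρ) hγ hr).trans_lt
      ENNReal.ofNat_lt_top
  have hδ2 : ∀ k : ℕ, n < k → mapLin (coeffLin (-k)) δ ∈ degGE (Fin n) ℚ 2 := by
    intro k hk
    have h1 : δ = (δ - 1 + (N : MvPowerSeries (Fin n) (LaurentSeries ℚ)) * (u - 1)) +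
        (1 - (N : MvPowerSeries (Fin n) (LaurentSeries ℚ)) * (u - 1)) := by ring
    rw [h1, map_add, mapLin_eq_zero_of_mem_ordGE (M := -n) (by omega)
      (sub_mem hone (natCast_mul_mem_seriesIn N hord)), add_zero]
    exact mapLin_mem_degGE _ hδN
  choose v hvV hv hv1 using fun l : Fin (n * N) => P.exists_pole (n + 1 + l) (by omega)
  obtain ⟨Δ, s, hΔ1, hΔr, hΔs, hs2, hcancel⟩ := exists_cancel_poles v hv hv1 hδ1 hδ2 h0 hρ hδr
    fun l => P.norm_lt_top _ (hvV l)
  obtain ⟨φ, hφ⟩ : ∃ φ, φ = 1 + ∑ l, MvPowerSeries.map (algebraMap ℚ (LaurentSeries ℚ)) (s l) *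
    MvPowerSeries.C (v l) := ⟨_, rfl⟩
  rw [← hφ] at hcancel
  obtain ⟨W, hW, hφW, hφW2, hφWd, hφWr⟩ := P.exists_det (fun l => ⟨v l, hvV l⟩) hs2 h0 hρ hΔr hΔs hφ
  have hφord : φ ∈ seriesIn (ordGE (-((n + n * N : ℕ) : ℤ))) := by
    rw [hφ]
    refine add_mem (one_mem_seriesIn (ordGE_mono (by omega) one_mem_ordGE))
      (sum_mem fun l _ => map_mul_mem_seriesIn _ (C_mem_seriesIn (ordGE_mono ?_ (hv l))))
    have := l.2
    omega
  have hψ : φ * δ ∈ seriesIn (ordGE (-n)) := by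
    refine mem_seriesIn_ordGE_of_mul_mem (m := n + n * N) (u := u ^ N) (φ := φ) (by omega)
      (isUnit_of_sub_one_mem (expLog_pow (l := resMul f) hγ N).1) ?_ ?_ hφord ?_ hcancel
    · refine (seriesPolys (Fin n)).pow_mem ?_ N
      have := (seriesPolys (Fin n)).add_mem (x := u - 1)
        (fun α => degLE_mono (by norm_num) (hdeg α)) (one_mem _)
      rwa [sub_add_cancel] at this
    · rw [Nat.add_sub_cancel_left]
      exact pow_mem_seriesIn_ordGE huord N
    · rw [mul_left_comm, hδu, mul_one]
  obtain ⟨γ, hγdef⟩ : ∃ γ, γ = φ * W * δ := ⟨_, rfl⟩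
  have hγ1 : γ - 1 ∈ degGE (Fin n) _ 1 :=
    hγdef ▸ mul_sub_one_mem (degGE_mono one_le_two hφW2) hδ1
  have hγdeg : γ - 1 ∈ seriesIn (degLE (-1)) :=
    hγdef ▸ mul_sub_one_mem_seriesIn degLE_neg_one_mul hφWd hδdeg
  have hγord : γ - 1 ∈ seriesIn (ordGE (-n)) := by
    refine sub_mem ?_ hone
    rw [hγdef, mul_right_comm]
    exact mul_mem_seriesIn (fun x hx y hy => by simpa using mul_mem_ordGE hx hy) hψ hW
  have hγτ := eq_tauSum hγdeg hγord
  have hμ1 : ∀ j : Fin n, mapLin (coeffLin (-((j : ℤ) + 1))) (γ - 1) ∈ degGE (Fin n) ℚ 1 :=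
    fun j => mapLin_mem_degGE _ hγ1
  refine ⟨Δ ^ (P.e + 1), fun j => mapLin (coeffLin (-((j : ℤ) + 1))) (γ - 1),
    (expLog_pow (l := (LinearMap.id : ℚ →ₗ[ℚ] ℚ)) hΔ1 _).1, NQ.finite.pow_mem hΔr _, fun j => ?_, hμ1,
    fun j => ?_, ?_⟩
  · have hfin : MvPowerSeries.map (algebraMap ℚ (LaurentSeries ℚ)) (Δ ^ (P.e + 1)) * (γ - 1) ∈
        NL.finite := by
      rw [mul_sub, mul_one, hγdef, ← mul_assoc]
      refine NL.finite.sub_mem (NL.finite.mul_mem hφWr hδr) ?_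
      show mvNorm _ _ _ < ∞
      rw [mvNorm_map]
      exact NQ.finite.pow_mem hΔr _
    rw [← mapLin_map_mul]
    exact (mvNorm_mapLin_coeffLin_le h0 hρ r _ _).trans_lt
      (ENNReal.mul_lt_top (ENNReal.zpow_lt_top h0 hρ _) hfin)
  · have h1 : mapLin (coeffLin (-((j : ℤ) + 1)))
        ((N : MvPowerSeries (Fin n) (LaurentSeries ℚ)) * (u - 1)) =
        (N : MvPowerSeries (Fin n) ℚ) * MvPowerSeries.X j := by
      rw [huτ, ← nsmul_eq_mul, map_nsmul, mapLin_tauSum, nsmul_eq_mul]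
    rw [← h1, ← map_add]
    refine mapLin_mem_degGE _ ?_
    have h2 : γ - 1 + (N : MvPowerSeries (Fin n) (LaurentSeries ℚ)) * (u - 1) =
        δ * (φ * W - 1) + (δ - 1 + (N : MvPowerSeries (Fin n) (LaurentSeries ℚ)) * (u - 1)) := by
      rw [hγdef]
      ring
    rw [h2]
    exact add_mem (Ideal.mul_mem_left _ _ hφW2) hδN
  · rw [expLog_subst hμ1 hγ, hu, subst_univPoly hμ1, ← hγτ, add_sub_cancel, ← hu]
    have huN := expLog_pow (l := resMul f) hγ N
    have h1 : expLog (resMul f) γ * expLog (resMul f) u ^ N = 1 := by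
      rw [← huN.2, ← expLog_mul hγ1 huN.1, hγdef, mul_assoc, mul_comm δ, hδu, mul_one, hφW]
    have h2 : expLog (-resMul f) u ^ N * expLog (resMul f) u ^ N = 1 := by
      rw [← mul_pow, expLog_neg_mul hγ, one_pow]
    calc expLog (resMul f) γ = expLog (resMul f) γ *
          (expLog (-resMul f) u ^ N * expLog (resMul f) u ^ N) := by rw [h2, mul_one]
      _ = expLog (-resMul f) u ^ N := by rw [mul_left_comm, h1, mul_one]

section
attribute [local instance] Matrix.seminormedAddCommGroup

theorem exists_small_int_solution {ι υ : Type*} [Fintype ι] [Fintype υ]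
    (hcard : Fintype.card υ = 2 * Fintype.card ι) (hpos : 0 < Fintype.card ι)
    (A : ι → υ → ℤ) {H : ℕ} (hH : 1 ≤ H) (hA : ∀ i j, (A i j).natAbs ≤ H) :
    ∃ t : υ → ℤ, t ≠ 0 ∧ (∀ i, ∑ j, A i j * t j = 0) ∧
      ∀ j, (t j).natAbs ≤ Fintype.card υ * H := by
  obtain ⟨t, ht, hAt, hn⟩ :=
    Int.Matrix.exists_ne_zero_int_vec_norm_le (Matrix.of A) (by omega) hpos
  refine ⟨t, ht, fun i => congrFun hAt i, fun j => ?_⟩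
  have hι : (Fintype.card ι : ℝ) ≠ 0 := by exact_mod_cast hpos.ne'
  have he : (Fintype.card ι : ℝ) / ((Fintype.card υ : ℝ) - Fintype.card ι) = 1 := by
    rw [hcard]
    push_cast
    field_simp
    ring
  rw [he, Real.rpow_one] at hn
  have hnat : ∀ z : ℤ, ‖z‖ = (z.natAbs : ℝ) := fun z => by
    rw [Int.norm_eq_abs, Nat.cast_natAbs, Int.cast_abs]
  have hAn : ‖Matrix.of A‖ ≤ H := (Matrix.norm_le_iff (by positivity)).mpr fun i j => by
    rw [hnat]
    exact_mod_cast hA i j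
  have h1 : ‖t j‖ ≤ (Fintype.card υ : ℝ) * H := (norm_le_pi_norm t j).trans (hn.trans (by
    gcongr
    exact max_le (by exact_mod_cast hH) hAn))
  rw [hnat] at h1
  exact_mod_cast h1

end

section
variable {σ : Type}

theorem enorm_intCast (z : ℤ) : ‖(z : ℚ)‖ₑ = (z.natAbs : ℝ≥0∞) := by
  have h : ‖(z : ℚ)‖₊ = (z.natAbs : NNReal) := by
    ext
    rw [coe_nnnorm, ← Rat.norm_cast_real, Rat.cast_intCast, Real.norm_eq_abs, NNReal.coe_natCast,
      Nat.cast_natAbs, Int.cast_abs]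
  rw [enorm_eq_nnnorm, h, ENNReal.coe_natCast]

theorem enorm_coeff_mul_pow_le_mvNorm (r : ℝ≥0∞) (g : MvPowerSeries σ ℚ) (α : σ →₀ ℕ) :
    ‖MvPowerSeries.coeff α g‖ₑ * r ^ α.degree ≤ mvNorm (fun q : ℚ => ‖q‖ₑ) r g :=
  ENNReal.le_tsum α

theorem mvNorm_monomial_one_le {r : ℝ≥0∞} (hr : r ≤ 1) (β : σ →₀ ℕ) :
    mvNorm (fun q : ℚ => ‖q‖ₑ) r (MvPowerSeries.monomial β (1 : ℚ)) ≤ 1 := by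
  classical
  unfold mvNorm
  rw [tsum_eq_single β]
  · simp only [MvPowerSeries.coeff_monomial_same, enorm_one, one_mul]
    exact pow_le_one' hr _
  · intro α hα
    rw [MvPowerSeries.coeff_monomial_ne hα]
    simp

theorem monomial_one_mem_denomRing (B M : ℕ) (β : σ →₀ ℕ) :
    MvPowerSeries.monomial β (1 : ℚ) ∈ denomRing σ B M := by
  classical
  intro α _
  rw [MvPowerSeries.coeff_monomial]
  split_ifs
  · rw [mul_one]
    exact natCast_mem_intQ _
  · rw [mul_zero]
    exact zero_mem _

/-- Leading terms of products of power series. -/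
theorem mul_sub_mul_mem_degGE {A : Type} [CommRing A] {a a' b b' : MvPowerSeries σ A} {p q : ℕ}
    (ha : a ∈ degGE σ A p) (hb' : b' ∈ degGE σ A q) (haa : a - a' ∈ degGE σ A (p + 1))
    (hbb : b - b' ∈ degGE σ A (q + 1)) : a * b - a' * b' ∈ degGE σ A (p + q + 1) := by
  have h : a * b - a' * b' = a * (b - b') + (a - a') * b' := by ring
  rw [h]
  have h₁ := mul_mem_degGE ha hbb
  have h₂ := mul_mem_degGE haa hb'
  rw [← add_assoc] at h₁
  rw [add_right_comm] at h₂
  exact add_mem h₁ h₂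

variable {c : ℚ} {μ : σ → MvPowerSeries σ ℚ}

theorem prod_pow_sub_monomial_mem (hμ : ∀ j, μ j ∈ degGE σ ℚ 1)
    (hμc : ∀ j, μ j - MvPowerSeries.C c * MvPowerSeries.X j ∈ degGE σ ℚ 2) (β : σ →₀ ℕ) :
    (β.prod fun j k => μ j ^ k) ∈ degGE σ ℚ β.degree ∧
      (β.prod fun j k => μ j ^ k) - MvPowerSeries.monomial β (c ^ β.degree) ∈
        degGE σ ℚ (β.degree + 1) := by
  classical
  have hadd : ∀ β₁ β₂ : σ →₀ ℕ,
      ((β₁.prod fun j k => μ j ^ k) ∈ degGE σ ℚ β₁.degree ∧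
        (β₁.prod fun j k => μ j ^ k) - MvPowerSeries.monomial β₁ (c ^ β₁.degree) ∈
          degGE σ ℚ (β₁.degree + 1)) →
      ((β₂.prod fun j k => μ j ^ k) ∈ degGE σ ℚ β₂.degree ∧
        (β₂.prod fun j k => μ j ^ k) - MvPowerSeries.monomial β₂ (c ^ β₂.degree) ∈
          degGE σ ℚ (β₂.degree + 1)) →
      (((β₁ + β₂).prod fun j k => μ j ^ k) ∈ degGE σ ℚ (β₁ + β₂).degree ∧
        ((β₁ + β₂).prod fun j k => μ j ^ k) -
          MvPowerSeries.monomial (β₁ + β₂) (c ^ (β₁ + β₂).degree) ∈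
          degGE σ ℚ ((β₁ + β₂).degree + 1)) := by
    intro β₁ β₂ h₁ h₂
    rw [Finsupp.prod_add_index' (by simp) (fun j k l => pow_add _ _ _), map_add, pow_add,
      ← MvPowerSeries.monomial_mul_monomial]
    exact ⟨mul_mem_degGE h₁.1 h₂.1, mul_sub_mul_mem_degGE h₁.1 (monomial_mem_degGE _ _) h₁.2 h₂.2⟩
  have hzero : ((0 : σ →₀ ℕ).prod fun j k => μ j ^ k) ∈ degGE σ ℚ (0 : σ →₀ ℕ).degree ∧
      ((0 : σ →₀ ℕ).prod fun j k => μ j ^ k) -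
        MvPowerSeries.monomial (0 : σ →₀ ℕ) (c ^ (0 : σ →₀ ℕ).degree) ∈
        degGE σ ℚ ((0 : σ →₀ ℕ).degree + 1) := by
    rw [Finsupp.prod_zero_index, map_zero, pow_zero, MvPowerSeries.monomial_zero_eq_C_apply,
      map_one, sub_self]
    exact ⟨fun α hα => absurd hα (by omega), zero_mem _⟩
  induction β using Finsupp.induction_linear with
  | zero => exact hzero
  | add β₁ β₂ h₁ h₂ => exact hadd _ _ h₁ h₂
  | single i k =>
    induction k with
    | zero => simpa using hzero
    | succ k ih =>
      rw [Finsupp.single_add]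
      refine hadd _ _ ih ?_
      rw [Finsupp.prod_single_index (h := fun j k => μ j ^ k) (pow_zero _), Finsupp.degree_single, pow_one, pow_one]
      refine ⟨hμ i, ?_⟩
      have := hμc i
      rwa [MvPowerSeries.X, ← MvPowerSeries.monomial_zero_eq_C_apply,
        MvPowerSeries.monomial_mul_monomial, zero_add, mul_one] at this

theorem coeff_subst_of_mem_degGE [Finite σ] (hμ : ∀ j, μ j ∈ degGE σ ℚ 1)
    (hμc : ∀ j, μ j - MvPowerSeries.C c * MvPowerSeries.X j ∈ degGE σ ℚ 2) {s : ℕ}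
    {g : MvPowerSeries σ ℚ} (hg : g ∈ degGE σ ℚ s) :
    MvPowerSeries.subst μ g ∈ degGE σ ℚ s ∧ ∀ α : σ →₀ ℕ, α.degree = s →
      MvPowerSeries.coeff α (MvPowerSeries.subst μ g) = c ^ s * MvPowerSeries.coeff α g := by
  classical
  have hs : MvPowerSeries.HasSubst μ :=
    MvPowerSeries.hasSubst_of_constantCoeff_zero fun i => mem_degGE_one.mp (hμ i)
  constructor
  · intro α hα
    rw [MvPowerSeries.coeff_subst hs, finsum_eq_zero_of_forall_eq_zero]
    intro β
    rcases lt_or_ge β.degree s with h | h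
    · rw [hg β h, zero_smul]
    · rw [(prod_pow_sub_monomial_mem hμ hμc β).1 α (by omega), smul_zero]
  · intro α hα
    rw [MvPowerSeries.coeff_subst hs, finsum_eq_single _ α]
    · have := (prod_pow_sub_monomial_mem hμ hμc α).2 α (by omega)
      rw [map_sub, sub_eq_zero, MvPowerSeries.coeff_monomial_same, hα] at this
      rw [this, smul_eq_mul, mul_comm]
    · intro β hβ
      rcases lt_trichotomy β.degree s with h | h | h
      · rw [hg β h, zero_smul]
      · have := (prod_pow_sub_monomial_mem hμ hμc β).2 α (by omega)
        rw [map_sub, sub_eq_zero, MvPowerSeries.coeff_monomial_ne hβ.symm] at this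
        rw [this, smul_zero]
      · rw [(prod_pow_sub_monomial_mem hμ hμc β).1 α (by omega), smul_zero]

theorem exists_order {g : MvPowerSeries σ ℚ} (hg : g ≠ 0) :
    ∃ (s : ℕ) (α : σ →₀ ℕ), g ∈ degGE σ ℚ s ∧ α.degree = s ∧ MvPowerSeries.coeff α g ≠ 0 := by
  classical
  have hex : ∃ s, ∃ α : σ →₀ ℕ, α.degree = s ∧ MvPowerSeries.coeff α g ≠ 0 := by
    by_contra! h
    exact hg (MvPowerSeries.ext fun α => by simpa using h _ α rfl)
  obtain ⟨α, hα, hα0⟩ := Nat.find_spec hex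
  refine ⟨Nat.find hex, α, fun β hβ => ?_, hα, hα0⟩
  by_contra h
  exact Nat.find_min hex hβ ⟨β, rfl, h⟩

theorem one_le_denomBound_mul_enorm_coeff {B M : ℕ} {g : MvPowerSeries σ ℚ}
    (hg : g ∈ denomRing σ B M) {α : σ →₀ ℕ} (hα : α.degree < M)
    (h : MvPowerSeries.coeff α g ≠ 0) :
    1 ≤ (denomBound B α.degree : ℝ≥0∞) * ‖MvPowerSeries.coeff α g‖ₑ := by
  obtain ⟨z, hz⟩ := hg α hα
  have hz' : (z : ℚ) = denomBound B α.degree * MvPowerSeries.coeff α g := hz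
  have hz0 : z ≠ 0 := by
    rintro rfl
    rw [Int.cast_zero, zero_eq_mul] at hz'
    exact hz'.elim (fun h' => (denomBound_pos B α.degree).ne' (by exact_mod_cast h')) h
  have h1 : (denomBound B α.degree : ℝ≥0∞) * ‖MvPowerSeries.coeff α g‖ₑ = z.natAbs := by
    rw [← enorm_intCast, hz', enorm_mul, ← Int.cast_natCast (R := ℚ), enorm_intCast,
      Int.natAbs_natCast]
  rw [h1]
  exact_mod_cast Int.natAbs_pos.mpr hz0

end

section
variable {n D : ℕ}

/-- The monomial `X ^ x.1 * F ^ x.2`. -/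
noncomputable def auxMonomial (F : MvPowerSeries (Fin n) ℚ) (x : (Fin n → Fin D) × Fin D) :
    MvPowerSeries (Fin n) ℚ :=
  MvPowerSeries.monomial (Finsupp.equivFunOnFinite.symm fun i => (x.1 i : ℕ)) (1 : ℚ) *
    F ^ (x.2 : ℕ)

theorem degree_equivFunOnFinite_symm (e : Fin n → ℕ) :
    (Finsupp.equivFunOnFinite.symm e).degree = ∑ i, e i := by
  rw [Finsupp.degree_eq_sum]
  rfl

theorem enorm_coeff_le_pow_mul_mvNorm {r : ℝ≥0∞} {ϱ : ℕ} (hϱ : 1 ≤ (ϱ : ℝ≥0∞) * r) (g : MvPowerSeries (Fin n) ℚ)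
    (α : Fin n →₀ ℕ) : ‖MvPowerSeries.coeff α g‖ₑ ≤
      (ϱ : ℝ≥0∞) ^ α.degree * mvNorm (fun q : ℚ => ‖q‖ₑ) r g := by
  have h1 : (1 : ℝ≥0∞) ≤ (ϱ : ℝ≥0∞) ^ α.degree * r ^ α.degree := by
    rw [← mul_pow]
    exact one_le_pow₀ hϱ
  calc ‖MvPowerSeries.coeff α g‖ₑ
      ≤ ‖MvPowerSeries.coeff α g‖ₑ * ((ϱ : ℝ≥0∞) ^ α.degree * r ^ α.degree) :=
        le_mul_of_one_le_right' h1
    _ = (ϱ : ℝ≥0∞) ^ α.degree * (‖MvPowerSeries.coeff α g‖ₑ * r ^ α.degree) := by ring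
    _ ≤ _ := by
        gcongr
        exact enorm_coeff_mul_pow_le_mvNorm r g α

theorem mvNorm_auxMonomial_le {r : ℝ≥0∞} (hr : r ≤ 1) {F : MvPowerSeries (Fin n) ℚ} {κ : ℕ}
    (hκ : 1 ≤ κ) (hF : mvNorm (fun q : ℚ => ‖q‖ₑ) r F ≤ κ) (x : (Fin n → Fin D) × Fin D) :
    mvNorm (fun q : ℚ => ‖q‖ₑ) r (auxMonomial F x) ≤ (κ : ℝ≥0∞) ^ D := by
  have NQ := isExtNorm_mvNorm (σ := Fin n) isExtNorm_enorm r
  have hκ' : (1 : ℝ≥0∞) ≤ κ := by exact_mod_cast hκ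
  calc mvNorm (fun q : ℚ => ‖q‖ₑ) r (auxMonomial F x)
      ≤ 1 * (κ : ℝ≥0∞) ^ (x.2 : ℕ) := (NQ.mul _ _).trans (mul_le_mul'
        (mvNorm_monomial_one_le hr _) ((NQ.pow_le _ _).trans (pow_le_pow_left' hF _)))
    _ ≤ (κ : ℝ≥0∞) ^ D := by
        rw [one_mul]
        exact pow_le_pow_right₀ hκ' x.2.2.le

theorem exists_auxiliary {B : ℕ} {F : MvPowerSeries (Fin n) ℚ}
    (hF : ∀ M, F ∈ denomRing (Fin n) B M) {r : ℝ≥0∞} (hr : r ≤ 1) {C κ ϱ : ℕ} (hC1 : 1 ≤ C)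
    (hC : ∀ m, denomBound B m ≤ C ^ m) (hκ : 1 ≤ κ)
    (hFκ : mvNorm (fun q : ℚ => ‖q‖ₑ) r F ≤ κ) (hϱ1 : 1 ≤ ϱ) (hϱ : 1 ≤ (ϱ : ℝ≥0∞) * r)
    {k : ℕ} (hk : 1 ≤ k) (hD : D = 2 * k ^ n) :
    ∃ P : (Fin n → Fin D) × Fin D → ℤ, P ≠ 0 ∧
      (∀ x, (P x).natAbs ≤ D ^ (n + 1) * (C ^ n * κ * ϱ ^ n) ^ (k * D)) ∧
      ∑ x, (P x : MvPowerSeries (Fin n) ℚ) * auxMonomial F x ∈ degGE (Fin n) ℚ (k * D) := by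
  classical
  obtain ⟨S, hS⟩ : ∃ S, S = k * D := ⟨_, rfl⟩
  rw [← hS]
  have hDpos : 0 < D := by rw [hD]; positivity
  have hSpos : 0 < S := by rw [hS]; positivity
  have hDS : D ≤ S := hS ▸ Nat.le_mul_of_pos_left D hk
  have hdeg : ∀ α : Fin n → Fin S,
      (Finsupp.equivFunOnFinite.symm fun i => (α i : ℕ)).degree ≤ n * S := by
    intro α
    rw [degree_equivFunOnFinite_symm]
    calc ∑ i, (α i : ℕ) ≤ ∑ _i : Fin n, S := Finset.sum_le_sum fun i _ => (α i).2.le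
      _ = n * S := by simp
  have h_integral : ∀ (α : Fin n → Fin S) (x : (Fin n → Fin D) × Fin D), ∃ z : ℤ,
      (z : ℚ) = (denomBound B (n * S) : ℚ) * MvPowerSeries.coeff
        (Finsupp.equivFunOnFinite.symm fun i => (α i : ℕ)) (auxMonomial F x) := by
    intro α x
    have hmem : auxMonomial F x ∈ denomRing (Fin n) B (n * S + 1) :=
      mul_mem (monomial_one_mem_denomRing _ _ _) (pow_mem (hF _) _)
    obtain ⟨d, hd⟩ := denomBound_dvd B (hdeg α)
    obtain ⟨z, hz⟩ := mul_mem (natCast_mem_intQ d) (hmem _ (Nat.lt_succ_of_le (hdeg α)))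
    refine ⟨z, hz.trans ?_⟩
    rw [hd]
    push_cast
    ring
  choose A hA using h_integral
  obtain ⟨P, hP0, hPz, hPb⟩ := exists_small_int_solution (ι := Fin n → Fin S)
    (υ := (Fin n → Fin D) × Fin D) (by
      simp only [Fintype.card_prod, Fintype.card_fun, Fintype.card_fin]
      rw [hS, mul_pow]
      nth_rewrite 2 [hD]
      ring) (by
      simp only [Fintype.card_fun, Fintype.card_fin]
      positivity) A (H := (C ^ n * κ * ϱ ^ n) ^ S) (Nat.one_le_pow _ _ (by positivity)) (by
      intro α x
      have hκ' : (1 : ℝ≥0∞) ≤ κ := by exact_mod_cast hκ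
      have hϱ' : (1 : ℝ≥0∞) ≤ ϱ := by exact_mod_cast hϱ1
      have h : ((A α x).natAbs : ℝ≥0∞) ≤ (C : ℝ≥0∞) ^ (n * S) *
          ((ϱ : ℝ≥0∞) ^ (n * S) * (κ : ℝ≥0∞) ^ S) := by
        rw [← enorm_intCast, hA, enorm_mul, ← Int.cast_natCast (R := ℚ), enorm_intCast,
          Int.natAbs_natCast]
        refine mul_le_mul' (by exact_mod_cast hC (n * S)) ((enorm_coeff_le_pow_mul_mvNorm hϱ _ _).trans ?_)
        exact mul_le_mul' (pow_le_pow_right₀ hϱ' (hdeg α))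
          ((mvNorm_auxMonomial_le hr hκ hFκ x).trans (pow_le_pow_right₀ hκ' hDS))
      have h2 : (A α x).natAbs ≤ C ^ (n * S) * (ϱ ^ (n * S) * κ ^ S) := by exact_mod_cast h
      refine h2.trans (le_of_eq ?_)
      rw [mul_pow, mul_pow, ← pow_mul, ← pow_mul]
      ring)
  refine ⟨P, hP0, fun x => (hPb x).trans (le_of_eq ?_), fun α hα => ?_⟩
  · simp only [Fintype.card_prod, Fintype.card_fun, Fintype.card_fin]
    ring
  · have hlt : ∀ i, α i < S := fun i => (Finsupp.le_degree i α).trans_lt hα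
    have h1 := hPz fun i => ⟨α i, hlt i⟩
    have h2 : (denomBound B (n * S) : ℚ) * MvPowerSeries.coeff α
        (∑ x, (P x : MvPowerSeries (Fin n) ℚ) * auxMonomial F x) = 0 := by
      rw [map_sum, Finset.mul_sum]
      have h3 : ((∑ x, A (fun i => ⟨α i, hlt i⟩) x * P x : ℤ) : ℚ) = 0 := by
        rw [h1, Int.cast_zero]
      rw [← h3, Int.cast_sum]
      refine Finset.sum_congr rfl fun x _ => ?_
      have h4 : Finsupp.equivFunOnFinite.symm (fun i => α i) = α := Finsupp.ext fun _ => rfl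
      rw [Int.cast_mul, hA, ← map_intCast (MvPowerSeries.C (σ := Fin n) (R := ℚ)),
        MvPowerSeries.coeff_C_mul]
      simp only [h4]
      ring
    exact (mul_eq_zero.mp h2).resolve_left (by exact_mod_cast (denomBound_pos B _).ne')

theorem enorm_coeff_le_of_subst {F G Δ : MvPowerSeries (Fin n) ℚ}
    {μ : Fin n → MvPowerSeries (Fin n) ℚ} {N : ℕ} (hΔ : Δ - 1 ∈ degGE (Fin n) ℚ 1)
    (hμ : ∀ j, μ j ∈ degGE (Fin n) ℚ 1)
    (hμN : ∀ j, μ j + (N : MvPowerSeries (Fin n) ℚ) * MvPowerSeries.X j ∈ degGE (Fin n) ℚ 2)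
    (hsubst : MvPowerSeries.subst μ F = G) {r : ℝ≥0∞} {K Q ϱ : ℕ} (hK : 1 ≤ K)
    (hϱ : 1 ≤ (ϱ : ℝ≥0∞) * r)
    (hΔK : mvNorm (fun q : ℚ => ‖q‖ₑ) r Δ ≤ K)
    (hμK : ∀ j, mvNorm (fun q : ℚ => ‖q‖ₑ) r (Δ * μ j) ≤ K)
    (hGK : mvNorm (fun q : ℚ => ‖q‖ₑ) r G ≤ K)
    {P : (Fin n → Fin D) × Fin D → ℤ} (hP : ∀ x, (P x).natAbs ≤ Q) {s : ℕ} {α : Fin n →₀ ℕ}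
    (hs : ∑ x, (P x : MvPowerSeries (Fin n) ℚ) * auxMonomial F x ∈ degGE (Fin n) ℚ s)
    (hα : α.degree = s) :
    (N : ℝ≥0∞) ^ s * ‖MvPowerSeries.coeff α
      (∑ x, (P x : MvPowerSeries (Fin n) ℚ) * auxMonomial F x)‖ₑ ≤
      (ϱ : ℝ≥0∞) ^ s * (D ^ (n + 1) * (Q * (K : ℝ≥0∞) ^ ((n + 1) * D))) := by
  classical
  have NQ := isExtNorm_mvNorm (σ := Fin n) isExtNorm_enorm r
  have hK' : (1 : ℝ≥0∞) ≤ K := by exact_mod_cast hK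
  have hsub : MvPowerSeries.HasSubst μ :=
    MvPowerSeries.hasSubst_of_constantCoeff_zero fun i => mem_degGE_one.mp (hμ i)
  obtain ⟨A, hA⟩ : ∃ A, A = ∑ x, (P x : MvPowerSeries (Fin n) ℚ) * auxMonomial F x := ⟨_, rfl⟩
  rw [← hA] at hs ⊢
  obtain ⟨hsA, hcoeff⟩ := coeff_subst_of_mem_degGE (c := -(N : ℚ)) hμ (fun j => by
    have := hμN j
    rwa [map_neg, map_natCast, neg_mul, sub_neg_eq_add]) hs
  have hsubA : MvPowerSeries.subst μ A = ∑ x, (P x : MvPowerSeries (Fin n) ℚ) *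
      ((∏ i, μ i ^ (x.1 i : ℕ)) * G ^ (x.2 : ℕ)) := by
    rw [hA, ← MvPowerSeries.coe_substAlgHom (R := ℚ) hsub, map_sum]
    refine Finset.sum_congr rfl fun x _ => ?_
    rw [auxMonomial, map_mul, map_mul, map_intCast, map_pow, MvPowerSeries.coe_substAlgHom,
      hsubst, MvPowerSeries.subst_monomial hsub, map_one, one_mul, Finsupp.prod_fintype _ _
        (fun i => pow_zero _)]
    rfl
  have hmul : Δ ^ (n * D) * MvPowerSeries.subst μ A - MvPowerSeries.subst μ A ∈
      degGE (Fin n) ℚ (s + 1) := by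
    have h1 : Δ ^ (n * D) - 1 ∈ degGE (Fin n) ℚ 1 := by
      induction n * D with
      | zero => simp
      | succ m ih => exact pow_succ Δ m ▸ mul_sub_one_mem ih hΔ
    have h2 := mul_mem_degGE h1 hsA
    rwa [sub_mul, one_mul, add_comm 1 s] at h2
  have hterm : ∀ x : (Fin n → Fin D) × Fin D, mvNorm (fun q : ℚ => ‖q‖ₑ) r
      (Δ ^ (n * D) * ((P x : MvPowerSeries (Fin n) ℚ) *
        ((∏ i, μ i ^ (x.1 i : ℕ)) * G ^ (x.2 : ℕ)))) ≤ Q * (K : ℝ≥0∞) ^ ((n + 1) * D) := by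
    intro x
    have hle : ∑ i, (x.1 i : ℕ) ≤ n * D :=
      (Finset.sum_le_sum fun i _ => (x.1 i).2.le).trans (by simp)
    have hrw : Δ ^ (n * D) * ((P x : MvPowerSeries (Fin n) ℚ) *
        ((∏ i, μ i ^ (x.1 i : ℕ)) * G ^ (x.2 : ℕ))) =
        MvPowerSeries.C (P x : ℚ) * (Δ ^ (n * D - ∑ i, (x.1 i : ℕ)) *
          ((∏ i, (Δ * μ i) ^ (x.1 i : ℕ)) * G ^ (x.2 : ℕ))) := by
      simp_rw [mul_pow]
      rw [Finset.prod_mul_distrib, Finset.prod_pow_eq_pow_sum, map_intCast]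
      conv_lhs => rw [← Nat.sub_add_cancel hle, pow_add]
      ring
    have hprod : ∀ t : Finset (Fin n), mvNorm (fun q : ℚ => ‖q‖ₑ) r
        (∏ i ∈ t, (Δ * μ i) ^ (x.1 i : ℕ)) ≤ (K : ℝ≥0∞) ^ (∑ i ∈ t, (x.1 i : ℕ)) := by
      intro t
      induction t using Finset.induction_on with
      | empty => simpa using NQ.one
      | insert i t hi ih =>
        rw [Finset.prod_insert hi, Finset.sum_insert hi, pow_add]
        exact (NQ.mul _ _).trans (mul_le_mul'
          ((NQ.pow_le _ _).trans (pow_le_pow_left' (hμK i) _)) ih)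
    have hPx : mvNorm (σ := Fin n) (fun q : ℚ => ‖q‖ₑ) r (MvPowerSeries.C (P x : ℚ)) ≤ Q := by
      rw [mvNorm_C isExtNorm_enorm, enorm_intCast]
      exact_mod_cast hP x
    rw [hrw]
    calc _ ≤ (Q : ℝ≥0∞) * ((K : ℝ≥0∞) ^ (n * D - ∑ i, (x.1 i : ℕ)) *
          ((K : ℝ≥0∞) ^ (∑ i, (x.1 i : ℕ)) * (K : ℝ≥0∞) ^ (x.2 : ℕ))) :=
          (NQ.mul _ _).trans (mul_le_mul' hPx ((NQ.mul _ _).trans (mul_le_mul'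
            ((NQ.pow_le _ _).trans (pow_le_pow_left' hΔK _)) ((NQ.mul _ _).trans (mul_le_mul'
              (hprod _) ((NQ.pow_le _ _).trans (pow_le_pow_left' hGK _)))))))
      _ ≤ Q * (K : ℝ≥0∞) ^ ((n + 1) * D) := by
          rw [← pow_add, ← pow_add]
          refine mul_le_mul' le_rfl (pow_le_pow_right₀ hK' ?_)
          have := x.2.2
          rw [add_one_mul]
          omega
  have hnorm : mvNorm (fun q : ℚ => ‖q‖ₑ) r (Δ ^ (n * D) * MvPowerSeries.subst μ A) ≤
      D ^ (n + 1) * (Q * (K : ℝ≥0∞) ^ ((n + 1) * D)) := by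
    rw [hsubA, Finset.mul_sum]
    refine (NQ.sum_le _ _).trans ((Finset.sum_le_sum fun x _ => hterm x).trans (le_of_eq ?_))
    simp [pow_succ]
  have hc : MvPowerSeries.coeff α (Δ ^ (n * D) * MvPowerSeries.subst μ A) =
      (-(N : ℚ)) ^ s * MvPowerSeries.coeff α A := by
    have := hmul α (by omega)
    rw [map_sub, sub_eq_zero] at this
    rw [this, hcoeff α hα]
  have hN : (N : ℝ≥0∞) = ‖-(N : ℚ)‖ₑ := by
    rw [enorm_neg, ← Int.cast_natCast (R := ℚ), enorm_intCast, Int.natAbs_natCast]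
  rw [hN, ← enorm_pow, ← enorm_mul, ← hc, ← hα]
  exact (enorm_coeff_le_pow_mul_mvNorm hϱ _ _).trans (mul_le_mul' le_rfl hnorm)

end

theorem exists_natCast_ge {x : ℝ≥0∞} (hx : x < ∞) : ∃ K : ℕ, 1 ≤ K ∧ x ≤ K := by
  obtain ⟨K, hK⟩ := ENNReal.exists_nat_gt hx.ne
  exact ⟨K + 1, Nat.le_add_left 1 K, hK.le.trans (by exact_mod_cast Nat.le_succ K)⟩

theorem exists_relation {n B : ℕ} {F G : MvPowerSeries (Fin n) ℚ}
    (hF : ∀ M, F ∈ denomRing (Fin n) B M) {r : ℝ≥0∞} (hr0 : r ≠ 0) (hr : r ≤ 1)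
    (hFr : mvNorm (fun q : ℚ => ‖q‖ₑ) r F < ∞) (hGr : mvNorm (fun q : ℚ => ‖q‖ₑ) r G < ∞)
    (hFG : ∀ N : ℕ, ∃ (Δ : MvPowerSeries (Fin n) ℚ) (μ : Fin n → MvPowerSeries (Fin n) ℚ),
      Δ - 1 ∈ degGE (Fin n) ℚ 1 ∧ mvNorm (fun q : ℚ => ‖q‖ₑ) r Δ < ∞ ∧
      (∀ j, mvNorm (fun q : ℚ => ‖q‖ₑ) r (Δ * μ j) < ∞) ∧ (∀ j, μ j ∈ degGE (Fin n) ℚ 1) ∧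
      (∀ j, μ j + (N : MvPowerSeries (Fin n) ℚ) * MvPowerSeries.X j ∈ degGE (Fin n) ℚ 2) ∧
      MvPowerSeries.subst μ F = G ^ N) :
    ∃ (D : ℕ) (P : (Fin n → Fin D) × Fin D → ℤ), P ≠ 0 ∧
      ∑ x, (P x : MvPowerSeries (Fin n) ℚ) * auxMonomial F x = 0 := by
  have NQ := isExtNorm_mvNorm (σ := Fin n) isExtNorm_enorm r
  obtain ⟨C, hC1, hC⟩ := exists_denomBound_le_pow B
  obtain ⟨κ, hκ1, hκ⟩ := exists_natCast_ge hFr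
  obtain ⟨ϱ, hϱ1, hϱ⟩ := exists_natCast_ge (ENNReal.inv_lt_top.mpr (pos_iff_ne_zero.mpr hr0))
  replace hϱ : 1 ≤ (ϱ : ℝ≥0∞) * r := by
    rw [← ENNReal.inv_mul_cancel hr0 (hr.trans_lt ENNReal.one_lt_top).ne]
    exact mul_le_mul' hϱ le_rfl
  obtain ⟨L, hL⟩ : ∃ L, L = C ^ n * κ * ϱ ^ n := ⟨_, rfl⟩
  have hL1 : 1 ≤ L := by rw [hL]; exact Nat.succ_le_of_lt (by positivity)
  obtain ⟨E, hE⟩ : ∃ E, E = 2 ^ (2 * (n + 1)) * L := ⟨_, rfl⟩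
  have hE1 : 1 ≤ E := by rw [hE]; exact Nat.succ_le_of_lt (by positivity)
  obtain ⟨N, hN⟩ : ∃ N, N = 2 * (C * ϱ * E) := ⟨_, rfl⟩
  obtain ⟨Δ, μ, hΔ, hΔr, hμr, hμ, hμN, hsub⟩ := hFG N
  have hsum : mvNorm (fun q : ℚ => ‖q‖ₑ) r Δ + (∑ j, mvNorm (fun q : ℚ => ‖q‖ₑ) r (Δ * μ j) +
      mvNorm (fun q : ℚ => ‖q‖ₑ) r (G ^ N)) < ∞ :=
    ENNReal.add_lt_top.mpr ⟨hΔr, ENNReal.add_lt_top.mpr ⟨ENNReal.sum_lt_top.mpr fun j _ => hμr j,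
      NQ.finite.pow_mem hGr N⟩⟩
  obtain ⟨K, hK1, hK⟩ := exists_natCast_ge hsum
  have hΔK := le_self_add.trans hK
  have hμK : ∀ j, mvNorm (fun q : ℚ => ‖q‖ₑ) r (Δ * μ j) ≤ K := fun j =>
    (Finset.single_le_sum (f := fun j => mvNorm (fun q : ℚ => ‖q‖ₑ) r (Δ * μ j))
      (fun _ _ => zero_le) (Finset.mem_univ j)).trans
      (le_self_add.trans (le_add_self.trans hK))
  have hGK := le_add_self.trans (le_add_self.trans hK)
  obtain ⟨k, hk⟩ := pow_unbounded_of_one_lt (K ^ (n + 1)) (one_lt_two : (1 : ℕ) < 2)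
  have hk1 : 1 ≤ k := by
    rcases Nat.eq_zero_or_pos k with rfl | h
    · have := Nat.one_le_pow (n + 1) K hK1
      simp at hk
      omega
    · exact h
  obtain ⟨D, hD⟩ : ∃ D, D = 2 * k ^ n := ⟨_, rfl⟩
  have hDpos : 0 < D := by rw [hD]; positivity
  obtain ⟨P, hP0, hPb, hPS⟩ := exists_auxiliary hF hr hC1 hC hκ1 hκ hϱ1 hϱ hk1 hD
  refine ⟨D, P, hP0, ?_⟩
  by_contra hA
  obtain ⟨s, α, hs, hα, hα0⟩ := exists_order hA
  have hSs : k * D ≤ s := by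
    by_contra! h
    exact hα0 (hPS α (by omega))
  have hmem : ∑ x, (P x : MvPowerSeries (Fin n) ℚ) * auxMonomial F x ∈
      denomRing (Fin n) B (s + 1) :=
    sum_mem fun x _ => mul_mem (intCast_mem _ _)
      (mul_mem (monomial_one_mem_denomRing _ _ _) (pow_mem (hF _) _))
  have hlow := one_le_denomBound_mul_enorm_coeff hmem (hα ▸ Nat.lt_succ_self _) hα0
  have hup := enorm_coeff_le_of_subst hΔ hμ hμN hsub hK1 hϱ hΔK hμK hGK hPb hs hα
  rw [hα] at hlow
  rw [← hL] at hup
  have hnat : N ^ s ≤ C ^ s * (ϱ ^ s * (D ^ (n + 1) * (D ^ (n + 1) * L ^ (k * D) *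
      K ^ ((n + 1) * D)))) := by
    have h : (N : ℝ≥0∞) ^ s ≤ (C : ℝ≥0∞) ^ s * ((ϱ : ℝ≥0∞) ^ s * (D ^ (n + 1) *
        (((D ^ (n + 1) * L ^ (k * D) : ℕ) : ℝ≥0∞) * (K : ℝ≥0∞) ^ ((n + 1) * D)))) := by
      refine (le_mul_of_one_le_right' hlow).trans ?_
      rw [mul_left_comm]
      exact mul_le_mul' (by exact_mod_cast hC s) hup
    exact_mod_cast h
  have hDE : D ^ (n + 1) * (D ^ (n + 1) * L ^ (k * D)) ≤ E ^ s := by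
    have h1 : D ^ (n + 1) ≤ (2 ^ (n + 1)) ^ (k * D) := by
      rw [← pow_mul, mul_comm (n + 1), pow_mul]
      refine Nat.pow_le_pow_left (Nat.lt_two_pow_self.le.trans ?_) _
      exact Nat.pow_le_pow_right two_pos (Nat.le_mul_of_pos_left D hk1)
    calc D ^ (n + 1) * (D ^ (n + 1) * L ^ (k * D))
        ≤ (2 ^ (n + 1)) ^ (k * D) * ((2 ^ (n + 1)) ^ (k * D) * L ^ (k * D)) := by gcongr
      _ = E ^ (k * D) := by
          rw [hE, ← mul_pow, ← mul_pow]
          ring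
      _ ≤ E ^ s := Nat.pow_le_pow_right hE1 hSs
  have h2 : 2 ^ s ≤ K ^ ((n + 1) * D) := by
    have h3 : (C * ϱ * E) ^ s * 2 ^ s ≤ (C * ϱ * E) ^ s * K ^ ((n + 1) * D) := by
      calc (C * ϱ * E) ^ s * 2 ^ s = N ^ s := by rw [hN, mul_pow 2, mul_comm]
        _ ≤ _ := hnat
        _ = C ^ s * ϱ ^ s * (D ^ (n + 1) * (D ^ (n + 1) * L ^ (k * D))) *
            K ^ ((n + 1) * D) := by ring
        _ ≤ C ^ s * ϱ ^ s * E ^ s * K ^ ((n + 1) * D) := by gcongr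
        _ = _ := by ring
    exact Nat.le_of_mul_le_mul_left h3 (by positivity)
  have h4 : K ^ ((n + 1) * D) < 2 ^ s := by
    calc K ^ ((n + 1) * D) = (K ^ (n + 1)) ^ D := pow_mul _ _ _
      _ < (2 ^ k) ^ D := Nat.pow_lt_pow_left hk hDpos.ne'
      _ = 2 ^ (k * D) := (pow_mul _ _ _).symm
      _ ≤ 2 ^ s := Nat.pow_le_pow_right two_pos hSs
  omega

section
variable {σ : Type}

theorem coeff_single_subst_restrict [Finite σ] [DecidableEq σ] (i₀ : σ) (G : MvPowerSeries σ ℚ)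
    (k : ℕ) : MvPowerSeries.coeff (Finsupp.single i₀ k) (MvPowerSeries.subst
      (fun i => if i = i₀ then (MvPowerSeries.X i₀ : MvPowerSeries σ ℚ) else 0) G) =
      MvPowerSeries.coeff (Finsupp.single i₀ k) G := by
  have hs : MvPowerSeries.HasSubst
      fun i => if i = i₀ then (MvPowerSeries.X i₀ : MvPowerSeries σ ℚ) else 0 := by
    refine MvPowerSeries.hasSubst_of_constantCoeff_zero fun i => ?_
    split_ifs <;> simp
  have hprod : ∀ m, ((Finsupp.single i₀ m).prod fun i l =>
      (if i = i₀ then (MvPowerSeries.X i₀ : MvPowerSeries σ ℚ) else 0) ^ l) =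
      MvPowerSeries.X i₀ ^ m := by
    intro m
    rw [Finsupp.prod_single_index (h := fun i l =>
      (if i = i₀ then (MvPowerSeries.X i₀ : MvPowerSeries σ ℚ) else 0) ^ l) (pow_zero _), if_pos rfl]
  rw [MvPowerSeries.coeff_subst hs, finsum_eq_single _ (Finsupp.single i₀ k)]
  · rw [hprod, MvPowerSeries.coeff_X_pow, if_pos rfl, smul_eq_mul, mul_one]
  · intro β hβ
    by_cases h : ∃ i, i ≠ i₀ ∧ β i ≠ 0
    · obtain ⟨i, hi, hβi⟩ := h
      rw [Finsupp.prod, Finset.prod_eq_zero (Finsupp.mem_support_iff.mpr hβi), map_zero, smul_zero]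
      rw [if_neg hi, zero_pow hβi]
    · push Not at h
      have hβ' : β = Finsupp.single i₀ (β i₀) := by
        ext i
        rcases eq_or_ne i i₀ with rfl | hi
        · simp
        · rw [h i hi, Finsupp.single_eq_of_ne hi]
      rw [hβ'] at hβ ⊢
      rw [hprod, MvPowerSeries.coeff_X_pow, if_neg hβ.symm, smul_zero]

theorem coeff_monomial_mul_of_restrict {i₀ : σ} {G : MvPowerSeries σ ℚ} {Y : PowerSeries ℚ}
    (hG : ∀ k, MvPowerSeries.coeff (Finsupp.single i₀ k) G = (-1) ^ k * coeff k Y)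
    (e : σ →₀ ℕ) (k : ℕ) :
    (-1) ^ k * MvPowerSeries.coeff (Finsupp.single i₀ k + e.erase i₀)
      (MvPowerSeries.monomial e (1 : ℚ) * G) = coeff k ((-X) ^ (e i₀) * Y : PowerSeries ℚ) := by
  classical
  have h1 : ((-X) ^ (e i₀) * Y : PowerSeries ℚ) = C ((-1) ^ (e i₀)) * (X ^ (e i₀) * Y) := by
    rw [neg_pow, map_pow, map_neg, map_one, mul_assoc]
  rw [MvPowerSeries.coeff_monomial_mul, h1, coeff_C_mul, coeff_X_pow_mul']
  have hiff : e ≤ Finsupp.single i₀ k + e.erase i₀ ↔ e i₀ ≤ k := by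
    constructor
    · intro h
      simpa using h i₀
    · intro h i
      rcases eq_or_ne i i₀ with rfl | hi
      · simpa using h
      · simp [Finsupp.erase_ne hi]
  simp only [hiff]
  split_ifs with h
  · obtain ⟨d, hd⟩ := Nat.exists_eq_add_of_le h
    subst hd
    have h2 : Finsupp.single i₀ (e i₀ + d) + e.erase i₀ - e = Finsupp.single i₀ d := by
      ext i
      rcases eq_or_ne i i₀ with rfl | hi
      · simp
      · simp [Finsupp.erase_ne hi, Finsupp.single_eq_of_ne hi]
    have h3 : (-1 : ℚ) ^ d * (-1) ^ d = 1 := by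
      rw [← mul_pow]
      norm_num
    rw [h2, hG, Nat.add_sub_cancel_left, one_mul, pow_add]
    linear_combination (-1 : ℚ) ^ (e i₀) * coeff d Y * h3
  · simp

theorem coeff_monomial_mul_eq_zero {i₀ : σ} (G : MvPowerSeries σ ℚ) {e β : σ →₀ ℕ}
    (hle : β.degree ≤ (e.erase i₀).degree) (hne : e.erase i₀ ≠ β) (k : ℕ) :
    MvPowerSeries.coeff (Finsupp.single i₀ k + β.erase i₀)
      (MvPowerSeries.monomial e (1 : ℚ) * G) = 0 := by
  classical
  rw [MvPowerSeries.coeff_monomial_mul, if_neg]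
  intro h
  have h1 : e.erase i₀ ≤ β := by
    intro i
    rcases eq_or_ne i i₀ with rfl | hi
    · simp
    · simpa [Finsupp.erase_ne hi, Finsupp.single_eq_of_ne hi] using h i
  obtain ⟨d, hd⟩ := exists_add_of_le h1
  have h2 : d.degree = 0 := by
    have := congrArg Finsupp.degree hd
    rw [map_add] at this
    omega
  rw [Finsupp.degree_eq_zero_iff] at h2
  rw [h2, add_zero] at hd
  exact hne hd.symm

end

theorem isAlgebraicPS_of_relation {n D : ℕ} {F : MvPowerSeries (Fin n) ℚ} {Y : PowerSeries ℚ}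
    {i₀ : Fin n} (hFY : ∀ j k : ℕ, MvPowerSeries.coeff (Finsupp.single i₀ k) (F ^ j) =
      (-1) ^ k * coeff k (Y ^ j)) {P : (Fin n → Fin D) × Fin D → ℤ} (hP0 : P ≠ 0)
    (hP : ∑ x, (P x : MvPowerSeries (Fin n) ℚ) * auxMonomial F x = 0) : IsAlgebraicPS Y := by
  classical
  obtain ⟨ε, hε⟩ : ∃ ε : (Fin n → Fin D) → (Fin n →₀ ℕ),
      ∀ e, ε e = Finsupp.equivFunOnFinite.symm fun i => (e i : ℕ) := ⟨_, fun _ => rfl⟩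
  have hεi : ∀ e i, ε e i = e i := fun e i => by rw [hε]; rfl
  obtain ⟨x₁, hx₁⟩ := Function.ne_iff.mp hP0
  obtain ⟨x₀, hx₀, hmin⟩ := Finset.exists_min_image (Finset.univ.filter fun x => P x ≠ 0)
    (fun x => ((ε x.1).erase i₀).degree) ⟨x₁, by simpa using hx₁⟩
  have hPx₀ : P x₀ ≠ 0 := (Finset.mem_filter.mp hx₀).2
  obtain ⟨β, hβ⟩ : ∃ β, β = (ε x₀.1).erase i₀ := ⟨_, rfl⟩
  have hββ : β.erase i₀ = β := by rw [hβ, Finsupp.erase_idem]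
  refine ⟨∑ x, if (ε x.1).erase i₀ = β then Polynomial.monomial (x.2 : ℕ)
    (Polynomial.C (P x : ℚ) * (-Polynomial.X) ^ (x.1 i₀ : ℕ)) else 0, fun h0 => ?_, ?_⟩
  · have h1 := congrArg (fun q : Polynomial (Polynomial ℚ) =>
      (q.coeff (x₀.2 : ℕ)).coeff (x₀.1 i₀ : ℕ)) h0
    simp only [Polynomial.finsetSum_coeff, Polynomial.coeff_zero] at h1
    rw [Finset.sum_eq_single x₀] at h1
    · rw [if_pos hβ.symm, Polynomial.coeff_monomial, if_pos rfl, neg_pow, Polynomial.coeff_C_mul,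
        ← Polynomial.C_1, ← Polynomial.C_neg, ← Polynomial.C_pow, Polynomial.coeff_C_mul,
        Polynomial.coeff_X_pow, if_pos rfl, mul_one] at h1
      have h2 := (mul_eq_zero.mp h1).resolve_right (pow_ne_zero _ (by norm_num))
      exact hPx₀ (by exact_mod_cast h2)
    · intro x _ hx
      split_ifs with hxβ
      · rw [Polynomial.coeff_monomial]
        split_ifs with h2
        · rw [neg_pow, Polynomial.coeff_C_mul, ← Polynomial.C_1, ← Polynomial.C_neg,
            ← Polynomial.C_pow, Polynomial.coeff_C_mul, Polynomial.coeff_X_pow, if_neg, mul_zero,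
            mul_zero]
          intro h3
          refine hx (Prod.ext (funext fun i => Fin.ext ?_) (Fin.ext h2))
          rcases eq_or_ne i i₀ with rfl | hi
          · exact h3.symm
          · have := DFunLike.congr_fun (hxβ.trans hβ) i
            rwa [Finsupp.erase_ne hi, Finsupp.erase_ne hi, hεi, hεi] at this
        · rw [Polynomial.coeff_zero]
      · rw [Polynomial.coeff_zero, Polynomial.coeff_zero]
    · exact fun h => absurd (Finset.mem_univ _) h
  · rw [Polynomial.eval₂_finsetSum]
    ext k
    have h1 := congrArg (fun g => (-1) ^ k * MvPowerSeries.coeff (Finsupp.single i₀ k + β) g) hP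
    simp only [map_zero, mul_zero] at h1
    rw [map_zero, ← h1, map_sum, map_sum, Finset.mul_sum]
    refine Finset.sum_congr rfl fun x _ => ?_
    rw [← map_intCast (MvPowerSeries.C (σ := Fin n) (R := ℚ)), MvPowerSeries.coeff_C_mul,
      auxMonomial, ← hε, mul_left_comm]
    split_ifs with hxβ
    · have hq : Polynomial.coeToPowerSeries.ringHom (Polynomial.C (P x : ℚ) *
          (-Polynomial.X) ^ (x.1 i₀ : ℕ)) = (C (P x : ℚ) * (-X) ^ (ε x.1 i₀) : PowerSeries ℚ) := by
        rw [hεi, map_mul, map_pow, map_neg]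
        simp only [Polynomial.coeToPowerSeries.ringHom_apply, Polynomial.coe_C, Polynomial.coe_X]
      rw [← hxβ, coeff_monomial_mul_of_restrict (hFY x.2), Polynomial.eval₂_monomial, hq, mul_assoc,
        coeff_C_mul]
    · rcases eq_or_ne (P x) 0 with h2 | h2
      · simp [h2]
      · rw [← hββ, coeff_monomial_mul_eq_zero _ _ hxβ, mul_zero, mul_zero, Polynomial.eval₂_zero,
          map_zero]
        rw [hβ]
        exact hmin x (by simpa using h2)

section
variable {n : ℕ}

theorem map_X_mul_C_single (j : Fin n) :
    MvPowerSeries.map (algebraMap ℚ (LaurentSeries ℚ)) (MvPowerSeries.X j) *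
      MvPowerSeries.C (HahnSeries.single (-((j : ℤ) + 1)) (1 : ℚ)) =
    (MvPowerSeries.monomial (Finsupp.single j 1) (HahnSeries.single (-((j : ℤ) + 1)) (1 : ℚ)) :
      MvPowerSeries (Fin n) (LaurentSeries ℚ)) := by
  rw [MvPowerSeries.map_X, MvPowerSeries.X, ← MvPowerSeries.monomial_zero_eq_C_apply,
    MvPowerSeries.monomial_mul_monomial, add_zero, one_mul]

theorem univPoly_sub_one_mem_coeffsIn : univPoly n - 1 ∈ coeffsIn negInt := by
  rw [univPoly_sub_one, tauSum]
  refine sum_mem fun j _ => ?_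
  rw [map_X_mul_C_single]
  have := single_mem_negInt (w := (j : ℕ) + 1) (Nat.le_add_left 1 _) (one_mem intQ)
  push_cast at this
  exact monomial_mem_coeffsIn this _

theorem exists_mvNorm_univPoly_le {ρ : ℝ≥0∞} (h0 : ρ ≠ 0) (hρ : ρ ≠ ∞) (n : ℕ) :
    ∃ r : ℝ≥0∞, r ≠ 0 ∧ r ≤ 1 ∧ mvNorm (lNorm ρ) r (univPoly n - 1) ≤ 2⁻¹ := by
  obtain ⟨T, hT⟩ : ∃ T, T = ∑ j : Fin n, ρ ^ (-((j : ℤ) + 1)) := ⟨_, rfl⟩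
  have hTtop : T < ∞ := hT ▸ ENNReal.sum_lt_top.mpr fun j _ => ENNReal.zpow_lt_top h0 hρ _
  obtain ⟨r, hr⟩ : ∃ r, r = 2⁻¹ * (T + 1)⁻¹ := ⟨_, rfl⟩
  have hT1 : (T + 1)⁻¹ ≤ 1 := ENNReal.inv_le_one.mpr le_add_self
  refine ⟨r, ?_, ?_, ?_⟩
  · rw [hr]
    exact mul_ne_zero (by simp) (ENNReal.inv_ne_zero.mpr (by simp [hTtop.ne]))
  · rw [hr]
    exact mul_le_one' (ENNReal.inv_le_one.mpr one_le_two) hT1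
  · have NL := isExtNorm_mvNorm (σ := Fin n) (isExtNorm_lNorm h0 hρ) r
    have hterm : ∀ j : Fin n, mvNorm (lNorm ρ) r
        (MvPowerSeries.map (algebraMap ℚ (LaurentSeries ℚ)) (MvPowerSeries.X j) *
          MvPowerSeries.C (HahnSeries.single (-((j : ℤ) + 1)) (1 : ℚ))) ≤
        r * ρ ^ (-((j : ℤ) + 1)) := by
      intro j
      refine (NL.mul _ _).trans (mul_le_mul' ?_ ?_)
      · rw [mvNorm_map, mvNorm, tsum_eq_single (Finsupp.single j 1)]
        · simp [MvPowerSeries.coeff_X]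
        · intro α hα
          simp [MvPowerSeries.coeff_X, hα]
      · rw [mvNorm_C (isExtNorm_lNorm h0 hρ), lNorm_single]
        simp
    rw [univPoly_sub_one, tauSum]
    calc _ ≤ ∑ j : Fin n, r * ρ ^ (-((j : ℤ) + 1)) :=
          (NL.sum_le _ _).trans (Finset.sum_le_sum fun j _ => hterm j)
      _ = 2⁻¹ * ((T + 1)⁻¹ * T) := by rw [← Finset.mul_sum, ← hT, hr, mul_assoc]
      _ ≤ 2⁻¹ * ((T + 1)⁻¹ * (T + 1)) := by gcongr; exact le_self_add
      _ ≤ 2⁻¹ := mul_le_of_le_one_right' (ENNReal.inv_mul_le_one _)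

theorem coeff_single_expLog_univPoly_pow {a : ℕ → ℤ} {f : PowerSeries ℚ}
    (hf : f = PowerSeries.mk fun k => (a (k + 1) : ℚ)) (hn : 0 < n) (j k : ℕ) :
    MvPowerSeries.coeff (Finsupp.single (⟨0, hn⟩ : Fin n) k)
      (expLog (resMul f) (univPoly n) ^ j) =
      (-1) ^ k * coeff k ((expo fun k => (a k : ℚ)) ^ j) := by
  classical
  obtain ⟨i₀, hi₀⟩ : ∃ i₀ : Fin n, i₀ = ⟨0, hn⟩ := ⟨_, rfl⟩
  obtain ⟨x, hx⟩ : ∃ x : MvPowerSeries (Fin n) ℚ, x = -MvPowerSeries.X i₀ := ⟨_, rfl⟩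
  have hxmem : x ∈ degGE (Fin n) ℚ 1 := hx ▸ neg_mem (X_mem_degGE i₀)
  have hμ : ∀ i : Fin n, (if i = i₀ then (MvPowerSeries.X i₀ : MvPowerSeries (Fin n) ℚ) else 0) ∈
      degGE (Fin n) ℚ 1 := fun i => by
    split_ifs
    · exact X_mem_degGE i₀
    · exact zero_mem _
  have hs := HasSubst.of_constantCoeff_zero (mem_degGE_one.mp hxmem)
  have hμs := MvPowerSeries.hasSubst_of_constantCoeff_zero fun i => mem_degGE_one.mp (hμ i)
  have hrestrict : MvPowerSeries.subst
      (fun i => if i = i₀ then (MvPowerSeries.X i₀ : MvPowerSeries (Fin n) ℚ) else 0)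
      (expLog (resMul f) (univPoly n)) = (expo fun k => (a k : ℚ)).subst x := by
    rw [expLog_subst hμ univPoly_sub_one_mem, subst_univPoly hμ,
      ← expLog_one_sub (l := resMul f) hxmem (HahnSeries.single (-(1 : ℤ)) (1 : ℚ))
        (fun k => (a k : ℚ))]
    · rw [tauSum, Finset.sum_eq_single i₀, if_pos rfl, hx, map_neg, neg_mul, sub_neg_eq_add, hi₀]
      · simp
      · intro i _ hi
        rw [if_neg hi, map_zero, zero_mul]
      · exact fun h => absurd (Finset.mem_univ _) h
    · intro k hk
      rw [HahnSeries.single_pow, one_pow, nsmul_eq_mul, mul_neg, mul_one, resMul_single f hk, hf,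
        coeff_mk, Nat.sub_add_cancel hk]
  rw [← hi₀, ← coeff_single_subst_restrict, ← MvPowerSeries.coe_substAlgHom (R := ℚ) hμs, map_pow,
    MvPowerSeries.coe_substAlgHom, hrestrict, ← PowerSeries.subst_pow hs,
    PowerSeries.coeff_subst hs, finsum_eq_single _ k]
  · rw [hx, neg_pow, ← map_one (MvPowerSeries.C (σ := Fin n) (R := ℚ)), ← map_neg, ← map_pow,
      MvPowerSeries.coeff_C_mul, MvPowerSeries.coeff_X_pow, if_pos rfl, mul_one, smul_eq_mul,
      mul_comm]
  · intro m hm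
    rw [hx, neg_pow, ← map_one (MvPowerSeries.C (σ := Fin n) (R := ℚ)), ← map_neg, ← map_pow,
      MvPowerSeries.coeff_C_mul, MvPowerSeries.coeff_X_pow, if_neg, mul_zero, smul_zero]
    intro h
    exact hm (Finsupp.single_injective i₀ h).symm

end

theorem isAlgebraicPS_expo {a : ℕ → ℤ} {f : PowerSeries ℚ}
    (hf : f = PowerSeries.mk fun k => (a (k + 1) : ℚ)) (halg : IsAlgebraicPS f) {B : ℕ}
    (hB : ∀ p : ℕ, p.Prime → B ≤ p → DworkAt p a) : IsAlgebraicPS (expo fun k => (a k : ℚ)) := by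
  obtain ⟨ρ, h0, h1, hfρ⟩ := exists_psNorm_lt_top halg
  replace h0 := h0.ne'
  have hρ : ρ ≠ ∞ := (h1.trans_lt ENNReal.one_lt_top).ne
  obtain ⟨A⟩ := nonempty_poleAlgebra halg h0 hρ hfρ
  obtain ⟨n, hn, hnA⟩ : ∃ n, 1 ≤ n ∧ A.n₀ ≤ n := ⟨max 1 A.n₀, le_max_left _ _, le_max_right _ _⟩
  obtain ⟨r, hr0, hr1, hr⟩ := exists_mvNorm_univPoly_le h0 hρ n
  have hC : ρ * psNorm ρ f ≠ ∞ := ENNReal.mul_ne_top hρ hfρ.ne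
  have hnorm := fun (l : LaurentSeries ℚ →ₗ[ℚ] ℚ)
      (hl : ∀ g, ‖l g‖ₑ ≤ (ρ * psNorm ρ f) * lNorm ρ g) =>
    mvNorm_expLog_lt_top (l := l) (isExtNorm_lNorm h0 hρ) (lNorm_smul_le h0 hρ) hC hl
      univPoly_sub_one_mem hr
  obtain ⟨D, P, hP0, hP⟩ := exists_relation (B := B)
    (fun M => expLog_mem_denomRing hf hB univPoly_sub_one_mem_coeffsIn univPoly_sub_one_mem M)
    hr0 hr1 (hnorm (resMul f) (enorm_resMul_le h0 hρ f))
    (hnorm (-resMul f) fun g => by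
      rw [LinearMap.neg_apply, enorm_neg]
      exact enorm_resMul_le h0 hρ f g)
    (A.exists_neg_mul h0 hρ hn hnA hr)
  exact isAlgebraicPS_of_relation (coeff_single_expLog_univPoly_pow hf hn) hP0 hP

theorem IsAlgebraicPS.C_mul {Y : PowerSeries ℚ} (h : IsAlgebraicPS Y) (c : ℚ) :
    IsAlgebraicPS (C c * Y) := by
  rcases eq_or_ne c 0 with rfl | hc
  · exact ⟨Polynomial.X, Polynomial.X_ne_zero, by simp⟩
  obtain ⟨P, hP0, hP⟩ := h
  have hY : C c⁻¹ * (C c * Y) = Y := by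
    rw [← mul_assoc, ← map_mul, inv_mul_cancel₀ hc, map_one, one_mul]
  have hu : IsUnit (Polynomial.C c⁻¹ : Polynomial ℚ) :=
    Polynomial.isUnit_C.mpr (inv_ne_zero hc).isUnit
  refine ⟨P.comp (Polynomial.C (Polynomial.C c⁻¹) * Polynomial.X), fun h0 => hP0 ?_, ?_⟩
  · exact (Polynomial.comp_C_mul_X_eq_zero_iff hu.mem_nonZeroDivisors).mp h0
  · rw [Polynomial.eval₂_comp]
    simp only [Polynomial.eval₂_mul, Polynomial.eval₂_C, Polynomial.eval₂_X,
      Polynomial.coeToPowerSeries.ringHom_apply, Polynomial.coe_C]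
    rw [hY, hP]

end RankOne

/-- **Theorem 1.** Let `(a_n)_{n ≥ 1}` be integers with `f(t) = ∑_{n ≥ 1} a_n t^{n-1}` algebraic
over `ℚ(t)`. Then every power series solution `y` of `y' = f y` is algebraic over `ℚ(t)` iff for
all but finitely many primes `p` one has `a_{np} ≡ a_n (mod p)` for all `n ≥ 1`. -/
theorem algebraic_solutions_iff_congruences
    (a : ℕ → ℤ) (f : PowerSeries ℚ)
    (hf : f = PowerSeries.mk fun k => (a (k + 1) : ℚ))
    (halg : IsAlgebraicPS f) :
    (∀ y : PowerSeries ℚ, PowerSeries.derivative ℚ y = f * y → IsAlgebraicPS y) ↔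
      (∃ B : ℕ, ∀ p : ℕ, p.Prime → B ≤ p →
        ∀ n : ℕ, 1 ≤ n → (p : ℤ) ∣ a (n * p) - a n) := by
  have hY : PowerSeries.derivative ℚ (RankOne.expo fun k => (a k : ℚ)) =
      f * RankOne.expo fun k => (a k : ℚ) := by
    rw [hf]
    exact RankOne.derivative_expo _
  refine ⟨fun h => RankOne.congruences_of_isAlgebraicPS a (h _ hY), fun ⟨B, hB⟩ y hy => ?_⟩
  rw [RankOne.eq_C_mul_of_derivative_eq_mul hy hY (RankOne.constantCoeff_expo _)]
  exact RankOne.IsAlgebraicPS.C_mul (RankOne.isAlgebraicPS_expo hf halg hB) _
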